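/- Linear dependence of the two cutting conditions in the symplectic case: Let {R,F} be a compatible pair of R-matrices on V = ℂ^N with F strict skew invertible and R skew invertible of BMW type with μ = −q^{−1−2k}, and suppose the antisymmetrizers A^(i) are defined for 1 ≤ i ≤ k+1. Then for every m ≥ 0 the descendants satisfy B^(m+1,k+1) + q·A^(m−1,k+1)·g = 0 as an identity of N×N matrices over M(R,F), where g multiplies the matrix entries on the right. -/

import Mathlib

open scoped BigOperators
open Matrix

noncomputable section

namespace QMA

/-- The space of operators on `V^{⊗ n}` (matrices indexed by multi-indices),
    with entries in `A`, where `V = ℂ^N`. -/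
abbrev MatV (N n : ℕ) (A : Type*) := Matrix (Fin n → Fin N) (Fin n → Fin N) A

variable {N : ℕ} [NeZero N] {A : Type*}

/-- The `j`-th component of a multi-index (junk value if out of range). -/
def idx {n : ℕ} (a : Fin n → Fin N) (j : ℕ) : Fin N :=
  if h : j < n then a ⟨j, h⟩ else ⟨0, Nat.pos_of_ne_zero (NeZero.ne N)⟩

/-- Place a two-factor operator `X` on the (0-indexed) tensor factors `p, p+1`
    of `V^{⊗ n}`, acting as the identity elsewhere. -/
def lift2 [Semiring A] {n : ℕ} (p : ℕ) (X : MatV N 2 A) : MatV N n A :=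
  fun a b =>
    if ∀ m : Fin n, (m : ℕ) = p ∨ (m : ℕ) = p + 1 ∨ a m = b m then
      X ![idx a p, idx a (p + 1)] ![idx b p, idx b (p + 1)]
    else 0

/-- Place a one-factor operator `X` on the (0-indexed) tensor factor `p`
    of `V^{⊗ n}`, acting as the identity elsewhere. -/
def lift1 [Semiring A] {n : ℕ} (p : ℕ) (X : Matrix (Fin N) (Fin N) A) : MatV N n A :=
  fun a b =>
    if ∀ m : Fin n, (m : ℕ) = p ∨ a m = b m then X (idx a p) (idx b p) else 0

/-- Extend an operator on `V^{⊗ n}` to `V^{⊗ (n+1)}` by the identity on the last factor. -/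
def ext1 [Semiring A] {n : ℕ} (X : MatV N n A) : MatV N (n + 1) A :=
  fun a b =>
    if a (Fin.last n) = b (Fin.last n) then X (fun t => a t.castSucc) (fun t => b t.castSucc)
    else 0

/-- The partial trace over the last tensor factor, weighted by the matrix `D`. -/
def ptrace [NonUnitalNonAssocSemiring A] {n : ℕ} (D : Matrix (Fin N) (Fin N) A)
    (X : MatV N (n + 1) A) : MatV N n A :=
  fun a b => ∑ m : Fin N, ∑ c : Fin N, D m c * X (Fin.snoc a c) (Fin.snoc b m)

/-- The full `D`-weighted trace over all `n` tensor factors. -/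
def trAll [NonUnitalNonAssocSemiring A] (D : Matrix (Fin N) (Fin N) A) :
    (n : ℕ) → MatV N n A → A
  | 0, X => X (fun i => i.elim0) (fun i => i.elim0)
  | n + 1, X => trAll D n (ptrace D X)

/-- The `D`-weighted trace over all tensor factors except the first. -/
def trTail [NonUnitalNonAssocSemiring A] (D : Matrix (Fin N) (Fin N) A) :
    (j : ℕ) → MatV N (j + 1) A → MatV N 1 A
  | 0, X => X
  | j + 1, X => trTail D j (ptrace D X)

/-- Identify operators on `V^{⊗1}` with `N × N` matrices. -/
def toN (X : MatV N 1 A) : Matrix (Fin N) (Fin N) A := fun i j => X (fun _ => i) (fun _ => j)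

/-- Entrywise embedding of complex matrices into matrices over a `ℂ`-algebra. -/
def cmap [Ring A] [Algebra ℂ A] {m : Type*} (X : Matrix m m ℂ) : Matrix m m A :=
  X.map (algebraMap ℂ A)

/-- Multiply all entries of a matrix by `c` on the right. -/
def rmulE [Mul A] {m : Type*} (X : Matrix m m A) (c : A) : Matrix m m A := fun a b => X a b * c

/-- Multiply all entries of a matrix by `c` on the left. -/
def lmulE [Mul A] {m : Type*} (c : A) (X : Matrix m m A) : Matrix m m A := fun a b => c * X a b

/-- The operator `D` associated with a skew inverse `Ψ`: `D_1 = Tr_(2) Ψ₁₂`. -/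
def Dof (Ψ : MatV N 2 ℂ) : Matrix (Fin N) (Fin N) ℂ :=
  fun i j => ∑ m : Fin N, Ψ ![i, m] ![j, m]

/-- `Ψ` is a skew inverse of the R-matrix `R`:
    `Tr_(2)(R₁₂ Ψ₂₃) = Tr_(2)(Ψ₁₂ R₂₃) = P₁₃`. -/
def SkewPair (R Ψ : MatV N 2 ℂ) : Prop :=
  (∀ a1 a3 b1 b3 : Fin N,
      (∑ m : Fin N, ∑ c : Fin N, R ![a1, m] ![b1, c] * Ψ ![c, a3] ![m, b3]) =
        if a1 = b3 ∧ a3 = b1 then 1 else 0) ∧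
  (∀ a1 a3 b1 b3 : Fin N,
      (∑ m : Fin N, ∑ c : Fin N, Ψ ![a1, m] ![b1, c] * R ![c, a3] ![m, b3]) =
        if a1 = b3 ∧ a3 = b1 then 1 else 0)

/-- The `q`-number `j_q = (q^j - q^{-j})/(q - q^{-1})`. -/
def nq (q : ℂ) (j : ℕ) : ℂ := (q ^ (j : ℤ) - q ^ (-(j : ℤ))) / (q - q⁻¹)

/-- The rank-one projector `K = μ⁻¹ (q-q⁻¹)⁻¹ (qI - R)(q⁻¹I + R)` of a BMW-type R-matrix. -/
def bmwK (q μ : ℂ) (R : MatV N 2 ℂ) : MatV N 2 ℂ :=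
  (μ⁻¹ * (q - q⁻¹)⁻¹) • ((q • (1 : MatV N 2 ℂ) - R) * (q⁻¹ • (1 : MatV N 2 ℂ) + R))

/-- The braid relation `R₁ R₂ R₁ = R₂ R₁ R₂`. -/
def IsBraid (R : MatV N 2 ℂ) : Prop :=
  lift2 (n := 3) 0 R * lift2 1 R * lift2 0 R = lift2 1 R * lift2 0 R * lift2 1 R

/-- `R` is an R-matrix of BMW type with eigenvalues `q, -q⁻¹, μ`. -/
def IsBMW (q μ : ℂ) (R : MatV N 2 ℂ) : Prop :=
  (q • (1 : MatV N 2 ℂ) - R) * (q⁻¹ • (1 : MatV N 2 ℂ) + R) * (μ • (1 : MatV N 2 ℂ) - R) = 0 ∧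
  lift2 (n := 3) 1 (bmwK q μ R) * lift2 0 (bmwK q μ R) =
      lift2 1 (bmwK q μ R) * lift2 0 R * lift2 1 R ∧
  lift2 (n := 3) 1 (bmwK q μ R) * lift2 0 (bmwK q μ R) =
      lift2 1 (bmwK q μ R) * lift2 0 R⁻¹ * lift2 1 R⁻¹ ∧
  lift2 (n := 3) 0 (bmwK q μ R) * lift2 1 (bmwK q μ R) * lift2 0 (bmwK q μ R) =
      lift2 0 (bmwK q μ R)

/-- `{R, F}` is a compatible pair of R-matrices (twist relations). -/
def Compatible (R F : MatV N 2 ℂ) : Prop :=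
  lift2 (n := 3) 0 R * lift2 1 F * lift2 0 F = lift2 1 F * lift2 0 F * lift2 1 R ∧
  lift2 (n := 3) 1 R * lift2 0 F * lift2 1 F = lift2 0 F * lift2 1 F * lift2 0 R

/-- The antisymmetrizers `A^{(i)} ∈ End(V^{⊗i})` of a BMW-type R-matrix. -/
def asym (q μ : ℂ) (R : MatV N 2 ℂ) : (i : ℕ) → MatV N i ℂ
  | 0 => 1
  | 1 => 1
  | i + 2 =>
      (q ^ (i + 1) / nq q (i + 2)) •
        (ext1 (asym q μ R (i + 1)) *
          ((1 : MatV N (i + 2) ℂ) +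
              ((q ^ (-(2 * ((i : ℤ) + 1))) - 1) / (q - q⁻¹)) • lift2 i R +
              (μ * (q ^ (-(2 * ((i : ℤ) + 1))) - 1) / (μ + q ^ (1 - 2 * ((i : ℤ) + 1)))) •
                lift2 i (bmwK q μ R)) *
          ext1 (asym q μ R (i + 1)))

/-- The height-`k` cutting condition
    `A^{(k)} σ⁻_k(q^{-2k}) A^{(k)} = 0` in `End(V^{⊗(k+1)})`. -/
def HeightCut (q μ : ℂ) (R : MatV N 2 ℂ) (k : ℕ) : Prop :=
  ext1 (asym q μ R k) *
      ((1 : MatV N (k + 1) ℂ) +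
          ((q ^ (-(2 * (k : ℤ))) - 1) / (q - q⁻¹)) • lift2 (k - 1) R +
          (μ * (q ^ (-(2 * (k : ℤ))) - 1) / (μ + q ^ (1 - 2 * (k : ℤ)))) •
            lift2 (k - 1) (bmwK q μ R)) *
      ext1 (asym q μ R k) = 0

/-- `R` is an R-matrix of height `k`. -/
def HasHeight (q μ : ℂ) (R : MatV N 2 ℂ) (k : ℕ) : Prop :=
  2 ≤ k ∧ (∀ i, 2 ≤ i → i ≤ k → asym q μ R i ≠ 0) ∧ HeightCut q μ R k

section AlgebraSide

variable [Ring A] [Algebra ℂ A]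

/-- The copies `M_{(i+1)}` of the quantum matrix inside `V^{⊗n}`:
    `M_{(1)} = M₁`, `M_{(i+1)} = F_i M_{(i)} F_i⁻¹`. -/
def Mcopy {n : ℕ} (F : MatV N 2 ℂ) (M : Matrix (Fin N) (Fin N) A) : ℕ → MatV N n A
  | 0 => lift1 0 M
  | j + 1 => cmap (lift2 j F) * Mcopy F M j * cmap (lift2 j F⁻¹)

/-- The product `M_{(1)} M_{(2)} ⋯ M_{(j)}`. -/
def Mprod {n : ℕ} (F : MatV N 2 ℂ) (M : Matrix (Fin N) (Fin N) A) : ℕ → MatV N n A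
  | 0 => 1
  | j + 1 => Mprod F M j * Mcopy F M j

/-- The product `M_{(2)} M_{(3)} ⋯ M_{(j+1)}`. -/
def MprodFrom2 {n : ℕ} (F : MatV N 2 ℂ) (M : Matrix (Fin N) (Fin N) A) : ℕ → MatV N n A
  | 0 => 1
  | j + 1 => MprodFrom2 F M j * Mcopy F M (j + 1)

/-- The defining relation `R₁ M_{(1)} M_{(2)} = M_{(1)} M_{(2)} R₁` of the
    quantum matrix algebra `M(R,F)`. -/
def QMArel (R F : MatV N 2 ℂ) (M : Matrix (Fin N) (Fin N) A) : Prop :=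
  cmap (lift2 (n := 2) 0 R) * Mcopy F M 0 * Mcopy F M 1 =
    Mcopy F M 0 * Mcopy F M 1 * cmap (lift2 (n := 2) 0 R)

/-- The 2-contraction `g` of the quantum matrix `M`. -/
def gElt (q μ : ℂ) (R F ΨR : MatV N 2 ℂ) (M : Matrix (Fin N) (Fin N) A) : A :=
  (μ * (q - q⁻¹) / ((q - μ) * (q⁻¹ + μ))) •
    trAll (cmap (Dof ΨR)) 2 (Mprod F M 2 * cmap (lift2 0 (bmwK q μ R)))

/-- The elementary symmetric functions `a_i` of the quantum matrix `M`. -/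
def aElt (q μ : ℂ) (R F ΨR : MatV N 2 ℂ) (M : Matrix (Fin N) (Fin N) A) : ℕ → A
  | 0 => 1
  | i + 1 => trAll (cmap (Dof ΨR)) (i + 1) (Mprod F M (i + 1) * cmap (asym q μ R (i + 1)))

/-- The map `φ(X)₁ = Tr_{R(2)}(F₁ X₁ F₁⁻¹ R₁)`. -/
def phi (R F ΨR : MatV N 2 ℂ) (X : Matrix (Fin N) (Fin N) A) : Matrix (Fin N) (Fin N) A :=
  toN (ptrace (cmap (Dof ΨR))
    (cmap (lift2 (n := 2) 0 F) * lift1 0 X * cmap (lift2 (n := 2) 0 F⁻¹) *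
      cmap (lift2 (n := 2) 0 R)))

/-- The map `ξ(X)₁ = Tr_{R(2)}(F₁ X₁ F₁⁻¹ K₁)`. -/
def xi (q μ : ℂ) (R F ΨR : MatV N 2 ℂ) (X : Matrix (Fin N) (Fin N) A) :
    Matrix (Fin N) (Fin N) A :=
  toN (ptrace (cmap (Dof ΨR))
    (cmap (lift2 (n := 2) 0 F) * lift1 0 X * cmap (lift2 (n := 2) 0 F⁻¹) *
      cmap (lift2 (n := 2) 0 (bmwK q μ R))))

/-- The map `φ⁻¹(X)₁ = μ⁻² Tr_{R_f(2)}(F₁⁻¹ X₁ R₁⁻¹ F₁)`,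
    where the `R_f`-trace has weight `D_{F⁻¹} (D_{R⁻¹})⁻¹ D_F`. -/
def phiInv (μ : ℂ) (R F ΨF ΨFinv ΨRinv : MatV N 2 ℂ) (X : Matrix (Fin N) (Fin N) A) :
    Matrix (Fin N) (Fin N) A :=
  (μ⁻¹) ^ 2 •
    toN (ptrace (cmap (Dof ΨFinv * (Dof ΨRinv)⁻¹ * Dof ΨF))
      (cmap (lift2 (n := 2) 0 F⁻¹) * lift1 0 X * cmap (lift2 (n := 2) 0 R⁻¹) *
        cmap (lift2 (n := 2) 0 F)))

/-- Star-multiplication by `M`: `L(X) = M ⋆ X = M · φ(X)`. -/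
def Lmap (R F ΨR : MatV N 2 ℂ) (M X : Matrix (Fin N) (Fin N) A) : Matrix (Fin N) (Fin N) A :=
  M * phi R F ΨR X

/-- The star-powers `M^{[n]}` of the quantum matrix. -/
def starPow (R F ΨR : MatV N 2 ℂ) (M : Matrix (Fin N) (Fin N) A) : ℕ → Matrix (Fin N) (Fin N) A
  | 0 => 1
  | n + 1 => M * phi R F ΨR (starPow R F ΨR M n)

/-- The wedge powers `M^{a^{(i)}} = Tr_{R(2,…,i)}(M_{(1)} ⋯ M_{(i)} A^{(i)})`. -/
def Mwedge (q μ : ℂ) (R F ΨR : MatV N 2 ℂ) (M : Matrix (Fin N) (Fin N) A) :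
    ℕ → Matrix (Fin N) (Fin N) A
  | 0 => 1
  | i + 1 => toN (trTail (cmap (Dof ΨR)) i (Mprod F M (i + 1) * cmap (asym q μ R (i + 1))))

/-- The descendants `A^{(m,i)} = i_q · M^{[m]} ⋆ M^{a^{(i)}}` (here `m ≥ 0`). -/
def Ad (q μ : ℂ) (R F ΨR : MatV N 2 ℂ) (M : Matrix (Fin N) (Fin N) A) (m i : ℕ) :
    Matrix (Fin N) (Fin N) A :=
  nq q i • (Lmap R F ΨR M)^[m] (Mwedge q μ R F ΨR M i)

/-- The descendants `B^{(m,i)}`, including the boundary value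
    `B^{(0,i)} = i_q φ⁻¹(ξ(M^{a^{(i)}}))`. -/
def Bd (q μ : ℂ) (R F ΨR ΨF ΨFinv ΨRinv : MatV N 2 ℂ) (M : Matrix (Fin N) (Fin N) A) :
    ℕ → ℕ → Matrix (Fin N) (Fin N) A
  | 0, i => nq q i • phiInv μ R F ΨF ΨFinv ΨRinv (xi q μ R F ΨR (Mwedge q μ R F ΨR M i))
  | m + 1, i => nq q i • (Lmap R F ΨR M)^[m] (M * xi q μ R F ΨR (Mwedge q μ R F ΨR M i))

/-- The boundary descendant
    `A^{(-1,i)} = i_q φ⁻¹(Tr_{R(2,…,i)}(M_{(2)} ⋯ M_{(i)} A^{(i)}))`. -/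
def Aneg1 (q μ : ℂ) (R F ΨR ΨF ΨFinv ΨRinv : MatV N 2 ℂ) (M : Matrix (Fin N) (Fin N) A) :
    ℕ → Matrix (Fin N) (Fin N) A
  | 0 => 0
  | i + 1 =>
      nq q (i + 1) •
        phiInv μ R F ΨF ΨFinv ΨRinv
          (toN (trTail (cmap (Dof ΨR)) i (MprodFrom2 F M i * cmap (asym q μ R (i + 1)))))

/-- The shifted family `AdS m i = A^{(m-1,i)}` (so that `AdS 0 i = A^{(-1,i)}`). -/
def AdS (q μ : ℂ) (R F ΨR ΨF ΨFinv ΨRinv : MatV N 2 ℂ) (M : Matrix (Fin N) (Fin N) A) :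
    ℕ → ℕ → Matrix (Fin N) (Fin N) A
  | 0, i => Aneg1 q μ R F ΨR ΨF ΨFinv ΨRinv M i
  | m + 1, i => Ad q μ R F ΨR M m i

/-- The coefficients `ε_i` of the symplectic Cayley-Hamilton identity. -/
def eps (q μ : ℂ) (R F ΨR : MatV N 2 ℂ) (M : Matrix (Fin N) (Fin N) A) (k i : ℕ) : A :=
  if i ≤ k then
    ∑ j ∈ Finset.range (i / 2 + 1), aElt q μ R F ΨR M (i - 2 * j) * gElt q μ R F ΨR M ^ j
  else
    (∑ j ∈ Finset.range ((2 * k - i) / 2 + 1),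
        aElt q μ R F ΨR M (2 * k - i - 2 * j) * gElt q μ R F ΨR M ^ j) *
      gElt q μ R F ΨR M ^ (i - k)

/-- The map `π(X)₁ = Tr_{R(2)}(R₁ X₁ K₁)`. -/
def piMap (q μ : ℂ) (R ΨR : MatV N 2 ℂ) (X : Matrix (Fin N) (Fin N) A) :
    Matrix (Fin N) (Fin N) A :=
  toN (ptrace (cmap (Dof ΨR))
    (cmap (lift2 (n := 2) 0 R) * lift1 0 X * cmap (lift2 (n := 2) 0 (bmwK q μ R))))

end AlgebraSide

/-- The matrix `G₁ = Tr_(2,3)(K₂ F₁⁻¹ F₂⁻¹)`. -/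
def Gmat (q μ : ℂ) (R F : MatV N 2 ℂ) : Matrix (Fin N) (Fin N) ℂ :=
  toN (trTail (1 : Matrix (Fin N) (Fin N) ℂ) 2
    (lift2 (n := 3) 1 (bmwK q μ R) * lift2 0 F⁻¹ * lift2 1 F⁻¹))

end QMA

end

noncomputable section

namespace QMA

/-- Operators on `A`-valued functions of infinitely many tensor legs. -/
def Op (N : ℕ) (A : Type*) [Ring A] [Algebra ℂ A] := Module.End ℂ ((ℕ → Fin N) → A)

namespace Op

variable {N : ℕ} {A : Type*} [Ring A] [Algebra ℂ A]

instance : Ring (Op N A) := inferInstanceAs (Ring (Module.End ℂ ((ℕ → Fin N) → A)))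

instance : Algebra ℂ (Op N A) := inferInstanceAs (Algebra ℂ (Module.End ℂ ((ℕ → Fin N) → A)))

/-- Apply an operator to a function. -/
def app (Z : Op N A) : ((ℕ → Fin N) → A) → (ℕ → Fin N) → A :=
  fun f => (show ((ℕ → Fin N) → A) →ₗ[ℂ] ((ℕ → Fin N) → A) from Z) f

instance : CoeFun (Op N A) (fun _ => ((ℕ → Fin N) → A) → (ℕ → Fin N) → A) := ⟨app⟩

theorem ext {Z Y : Op N A} (h : ∀ f a, Z f a = Y f a) : Z = Y :=
  LinearMap.ext fun f => funext fun a => h f a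

theorem mul_apply (Z Y : Op N A) (f : (ℕ → Fin N) → A) (a : ℕ → Fin N) :
    (Z * Y) f a = Z (Y f) a := rfl

theorem one_apply (f : (ℕ → Fin N) → A) (a : ℕ → Fin N) : (1 : Op N A) f a = f a := rfl

theorem zero_apply (f : (ℕ → Fin N) → A) (a : ℕ → Fin N) : (0 : Op N A) f a = 0 := rfl

theorem add_apply (Z Y : Op N A) (f : (ℕ → Fin N) → A) (a : ℕ → Fin N) :
    (Z + Y) f a = Z f a + Y f a := rfl

theorem smul_apply (c : ℂ) (Z : Op N A) (f : (ℕ → Fin N) → A) (a : ℕ → Fin N) :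
    (c • Z) f a = c • Z f a := rfl

theorem sum_apply {ι : Type*} (u : Finset ι) (Z : ι → Op N A) (f : (ℕ → Fin N) → A)
    (a : ℕ → Fin N) : (∑ i ∈ u, Z i) f a = ∑ i ∈ u, Z i f a := by
  classical
  induction u using Finset.induction_on with
  | empty => rfl
  | insert i u hi ih => rw [Finset.sum_insert hi, Finset.sum_insert hi, add_apply, ih]

end Op

section Legs

variable {N : ℕ} {A : Type*} [Ring A] [Algebra ℂ A]

/-- The matrix unit `e_{st}` acting on leg `j`. -/
def eU (A : Type*) [Ring A] [Algebra ℂ A] (j : ℕ) (s t : Fin N) : Op N A :=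
  ({ toFun := fun f a => if a j = s then f (Function.update a j t) else 0
     map_add' := fun f g => by
      funext a; by_cases h : a j = s <;> simp [h]
     map_smul' := fun c f => by
      funext a; by_cases h : a j = s <;> simp [h] } :
    ((ℕ → Fin N) → A) →ₗ[ℂ] ((ℕ → Fin N) → A))

/-- Left multiplication by an element of `A`. -/
def gam (N : ℕ) (x : A) : Op N A :=
  ({ toFun := fun f a => x * f a
     map_add' := fun f g => by funext a; simp [mul_add]
     map_smul' := fun c f => by funext a; simp } :
    ((ℕ → Fin N) → A) →ₗ[ℂ] ((ℕ → Fin N) → A))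

/-- An `n`-leg operator with entries in `A`, placed on the legs listed by `σ`. -/
def emb {n : ℕ} (σ : Fin n → ℕ) (X : MatV N n A) : Op N A :=
  ({ toFun := fun f a => ∑ b, X (a ∘ σ) b * f (Function.extend σ b a)
     map_add' := fun f g => by funext a; simp [mul_add, Finset.sum_add_distrib]
     map_smul' := fun c f => by funext a; simp [Finset.smul_sum] } :
    ((ℕ → Fin N) → A) →ₗ[ℂ] ((ℕ → Fin N) → A))

theorem eU_apply (j : ℕ) (s t : Fin N) (f : (ℕ → Fin N) → A) (a : ℕ → Fin N) :
    eU A j s t f a = if a j = s then f (Function.update a j t) else 0 := rfl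

theorem gam_apply (x : A) (f : (ℕ → Fin N) → A) (a : ℕ → Fin N) :
    gam N x f a = x * f a := rfl

theorem emb_apply {n : ℕ} (σ : Fin n → ℕ) (X : MatV N n A) (f : (ℕ → Fin N) → A)
    (a : ℕ → Fin N) :
    emb σ X f a = ∑ b, X (a ∘ σ) b * f (Function.extend σ b a) := rfl

theorem eU_mul_same (j : ℕ) (s t u v : Fin N) :
    eU A j s t * eU A j u v = if t = u then eU A j s v else 0 := by
  refine Op.ext fun f a => ?_
  by_cases h : t = u
  · subst h; simp [Op.mul_apply, eU_apply]
  · simp [Op.mul_apply, Op.zero_apply, eU_apply, h]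

theorem eU_comm {i j : ℕ} (hij : i ≠ j) (s t u v : Fin N) :
    Commute (eU A i s t) (eU A j u v) := by
  refine Op.ext fun f a => ?_
  simp only [Op.mul_apply, eU_apply, Function.update_of_ne hij, Function.update_of_ne hij.symm,
    Function.update_comm hij]
  split_ifs <;> rfl

theorem sum_eU (j : ℕ) : ∑ s, eU A j s s = (1 : Op N A) := by
  refine Op.ext fun f a => ?_
  simp [Op.sum_apply, Op.one_apply, eU_apply]

theorem gam_comm_eU (x : A) (j : ℕ) (s t : Fin N) : Commute (gam N x) (eU A j s t) := by
  refine Op.ext fun f a => ?_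
  simp [Op.mul_apply, gam_apply, eU_apply]

theorem gam_mul (x y : A) : gam N (x * y) = gam N x * gam N y := by
  refine Op.ext fun f a => ?_
  simp [Op.mul_apply, gam_apply, mul_assoc]

theorem gam_add (x y : A) : gam N (x + y) = gam N x + gam N y := by
  refine Op.ext fun f a => ?_
  simp [gam_apply, Op.add_apply, add_mul]

theorem gam_smul (c : ℂ) (x : A) : gam N (c • x) = c • gam N x := by
  refine Op.ext fun f a => ?_
  simp [gam_apply, Op.smul_apply]

theorem emb_add {n : ℕ} (σ : Fin n → ℕ) (X Y : MatV N n A) :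
    emb σ (X + Y) = emb σ X + emb σ Y :=
  Op.ext fun f a => by simp [emb_apply, Op.add_apply, add_mul, Finset.sum_add_distrib]

theorem emb_smul {n : ℕ} (σ : Fin n → ℕ) (c : ℂ) (X : MatV N n A) :
    emb σ (c • X) = c • emb σ X :=
  Op.ext fun f a => by simp [emb_apply, Op.smul_apply, Finset.smul_sum]

theorem emb_mul {n : ℕ} {σ : Fin n → ℕ} (hσ : Function.Injective σ) (X Y : MatV N n A) :
    emb σ (X * Y) = emb σ X * emb σ Y := by
  have hext : ∀ (b c : Fin n → Fin N) (a : ℕ → Fin N),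
      Function.extend σ b (Function.extend σ c a) = Function.extend σ b a := by
    intro b c a
    funext i
    by_cases h : ∃ m, σ m = i
    · obtain ⟨m, rfl⟩ := h
      simp [hσ.extend_apply]
    · simp [Function.extend_apply' _ _ _ h]
  have hcomp : ∀ (c : Fin n → Fin N) (a : ℕ → Fin N), Function.extend σ c a ∘ σ = c := by
    intro c a; funext m; simp [hσ.extend_apply]
  refine Op.ext fun f a => ?_
  simp only [Op.mul_apply, emb_apply, Matrix.mul_apply, Finset.sum_mul, Finset.mul_sum,
    hext, hcomp, mul_assoc]
  exact Finset.sum_comm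

theorem emb_one {n : ℕ} (σ : Fin n → ℕ) : emb σ (1 : MatV N n A) = 1 := by
  have hext : ∀ a : ℕ → Fin N, Function.extend σ (a ∘ σ) a = a := by
    intro a
    funext i
    by_cases h : ∃ m, σ m = i
    · obtain ⟨m, rfl⟩ := h
      rw [show a ∘ σ = fun m => a (σ m) from rfl]
      by_cases h' : ∃ m', σ m' = σ m
      · unfold Function.extend
        rw [dif_pos h']
        exact congrArg a (Classical.choose_spec h')
      · exact absurd ⟨m, rfl⟩ h'
    · simp [Function.extend_apply' _ _ _ h]
  refine Op.ext fun f a => ?_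
  simp [emb_apply, Op.one_apply, Matrix.one_apply, hext]

theorem emb_injective [NeZero N] {n : ℕ} {σ : Fin n → ℕ} (hσ : Function.Injective σ) :
    Function.Injective (emb (N := N) (A := A) σ) := by
  classical
  intro X Y h
  funext a b
  let x0 : ℕ → Fin N := fun _ => 0
  have key : ∀ Z : MatV N n A,
      emb σ Z (fun x => if x = Function.extend σ b x0 then 1 else 0) (Function.extend σ a x0)
        = Z a b := by
    intro Z
    have hc : Function.extend σ a x0 ∘ σ = a := by funext m; simp [hσ.extend_apply]
    have hb : ∀ c : Fin n → Fin N,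
        Function.extend σ c (Function.extend σ a x0) = Function.extend σ b x0 ↔ c = b := by
      intro c
      constructor
      · intro hcb
        funext m
        have := congrFun hcb (σ m)
        simpa [hσ.extend_apply] using this
      · rintro rfl
        funext i
        by_cases h : ∃ m, σ m = i
        · obtain ⟨m, rfl⟩ := h
          simp [hσ.extend_apply]
        · simp [Function.extend_apply' _ _ _ h]
    simp [emb_apply, hc, hb]
  rw [← key X, ← key Y, h]

/-- Operators acting on a sub-tuple of legs, as the identity on the remaining ones. -/
theorem emb_comp {n k : ℕ} {σ : Fin n → ℕ} (hσ : Function.Injective σ) {τ : Fin k → Fin n}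
    (hτ : Function.Injective τ) (X : MatV N k A) (Y : MatV N n A)
    (h1 : ∀ a b, (∀ i, i ∉ Set.range τ → a i = b i) → Y a b = X (a ∘ τ) (b ∘ τ))
    (h0 : ∀ a b, (¬ ∀ i, i ∉ Set.range τ → a i = b i) → Y a b = 0) :
    emb σ Y = emb (σ ∘ τ) X := by
  refine Op.ext fun f a => ?_
  simp only [emb_apply]
  symm
  refine Fintype.sum_of_injective (fun c : Fin k → Fin N => Function.extend τ c (a ∘ σ)) ?_ _ _ ?_ ?_
  · intro c d hcd
    funext m
    simpa [hτ.extend_apply] using congrFun hcd (τ m)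
  · intro b hb
    rw [h0, zero_mul]
    intro hall
    apply hb
    refine ⟨b ∘ τ, ?_⟩
    funext i
    by_cases h : ∃ m, τ m = i
    · obtain ⟨m, rfl⟩ := h
      simp [hτ.extend_apply]
    · simp only [Function.extend_apply' _ _ _ h]
      exact hall i h
  · intro c
    rw [h1]
    · congr 2
      · funext m; simp [hτ.extend_apply]
      · funext i
        by_cases h : ∃ m, σ m = i
        · obtain ⟨m, rfl⟩ := h
          rw [hσ.extend_apply]
          by_cases h' : ∃ l, τ l = m
          · obtain ⟨l, rfl⟩ := h'
            rw [hτ.extend_apply, show σ (τ l) = (σ ∘ τ) l from rfl, (hσ.comp hτ).extend_apply]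
          · rw [Function.extend_apply' _ _ _ h', Function.extend_apply']
            · rfl
            · rintro ⟨l, hl⟩
              exact h' ⟨l, hσ hl⟩
        · rw [Function.extend_apply' _ _ _ h, Function.extend_apply']
          rintro ⟨l, hl⟩
          exact h ⟨τ l, hl⟩
    · intro i hi
      rw [Function.extend_apply']
      exact hi

theorem injective_pair {α : Type*} {i j : α} (hij : i ≠ j) : Function.Injective ![i, j] := by
  intro a b h
  fin_cases a <;> fin_cases b <;> simp_all [hij.symm]

theorem emb_lift2 [NeZero N] {n : ℕ} {σ : Fin n → ℕ} (hσ : Function.Injective σ) {p : ℕ}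
    (hp : p + 1 < n) (X : MatV N 2 A) :
    emb σ (lift2 p X) = emb ![σ ⟨p, by omega⟩, σ ⟨p + 1, hp⟩] X := by
  have hτ : Function.Injective ![(⟨p, by omega⟩ : Fin n), ⟨p + 1, hp⟩] :=
    injective_pair (by simp [Fin.ext_iff])
  have hcomp : ∀ {β : Type _} (g : Fin n → β),
      g ∘ ![(⟨p, by omega⟩ : Fin n), ⟨p + 1, hp⟩] = ![g ⟨p, by omega⟩, g ⟨p + 1, hp⟩] := by
    intro β g; funext m; fin_cases m <;> rfl
  have hcond : ∀ a b : Fin n → Fin N,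
      (∀ i, i ∉ Set.range ![(⟨p, by omega⟩ : Fin n), ⟨p + 1, hp⟩] → a i = b i) ↔
      ∀ m : Fin n, (m : ℕ) = p ∨ (m : ℕ) = p + 1 ∨ a m = b m := by
    intro a b
    refine forall_congr' fun m => ?_
    simp only [Set.mem_range, not_exists, Fin.forall_fin_two, Matrix.cons_val_zero,
      Matrix.cons_val_one, Fin.ext_iff]
    constructor
    · intro h
      by_cases h1 : (m : ℕ) = p
      · exact Or.inl h1
      · by_cases h2 : (m : ℕ) = p + 1
        · exact Or.inr (Or.inl h2)
        · exact Or.inr (Or.inr (h ⟨fun h => h1 h.symm, fun h => h2 h.symm⟩))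
    · rintro (h | h | h) ⟨h1, h2⟩
      · exact absurd h.symm h1
      · exact absurd h.symm h2
      · exact h
  rw [← hcomp σ]
  refine emb_comp hσ hτ X _ (fun a b h => ?_) (fun a b h => ?_)
  · rw [lift2, if_pos ((hcond a b).1 h), hcomp a, hcomp b]
    simp [idx, hp, show p < n by omega]
  · rw [lift2, if_neg (fun h' => h ((hcond a b).2 h'))]

theorem emb_lift1 [NeZero N] {n : ℕ} {σ : Fin n → ℕ} (hσ : Function.Injective σ) {p : ℕ}
    (hp : p < n) (X : Matrix (Fin N) (Fin N) A) :
    emb σ (lift1 p X) = emb ![σ ⟨p, hp⟩] (fun a b => X (a 0) (b 0)) := by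
  have hτ : Function.Injective ![(⟨p, hp⟩ : Fin n)] := Function.injective_of_subsingleton _
  have hcomp : ∀ {β : Type _} (g : Fin n → β),
      g ∘ ![(⟨p, hp⟩ : Fin n)] = ![g ⟨p, hp⟩] := by
    intro β g; funext m; fin_cases m; rfl
  have hcond : ∀ a b : Fin n → Fin N,
      (∀ i, i ∉ Set.range ![(⟨p, hp⟩ : Fin n)] → a i = b i) ↔
      ∀ m : Fin n, (m : ℕ) = p ∨ a m = b m := by
    intro a b
    refine forall_congr' fun m => ?_
    simp only [Set.mem_range, not_exists, Fin.forall_fin_one, Matrix.cons_val_zero,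
      Fin.ext_iff]
    constructor
    · intro h
      by_cases h1 : (m : ℕ) = p
      · exact Or.inl h1
      · exact Or.inr (h fun h => h1 h.symm)
    · rintro (h | h) h1
      · exact absurd h.symm h1
      · exact h
  rw [← hcomp σ]
  refine emb_comp hσ hτ _ _ (fun a b h => ?_) (fun a b h => ?_)
  · rw [lift1, if_pos ((hcond a b).1 h)]
    simp [idx, hp]
  · rw [lift1, if_neg (fun h' => h ((hcond a b).2 h'))]

theorem emb_ext1 {n : ℕ} {σ : Fin (n + 1) → ℕ} (hσ : Function.Injective σ) (X : MatV N n A) :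
    emb σ (ext1 X) = emb (σ ∘ Fin.castSucc) X := by
  have hcond : ∀ a b : Fin (n + 1) → Fin N,
      (∀ i, i ∉ Set.range (Fin.castSucc : Fin n → Fin (n + 1)) → a i = b i) ↔
      a (Fin.last n) = b (Fin.last n) := by
    intro a b
    constructor
    · intro h
      exact h _ (by rintro ⟨m, hm⟩; exact Fin.castSucc_ne_last m hm)
    · intro h i hi
      rcases Fin.eq_castSucc_or_eq_last i with ⟨j, rfl⟩ | rfl
      · exact absurd ⟨j, rfl⟩ hi
      · exact h
  refine emb_comp hσ (Fin.castSucc_injective n) X _ (fun a b h => ?_) (fun a b h => ?_)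
  · rw [ext1, if_pos ((hcond a b).1 h)]; rfl
  · rw [ext1, if_neg (fun h' => h ((hcond a b).2 h'))]

/-- A one-leg complex operator. -/
def opOne (A : Type*) [Ring A] [Algebra ℂ A] (j : ℕ) (c : Matrix (Fin N) (Fin N) ℂ) : Op N A :=
  ∑ s, ∑ t, c s t • eU A j s t

/-- A two-leg complex operator. -/
def opTwo (A : Type*) [Ring A] [Algebra ℂ A] (i j : ℕ) (X : MatV N 2 ℂ) : Op N A :=
  ∑ a, ∑ b, ∑ c, ∑ d, X ![a, b] ![c, d] • (eU A i a c * eU A j b d)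

theorem sum_pair {β : Type*} [AddCommMonoid β] {n : ℕ} (f : (Fin 2 → Fin n) → β) :
    ∑ b, f b = ∑ x, ∑ y, f ![x, y] := by
  rw [← Fintype.sum_prod_type', ← (finTwoArrowEquiv (Fin n)).symm.sum_comp]
  rfl

theorem extend_pair {i j : ℕ} (hij : i ≠ j) (c d : Fin N) (a : ℕ → Fin N) :
    Function.extend ![i, j] ![c, d] a = Function.update (Function.update a i c) j d := by
  have h0 := (injective_pair hij).extend_apply ![c, d] a 0
  have h1 := (injective_pair hij).extend_apply ![c, d] a 1
  simp only [Matrix.cons_val_zero, Matrix.cons_val_one] at h0 h1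
  funext m
  by_cases hj : m = j
  · subst hj
    simpa using h1
  · by_cases hi : m = i
    · subst hi
      simpa [hj] using h0
    · rw [Function.update_of_ne hj, Function.update_of_ne hi, Function.extend_apply']
      rintro ⟨l, hl⟩
      fin_cases l
      · exact hi (by simpa using hl.symm)
      · exact hj (by simpa using hl.symm)

theorem emb_pair {i j : ℕ} (hij : i ≠ j) (X : MatV N 2 ℂ) :
    emb ![i, j] (cmap X) = opTwo A i j X := by
  refine Op.ext fun f x => ?_
  simp only [emb_apply, opTwo, Op.sum_apply, Op.smul_apply, Op.mul_apply, eU_apply, Function.update_of_ne hij.symm, sum_pair,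
    extend_pair hij]
  symm
  rw [Finset.sum_eq_single (x i), Finset.sum_eq_single (x j)]
  · simp only [if_true, cmap, Matrix.map_apply, Algebra.smul_def]
    rw [show x ∘ ![i, j] = ![x i, x j] by funext m; fin_cases m <;> rfl]
  · intro b _ hb
    simp [hb.symm]
  · simp
  · intro b _ hb
    simp [hb.symm]
  · simp

/-- The operator on leg `0` with entries in `A`. -/
def iot (X : Matrix (Fin N) (Fin N) A) : Op N A := ∑ s, ∑ t, gam N (X s t) * eU A 0 s t

theorem emb_single (X : MatV N 1 A) : emb ![0] X = iot (toN X) := by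
  have hext : ∀ (b : Fin 1 → Fin N) (a : ℕ → Fin N),
      Function.extend ![0] b a = Function.update a 0 (b 0) := by
    intro b a
    funext m
    by_cases hm : m = 0
    · subst hm
      have := (Function.injective_of_subsingleton (![0] : Fin 1 → ℕ)).extend_apply b a 0
      simpa using this
    · rw [Function.update_of_ne hm, Function.extend_apply']
      rintro ⟨l, hl⟩
      exact hm (by simpa using hl.symm)
  refine Op.ext fun f x => ?_
  simp only [emb_apply, iot, Op.sum_apply,
    Op.mul_apply, eU_apply, gam_apply, toN, hext]
  rw [Finset.sum_eq_single (x 0)]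
  · simp only [if_true]
    rw [← (Equiv.funUnique (Fin 1) (Fin N)).symm.sum_comp,
      show x ∘ ![0] = fun _ => x 0 by funext m; fin_cases m; rfl]
    rfl
  · intro b _ hb
    simp [hb.symm]
  · simp

end Legs

section Traces

variable {N : ℕ} {A : Type*} [Ring A] [Algebra ℂ A]

/-- `Z` commutes with every operator acting on leg `j` only. -/
def Off (j : ℕ) (Z : Op N A) : Prop := ∀ s t, Commute (eU A j s t) Z

namespace Off

variable {j : ℕ} {Z Y : Op N A}

theorem mul (hZ : Off j Z) (hY : Off j Y) : Off j (Z * Y) := fun s t => (hZ s t).mul_right (hY s t)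

theorem smul (hZ : Off j Z) (c : ℂ) : Off j (c • Z) := fun s t => (hZ s t).smul_right c

theorem one : Off j (1 : Op N A) := fun _ _ => Commute.one_right _

theorem sum {ι : Type*} (u : Finset ι) (f : ι → Op N A) (h : ∀ i, Off j (f i)) :
    Off j (∑ i ∈ u, f i) := fun s t => Commute.sum_right _ _ _ fun i _ => h i s t

theorem eU {i : ℕ} (h : i ≠ j) (s t : Fin N) : Off j (eU A i s t) :=
  fun u v => (eU_comm h s t u v).symm

theorem gam (x : A) : Off j (gam N x) := fun s t => (gam_comm_eU x j s t).symm

theorem opOne {i : ℕ} (h : i ≠ j) (c : Matrix (Fin N) (Fin N) ℂ) : Off j (opOne A i c) :=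
  sum _ _ fun _ => sum _ _ fun _ => (eU h _ _).smul _

theorem opTwo {a b : ℕ} (ha : a ≠ j) (hb : b ≠ j) (X : MatV N 2 ℂ) : Off j (opTwo A a b X) :=
  sum _ _ fun _ => sum _ _ fun _ => sum _ _ fun _ => sum _ _ fun _ =>
    ((eU ha _ _).mul (eU hb _ _)).smul _

theorem commute_opOne (hZ : Off j Z) (c : Matrix (Fin N) (Fin N) ℂ) :
    Commute (QMA.opOne A j c) Z :=
  Commute.sum_left _ _ _ fun s _ => Commute.sum_left _ _ _ fun t _ => (hZ s t).smul_left _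

theorem commute_opTwo {i : ℕ} (hi : Off i Z) (hj : Off j Z) (X : MatV N 2 ℂ) :
    Commute (QMA.opTwo A i j X) Z :=
  Commute.sum_left _ _ _ fun _ _ => Commute.sum_left _ _ _ fun _ _ =>
    Commute.sum_left _ _ _ fun _ _ => Commute.sum_left _ _ _ fun _ _ =>
      ((hi _ _).mul_left (hj _ _)).smul_left _

end Off

theorem Off.iot {j : ℕ} (hj : j ≠ 0) (X : Matrix (Fin N) (Fin N) A) : Off j (iot X) :=
  Off.sum _ _ fun _ => Off.sum _ _ fun _ => (Off.gam _).mul (Off.eU hj.symm _ _)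

/-- The component of `Z` along the matrix unit `e_{st}` on leg `j`. -/
def cmpt (j : ℕ) (s t : Fin N) : Op N A →ₗ[ℂ] Op N A :=
  ∑ r, LinearMap.mulLeft ℂ (eU A j r s) ∘ₗ LinearMap.mulRight ℂ (eU A j t r)

theorem cmpt_apply (j : ℕ) (s t : Fin N) (Z : Op N A) :
    cmpt j s t Z = ∑ r, eU A j r s * Z * eU A j t r := by
  simp [cmpt, LinearMap.sum_apply, mul_assoc]

/-- The trace over leg `j` with weight `W`. -/
def Tr (W : Matrix (Fin N) (Fin N) ℂ) (j : ℕ) : Op N A →ₗ[ℂ] Op N A :=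
  ∑ m, ∑ c, W m c • cmpt j c m

theorem Tr_apply (W : Matrix (Fin N) (Fin N) ℂ) (j : ℕ) (Z : Op N A) :
    Tr W j Z = ∑ m, ∑ c, W m c • cmpt j c m Z := by
  simp [Tr, LinearMap.sum_apply]

theorem cmpt_off (j : ℕ) (s t : Fin N) (Z : Op N A) : Off j (cmpt j s t Z) := by
  intro u v
  show _ * _ = _ * _
  simp only [cmpt_apply, Finset.mul_sum, Finset.sum_mul, ← mul_assoc, eU_mul_same]
  simp only [mul_assoc, eU_mul_same]
  simp

theorem sum_cmpt (j : ℕ) (Z : Op N A) : ∑ s, ∑ t, eU A j s t * cmpt j s t Z = Z := by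
  have h : ∀ s t : Fin N, eU A j s t * cmpt j s t Z = eU A j s s * (Z * eU A j t t) := by
    intro s t
    simp only [cmpt_apply, Finset.mul_sum, ← mul_assoc, eU_mul_same]
    simp
  simp only [h, ← Finset.mul_sum, ← Finset.sum_mul, sum_eU, one_mul, mul_one]

theorem cmpt_mul_left {j : ℕ} {z : Op N A} (h : Off j z) (s t : Fin N) (Z : Op N A) :
    cmpt j s t (z * Z) = z * cmpt j s t Z := by
  simp only [cmpt_apply, Finset.mul_sum]
  refine Finset.sum_congr rfl fun r _ => ?_
  rw [← mul_assoc, (h r s).eq]; simp only [mul_assoc]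

theorem cmpt_mul_right {j : ℕ} {z : Op N A} (h : Off j z) (s t : Fin N) (Z : Op N A) :
    cmpt j s t (Z * z) = cmpt j s t Z * z := by
  simp only [cmpt_apply, Finset.sum_mul]
  refine Finset.sum_congr rfl fun r _ => ?_
  rw [mul_assoc, mul_assoc, ← (h t r).eq]; simp only [mul_assoc]

theorem cmpt_off_of_ne {i j : ℕ} (hij : i ≠ j) {Z : Op N A} (h : Off i Z) (s t : Fin N) :
    Off i (cmpt j s t Z) := by
  rw [cmpt_apply]
  exact Off.sum _ _ fun r => ((Off.eU hij.symm _ _).mul h).mul (Off.eU hij.symm _ _)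

theorem Tr_off (W : Matrix (Fin N) (Fin N) ℂ) (j : ℕ) (Z : Op N A) : Off j (Tr W j Z) := by
  rw [Tr_apply]
  exact Off.sum _ _ fun m => Off.sum _ _ fun c => (cmpt_off _ _ _ _).smul _

theorem Tr_off_of {i j : ℕ} (W : Matrix (Fin N) (Fin N) ℂ) {Z : Op N A} (h : Off i Z) :
    Off i (Tr W j Z) := by
  by_cases hij : i = j
  · subst hij; exact Tr_off _ _ _
  · rw [Tr_apply]
    exact Off.sum _ _ fun m => Off.sum _ _ fun c => (cmpt_off_of_ne hij h _ _).smul _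

theorem Tr_mul_left {j : ℕ} {z : Op N A} (h : Off j z) (W : Matrix (Fin N) (Fin N) ℂ)
    (Z : Op N A) : Tr W j (z * Z) = z * Tr W j Z := by
  simp only [Tr_apply, cmpt_mul_left h, Finset.mul_sum, mul_smul_comm]

theorem Tr_mul_right {j : ℕ} {z : Op N A} (h : Off j z) (W : Matrix (Fin N) (Fin N) ℂ)
    (Z : Op N A) : Tr W j (Z * z) = Tr W j Z * z := by
  simp only [Tr_apply, cmpt_mul_right h, Finset.sum_mul, smul_mul_assoc]

theorem cmpt_cmpt {i j : ℕ} (hij : i ≠ j) (s t u v : Fin N) (Z : Op N A) :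
    cmpt i s t (cmpt j u v Z) = cmpt j u v (cmpt i s t Z) := by
  simp only [cmpt_apply j, map_sum]
  refine Finset.sum_congr rfl fun r _ => ?_
  rw [cmpt_mul_right (Off.eU hij.symm _ _), cmpt_mul_left (Off.eU hij.symm _ _)]

theorem Tr_Tr {i j : ℕ} (hij : i ≠ j) (W W' : Matrix (Fin N) (Fin N) ℂ) (Z : Op N A) :
    Tr W i (Tr W' j Z) = Tr W' j (Tr W i Z) := by
  have h : ∀ c m : Fin N, Tr W i (cmpt j c m Z) = cmpt j c m (Tr W i Z) := by
    intro c m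
    simp only [Tr_apply, map_sum, map_smul, cmpt_cmpt hij]
  simp only [Tr_apply W' j, map_sum, map_smul, h]

theorem eU_mul_opOne (j : ℕ) (s t : Fin N) (c : Matrix (Fin N) (Fin N) ℂ) :
    eU A j s t * opOne A j c = ∑ u, c t u • eU A j s u := by
  simp only [opOne, Finset.mul_sum, mul_smul_comm, eU_mul_same]
  rw [Finset.sum_eq_single t]
  · simp
  · intro b _ hb; simp [hb.symm]
  · simp

theorem opOne_mul_eU (j : ℕ) (s t : Fin N) (c : Matrix (Fin N) (Fin N) ℂ) :
    opOne A j c * eU A j s t = ∑ u, c u s • eU A j u t := by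
  simp only [opOne, Finset.sum_mul, smul_mul_assoc, eU_mul_same]
  refine Finset.sum_congr rfl fun u _ => ?_
  rw [Finset.sum_eq_single s]
  · simp
  · intro b _ hb; simp [hb]
  · simp

theorem opOne_one (j : ℕ) : opOne A j (1 : Matrix (Fin N) (Fin N) ℂ) = 1 := by
  simp [opOne, Matrix.one_apply, ite_smul, sum_eU]

theorem opOne_smul (j : ℕ) (z : ℂ) (c : Matrix (Fin N) (Fin N) ℂ) :
    opOne A j (z • c) = z • opOne A j c := by
  simp [opOne, Finset.smul_sum, smul_smul]

theorem opOne_single (j : ℕ) (s t : Fin N) :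
    opOne A j (Matrix.single s t 1) = eU A j s t := by
  rw [opOne, Finset.sum_eq_single s, Finset.sum_eq_single t]
  · simp
  · intro b _ hb; simp [hb.symm]
  · simp
  · intro b _ hb; simp [hb.symm]
  · simp

theorem Tr_opOne_left (W : Matrix (Fin N) (Fin N) ℂ) (j : ℕ) (c : Matrix (Fin N) (Fin N) ℂ)
    (Z : Op N A) : Tr W j (opOne A j c * Z) = Tr (W * c) j Z := by
  have h : ∀ s t : Fin N, cmpt j s t (opOne A j c * Z) = ∑ u, c s u • cmpt j u t Z := by
    intro s t
    simp only [cmpt_apply, ← mul_assoc, eU_mul_opOne, Finset.sum_mul, smul_mul_assoc,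
      Finset.smul_sum]
    rw [Finset.sum_comm]
  simp only [Tr_apply, h, Finset.smul_sum, smul_smul, Matrix.mul_apply, Finset.sum_smul]
  refine Finset.sum_congr rfl fun m _ => ?_
  rw [Finset.sum_comm]

theorem Tr_opOne_right (W : Matrix (Fin N) (Fin N) ℂ) (j : ℕ) (c : Matrix (Fin N) (Fin N) ℂ)
    (Z : Op N A) : Tr W j (Z * opOne A j c) = Tr (c * W) j Z := by
  have h : ∀ s t : Fin N, cmpt j s t (Z * opOne A j c) = ∑ u, c u t • cmpt j s u Z := by
    intro s t
    simp only [cmpt_apply, mul_assoc, opOne_mul_eU, Finset.mul_sum, mul_smul_comm,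
      Finset.smul_sum]
    rw [Finset.sum_comm]
  simp only [Tr_apply, h, Finset.smul_sum, smul_smul, Matrix.mul_apply, Finset.sum_smul]
  rw [Finset.sum_comm]
  rw [Finset.sum_congr rfl fun a _ => Finset.sum_comm]
  rw [Finset.sum_comm]
  simp only [mul_comm]

theorem Tr_eU (W : Matrix (Fin N) (Fin N) ℂ) (j : ℕ) (s t : Fin N) :
    Tr W j (eU A j s t) = W t s • 1 := by
  have h : ∀ c m : Fin N, cmpt j c m (eU A j s t) = if c = s ∧ t = m then 1 else 0 := by
    intro c m
    simp only [cmpt_apply, eU_mul_same, ite_mul, zero_mul]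
    by_cases h1 : c = s <;> by_cases h2 : t = m <;> simp [h1, h2, sum_eU]
  rw [Tr_apply, Finset.sum_eq_single t, Finset.sum_eq_single s]
  · simp [h]
  · intro b _ hb; simp [h, hb]
  · simp
  · intro b _ hb; simp [h, hb.symm]
  · simp

theorem Tr_opOne (W : Matrix (Fin N) (Fin N) ℂ) (j : ℕ) (c : Matrix (Fin N) (Fin N) ℂ) :
    Tr W j (opOne A j c) = (W * c).trace • 1 := by
  simp only [opOne, map_sum, map_smul, Tr_eU, smul_smul, Matrix.trace, Matrix.diag,
    Matrix.mul_apply, Finset.sum_smul]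
  rw [Finset.sum_comm]
  simp only [mul_comm]

theorem Tr_one (W : Matrix (Fin N) (Fin N) ℂ) (j : ℕ) :
    Tr W j (1 : Op N A) = W.trace • 1 := by
  have h := Tr_opOne (A := A) W j 1
  rwa [opOne_one, mul_one] at h

theorem Tr_of_off (W : Matrix (Fin N) (Fin N) ℂ) {j : ℕ} {Z : Op N A} (h : Off j Z) :
    Tr W j Z = W.trace • Z := by
  rw [← mul_one Z, Tr_mul_left h, Tr_one, mul_smul_comm]

theorem Tr_smul_weight (z : ℂ) (W : Matrix (Fin N) (Fin N) ℂ) (j : ℕ) (Z : Op N A) :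
    Tr (z • W) j Z = z • Tr W j Z := by
  simp [Tr_apply, Finset.smul_sum, smul_smul]

theorem opTwo_add (i j : ℕ) (X Y : MatV N 2 ℂ) :
    opTwo A i j (X + Y) = opTwo A i j X + opTwo A i j Y := by
  simp [opTwo, add_smul, Finset.sum_add_distrib]

theorem opTwo_smul (i j : ℕ) (z : ℂ) (X : MatV N 2 ℂ) :
    opTwo A i j (z • X) = z • opTwo A i j X := by
  simp [opTwo, Finset.smul_sum, smul_smul]

theorem opTwo_sub (i j : ℕ) (X Y : MatV N 2 ℂ) :
    opTwo A i j (X - Y) = opTwo A i j X - opTwo A i j Y := by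
  refine eq_sub_of_add_eq ?_
  rw [← opTwo_add, sub_add_cancel]

theorem cmap_mul {m : Type*} [Fintype m] (X Y : Matrix m m ℂ) :
    cmap (A := A) (X * Y) = cmap X * cmap Y := Matrix.map_mul

theorem cmap_one {m : Type*} [DecidableEq m] :
    cmap (A := A) (1 : Matrix m m ℂ) = 1 := by
  simp [cmap]

theorem opTwo_mul {i j : ℕ} (hij : i ≠ j) (X Y : MatV N 2 ℂ) :
    opTwo A i j (X * Y) = opTwo A i j X * opTwo A i j Y := by
  rw [← emb_pair hij, ← emb_pair hij, ← emb_pair hij, cmap_mul, emb_mul (injective_pair hij)]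

theorem opTwo_one {i j : ℕ} (hij : i ≠ j) : opTwo A i j (1 : MatV N 2 ℂ) = 1 := by
  rw [← emb_pair hij, cmap_one, emb_one]

theorem Tr_opTwo {i j : ℕ} (hij : i ≠ j) (W : Matrix (Fin N) (Fin N) ℂ) (X : MatV N 2 ℂ) :
    Tr W j (opTwo A i j X) = opOne A i (fun a c => ∑ d, ∑ b, W d b * X ![a, b] ![c, d]) := by
  simp only [opTwo, map_sum, map_smul, Tr_mul_left (Off.eU hij _ _), Tr_eU, opOne,
    mul_smul_comm, mul_one, smul_smul, Finset.sum_smul]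
  refine Finset.sum_congr rfl fun a _ => ?_
  rw [Finset.sum_comm]
  refine Finset.sum_congr rfl fun c _ => ?_
  rw [Finset.sum_comm]
  simp only [mul_comm]

theorem Tr_opTwo_fst {i j : ℕ} (hij : i ≠ j) (W : Matrix (Fin N) (Fin N) ℂ) (X : MatV N 2 ℂ) :
    Tr W i (opTwo A i j X) = opOne A j (fun b d => ∑ c, ∑ a, W c a * X ![a, b] ![c, d]) := by
  simp only [opTwo, map_sum, map_smul, Tr_mul_right (Off.eU hij.symm _ _), Tr_eU, opOne,
    smul_mul_assoc, one_mul, smul_smul, Finset.sum_smul]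
  rw [Finset.sum_comm]
  refine Finset.sum_congr rfl fun b _ => ?_
  rw [Finset.sum_congr rfl fun a _ => Finset.sum_comm]
  rw [Finset.sum_comm]
  refine Finset.sum_congr rfl fun d _ => ?_
  rw [Finset.sum_comm]
  simp only [mul_comm]

theorem trace_cyclic_one {W : Matrix (Fin N) (Fin N) ℂ} (j : ℕ) {c : Matrix (Fin N) (Fin N) ℂ}
    (h : W * c = c * W) (Z : Op N A) : Tr W j (opOne A j c * Z) = Tr W j (Z * opOne A j c) := by
  rw [Tr_opOne_left, Tr_opOne_right, h]

theorem trace_cyclic_two_unweighted {i j : ℕ} (hij : i ≠ j) (X : MatV N 2 ℂ) (Z : Op N A) :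
    Tr 1 i (Tr 1 j (opTwo A i j X * Z)) = Tr 1 i (Tr 1 j (Z * opTwo A i j X)) := by
  have key : ∀ a b c d : Fin N, Tr 1 i (Tr 1 j (eU A i a c * eU A j b d * Z)) =
      Tr 1 i (Tr 1 j (Z * (eU A i a c * eU A j b d))) := by
    intro a b c d
    rw [mul_assoc, Tr_mul_left (Off.eU hij _ _), ← opOne_single i, trace_cyclic_one _ (by simp),
      opOne_single, ← Tr_mul_right (Off.eU hij _ _), ← opOne_single j, mul_assoc,
      trace_cyclic_one _ (by simp), opOne_single, mul_assoc]
  simp only [opTwo, Finset.sum_mul, Finset.mul_sum, smul_mul_assoc, mul_smul_comm, map_sum,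
    map_smul, key]

theorem trace_cyclic_two {i j : ℕ} (hij : i ≠ j) {D : Matrix (Fin N) (Fin N) ℂ}
    {X : MatV N 2 ℂ}
    (h : Commute (opOne A i D * opOne A j D) (opTwo A i j X)) (Z : Op N A) :
    Tr D i (Tr D j (opTwo A i j X * Z)) = Tr D i (Tr D j (Z * opTwo A i j X)) := by
  have h1 : ∀ Y : Op N A, Tr D i (Tr D j Y) =
      Tr 1 i (Tr 1 j (opOne A i D * opOne A j D * Y)) := by
    intro Y
    rw [mul_assoc, Tr_mul_left (Off.opOne hij _), Tr_opOne_left, Tr_opOne_left, one_mul]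
  rw [h1, h1, ← mul_assoc, h.eq, mul_assoc, trace_cyclic_two_unweighted hij, mul_assoc]

theorem extend_val_snoc (n : ℕ) (b : Fin n → Fin N) (m c : Fin N) (a : ℕ → Fin N) :
    Function.extend (Fin.val : Fin (n + 1) → ℕ) (Fin.snoc b m) (Function.update a n c) n = m ∧
    Function.update (Function.extend (Fin.val : Fin (n + 1) → ℕ) (Fin.snoc b m)
      (Function.update a n c)) n (a n) = Function.extend (Fin.val : Fin n → ℕ) b a := by
  have hn := Fin.val_injective.extend_apply (Fin.snoc b m : Fin (n + 1) → Fin N)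
    (Function.update a n c) (Fin.last n)
  refine ⟨by simpa using hn, ?_⟩
  funext i
  by_cases hi : i = n
  · subst hi
    rw [Function.update_self, Function.extend_apply']
    rintro ⟨l, hl⟩
    exact absurd hl l.2.ne
  · rw [Function.update_of_ne hi]
    by_cases hlt : i < n
    · have h1 := Fin.val_injective.extend_apply (Fin.snoc b m : Fin (n + 1) → Fin N)
        (Function.update a n c) (Fin.castSucc ⟨i, hlt⟩)
      have h2 := Fin.val_injective.extend_apply b a ⟨i, hlt⟩
      rw [Fin.snoc_castSucc] at h1
      exact h1.trans h2.symm
    · rw [Function.extend_apply', Function.extend_apply', Function.update_of_ne hi]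
      · rintro ⟨l, hl⟩
        have := l.2
        omega
      · rintro ⟨l, hl⟩
        have := l.2
        omega

theorem emb_ptrace (n : ℕ) (D : Matrix (Fin N) (Fin N) ℂ) (X : MatV N (n + 1) A) :
    emb (Fin.val : Fin n → ℕ) (ptrace (cmap D) X) =
      Tr D n (emb (Fin.val : Fin (n + 1) → ℕ) X) := by
  refine Op.ext fun f a => ?_
  have hcomp : ∀ c : Fin N, (Function.update a n c) ∘ (Fin.val : Fin (n + 1) → ℕ) =
      Fin.snoc (a ∘ (Fin.val : Fin n → ℕ)) c := by
    intro c
    funext i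
    refine Fin.lastCases ?_ (fun l => ?_) i
    · simp
    · simp [Function.update_of_ne l.2.ne]
  simp only [Tr_apply, cmpt_apply, Op.sum_apply, Op.smul_apply, Op.mul_apply, eU_apply, emb_apply, Finset.sum_ite_eq,
    Finset.mem_univ, if_true, hcomp, ptrace, Finset.sum_mul]
  rw [Finset.sum_comm]
  refine Finset.sum_congr rfl fun m _ => ?_
  rw [Finset.sum_comm]
  refine Finset.sum_congr rfl fun c _ => ?_
  rw [← (Fin.snocEquiv fun _ => Fin N).sum_comp, Fintype.sum_prod_type,
    Finset.sum_eq_single m]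
  · rw [Finset.smul_sum]
    refine Finset.sum_congr rfl fun b _ => ?_
    rw [show (Fin.snocEquiv fun _ => Fin N) (m, b) = (Fin.snoc b m : Fin (n + 1) → Fin N) from rfl,
      (extend_val_snoc n b m c a).1, (extend_val_snoc n b m c a).2]
    simp [cmap, Algebra.smul_def, mul_assoc]
  · intro m' _ hm'
    refine Finset.sum_eq_zero fun b _ => ?_
    rw [show (Fin.snocEquiv fun _ => Fin N) (m', b) = (Fin.snoc b m' : Fin (n + 1) → Fin N) from rfl,
      (extend_val_snoc n b m' c a).1, if_neg hm', mul_zero]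
  · simp

/-- The iterated `D`-trace over the legs `s + 1, …, s + n`. -/
def tau (D : Matrix (Fin N) (Fin N) ℂ) (s : ℕ) : ℕ → Op N A → Op N A
  | 0, Z => Z
  | n + 1, Z => tau D s n (Tr D (s + n + 1) Z)

theorem iot_trTail (D : Matrix (Fin N) (Fin N) ℂ) (j : ℕ) (X : MatV N (j + 1) A) :
    iot (toN (trTail (cmap D) j X)) = tau D 0 j (emb (Fin.val : Fin (j + 1) → ℕ) X) := by
  induction j with
  | zero =>
    rw [trTail, tau, ← emb_single]
    congr 1
    funext m; fin_cases m; rfl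
  | succ j ih =>
    rw [trTail, tau, ih, emb_ptrace, zero_add]

theorem iot_injective [NeZero N] : Function.Injective (iot (N := N) (A := A)) := by
  intro X Y h
  let w : Matrix (Fin N) (Fin N) A → MatV N 1 A := fun Z => Matrix.of fun a b => Z (a 0) (b 0)
  have hX : ∀ Z : Matrix (Fin N) (Fin N) A, iot Z = emb ![0] (w Z) := by
    intro Z; rw [emb_single]; rfl
  rw [hX, hX] at h
  have := emb_injective (Function.injective_of_subsingleton _) h
  funext a b
  exact congrFun (congrFun this fun _ => a) fun _ => b

end Traces

section BMW

variable {B : Type*} [Ring B] [Algebra ℂ B]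

/-- The relations of a single Birman–Murakami–Wenzl generator. -/
structure BMWElt (q μ : ℂ) (r k : B) : Prop where
  rk : r * k = μ • k
  kr : k * r = μ • k
  sq : r * r = 1 + (q - q⁻¹) • r - ((q - q⁻¹) * μ) • k

/-- The relations between two neighbouring Birman–Murakami–Wenzl generators. -/
structure BMWAdj (r k r' k' : B) : Prop where
  braid : r * r' * r = r' * r * r'
  rrk : r * r' * k = k' * k
  rrk' : r' * r * k' = k * k'
  krr : k' * r * r' = k' * k
  krr' : k * r' * r = k * k'
  kkk : k * k' * k = k
  kkk' : k' * k * k' = k'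

/-- The relations of the first `n` generators of a Birman–Murakami–Wenzl algebra. -/
structure BMWChain (q μ : ℂ) (n : ℕ) (r k : ℕ → B) : Prop where
  elt : ∀ i, i < n → BMWElt q μ (r i) (k i)
  adj : ∀ i, i + 1 < n → BMWAdj (r i) (k i) (r (i + 1)) (k (i + 1))
  rr : ∀ i j, i + 2 ≤ j → j < n → Commute (r i) (r j)
  rk : ∀ i j, i + 2 ≤ j → j < n → Commute (r i) (k j)
  kr : ∀ i j, i + 2 ≤ j → j < n → Commute (k i) (r j)
  kk : ∀ i j, i + 2 ≤ j → j < n → Commute (k i) (k j)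

theorem BMWAdj.symm {B : Type*} [Ring B] {r k r' k' : B} (h : BMWAdj r k r' k') : BMWAdj r' k' r k :=
  ⟨h.braid.symm, h.rrk', h.rrk, h.krr', h.krr, h.kkk', h.kkk⟩

theorem BMWChain.mono {q μ : ℂ} {n m : ℕ} {r k : ℕ → B} (h : BMWChain q μ n r k) (hm : m ≤ n) :
    BMWChain q μ m r k :=
  ⟨fun i hi => h.elt i (by omega), fun i hi => h.adj i (by omega),
    fun i j hij hj => h.rr i j hij (by omega), fun i j hij hj => h.rk i j hij (by omega),
    fun i j hij hj => h.kr i j hij (by omega), fun i j hij hj => h.kk i j hij (by omega)⟩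

theorem BMWChain.shift {q μ : ℂ} {n m s : ℕ} {r k : ℕ → B} (h : BMWChain q μ n r k)
    (hm : s + m ≤ n) : BMWChain q μ m (fun i => r (s + i)) (fun i => k (s + i)) :=
  ⟨fun i hi => h.elt _ (by omega), fun i hi => h.adj (s + i) (by omega),
    fun i j hij hj => h.rr _ _ (by omega) (by omega),
    fun i j hij hj => h.rk _ _ (by omega) (by omega),
    fun i j hij hj => h.kr _ _ (by omega) (by omega),
    fun i j hij hj => h.kk _ _ (by omega) (by omega)⟩

theorem BMWChain.reverse {q μ : ℂ} {n : ℕ} {r k : ℕ → B} (h : BMWChain q μ n r k) :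
    BMWChain q μ n (fun i => r (n - 1 - i)) (fun i => k (n - 1 - i)) := by
  refine ⟨fun i hi => h.elt _ (by omega), fun i hi => ?_,
    fun i j hij hj => (h.rr _ _ (by omega) (by omega)).symm,
    fun i j hij hj => (h.kr _ _ (by omega) (by omega)).symm,
    fun i j hij hj => (h.rk _ _ (by omega) (by omega)).symm,
    fun i j hij hj => (h.kk _ _ (by omega) (by omega)).symm⟩
  have := (h.adj (n - 1 - (i + 1)) (by omega)).symm
  rwa [show n - 1 - (i + 1) + 1 = n - 1 - i by omega] at this

theorem BMWChain.op {q μ : ℂ} {n : ℕ} {r k : ℕ → B} (h : BMWChain q μ n r k) :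
    BMWChain q μ n (fun i => MulOpposite.op (r i)) (fun i => MulOpposite.op (k i)) := by
  refine ⟨fun i hi => ⟨?_, ?_, ?_⟩, fun i hi => ?_, fun i j hij hj => (h.rr i j hij hj).op,
    fun i j hij hj => (h.rk i j hij hj).op, fun i j hij hj => (h.kr i j hij hj).op,
    fun i j hij hj => (h.kk i j hij hj).op⟩
  · rw [← MulOpposite.op_mul, (h.elt i hi).kr, MulOpposite.op_smul]
  · rw [← MulOpposite.op_mul, (h.elt i hi).rk, MulOpposite.op_smul]
  · rw [← MulOpposite.op_mul, (h.elt i hi).sq]; simp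
  · have H := h.adj i hi
    constructor <;> simp only [← MulOpposite.op_mul, ← mul_assoc]
    · rw [H.braid]
    · rw [H.krr']
    · rw [H.krr]
    · rw [H.rrk']
    · rw [H.rrk]
    · rw [H.kkk]
    · rw [H.kkk']

/-- The coefficient of `r` in the baxterized generator. -/
def bxA (q x : ℂ) : ℂ := (x - 1) / (q - q⁻¹)

/-- The coefficient of `k` in the baxterized generator. -/
def bxB (q μ x : ℂ) : ℂ := μ * (x - 1) / (μ + q * x)

/-- The baxterized generator. -/
def bxS (q μ x : ℂ) (r k : B) : B := 1 + bxA q x • r + bxB q μ x • k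

/-- The spectral parameter of the `i`-th antisymmetrizer step. -/
def spx (q : ℂ) (i : ℕ) : ℂ := q ^ (-(2 * (i : ℤ)))

/-- The normalisation of the `i`-th antisymmetrizer step. -/
def aC (q : ℂ) (i : ℕ) : ℂ := q ^ i / nq q (i + 1)

/-- The antisymmetrizers on a chain of generators. -/
def aS (q μ : ℂ) (r k : ℕ → B) : ℕ → B
  | 0 => 1
  | 1 => 1
  | i + 2 => aC q (i + 1) • (aS q μ r k (i + 1) * bxS q μ (spx q (i + 1)) (r i) (k i) *
      aS q μ r k (i + 1))

theorem aS_congr {q μ : ℂ} {r k r' k' : ℕ → B} {n : ℕ}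
    (hr : ∀ i, i + 1 < n → r i = r' i) (hk : ∀ i, i + 1 < n → k i = k' i) :
    aS q μ r k n = aS q μ r' k' n := by
  induction n with
  | zero => rfl
  | succ n ih =>
    cases n with
    | zero => rfl
    | succ n =>
      rw [aS, aS, ih (fun i hi => hr i (by omega)) (fun i hi => hk i (by omega)),
        hr n (by omega), hk n (by omega)]

theorem aS_op {q μ : ℂ} (r k : ℕ → B) (n : ℕ) :
    aS q μ (fun i => MulOpposite.op (r i)) (fun i => MulOpposite.op (k i)) n =
      MulOpposite.op (aS q μ r k n) := by
  induction n with
  | zero => rfl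
  | succ n ih =>
    cases n with
    | zero => rfl
    | succ n =>
      rw [aS, aS, ih]
      simp [bxS, mul_assoc]

theorem aS_slide {q μ : ℂ} {r k r' k' : ℕ → B} {n : ℕ} {κ : B}
    (hr : ∀ i, i + 1 < n → r i * κ = κ * r' i) (hk : ∀ i, i + 1 < n → k i * κ = κ * k' i) :
    aS q μ r k n * κ = κ * aS q μ r' k' n := by
  induction n with
  | zero => simp [aS]
  | succ n ih =>
    cases n with
    | zero => simp [aS]
    | succ n =>
      have ih := ih (fun i hi => hr i (by omega)) (fun i hi => hk i (by omega))
      have hσ : bxS q μ (spx q (n + 1)) (r n) (k n) * κ =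
          κ * bxS q μ (spx q (n + 1)) (r' n) (k' n) := by
        simp only [bxS, add_mul, mul_add, one_mul, mul_one, smul_mul_assoc, mul_smul_comm,
          hr n (by omega), hk n (by omega)]
      rw [aS, aS, smul_mul_assoc, mul_smul_comm]
      congr 1
      rw [mul_assoc, ih, mul_assoc, ← mul_assoc _ κ, hσ, ← mul_assoc, ← mul_assoc, ih]
      simp only [mul_assoc]

theorem aS_commute {q μ : ℂ} {r k : ℕ → B} {n : ℕ} {z : B}
    (hr : ∀ i, i + 1 < n → Commute (r i) z) (hk : ∀ i, i + 1 < n → Commute (k i) z) :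
    Commute (aS q μ r k n) z := aS_slide (fun i hi => hr i hi) (fun i hi => hk i hi)

/-- `Z` is an antisymmetric left eigenvector of the first `n` generators. -/
def LAnti (q : ℂ) (n : ℕ) (r k : ℕ → B) (Z : B) : Prop :=
  ∀ i, i < n → r i * Z = (-q⁻¹) • Z ∧ k i * Z = 0

/-- The genericity conditions under which `n + 1` antisymmetrizers exist. -/
structure Generic (q μ : ℂ) (n : ℕ) : Prop where
  q0 : q ≠ 0
  lam : q - q⁻¹ ≠ 0
  mu : μ ≠ 0
  nq : ∀ i, 2 ≤ i → i ≤ n + 1 → nq q i ≠ 0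
  den : ∀ i : ℕ, 1 ≤ i → i ≤ n → μ + q * spx q i ≠ 0

theorem Generic.mono {q μ : ℂ} {n m : ℕ} (h : Generic q μ n) (hm : m ≤ n) : Generic q μ m :=
  ⟨h.q0, h.lam, h.mu, fun i h1 h2 => h.nq i h1 (by omega), fun i h1 h2 => h.den i h1 (by omega)⟩

theorem sq_sub_one_ne {q : ℂ} (hl : q - q⁻¹ ≠ 0) : q ^ 2 - 1 ≠ 0 := by
  rintro h0
  have hq : q ≠ 0 := by rintro rfl; simp at hl
  apply hl
  field_simp
  rw [h0, mul_zero]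

theorem aC_norm {q μ : ℂ} {n : ℕ} (h : Generic q μ n) {i : ℕ} (h1 : 1 ≤ i) (h2 : i ≤ n) :
    aC q i * (1 - bxA q (spx q i) * q⁻¹) = 1 := by
  have hn := h.nq (i + 1) (by omega) (by omega)
  have hq := h.q0
  have hl := h.lam
  have key : nq q (i + 1) = q ^ i * (1 - bxA q (spx q i) * q⁻¹) := by
    rw [nq, bxA, spx]
    have e1 : q ^ (-(2 * (i : ℤ))) = (q ^ i)⁻¹ * (q ^ i)⁻¹ := by
      rw [_root_.zpow_neg, two_mul, zpow_add₀ hq, zpow_natCast, mul_inv]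
    have e2 : q ^ (-((i + 1 : ℕ) : ℤ)) = (q ^ i)⁻¹ * q⁻¹ := by
      rw [_root_.zpow_neg, zpow_natCast, pow_succ, mul_inv]
    rw [e1, e2, zpow_natCast, pow_succ]
    have hqi : q ^ i ≠ 0 := pow_ne_zero _ hq
    generalize q ^ i = y at *
    have hl' := sq_sub_one_ne hl
    field_simp
    ring
  rw [aC, div_mul_eq_mul_div, ← key, div_self hn]

theorem bxS_mul_anti {q μ x : ℂ} {r k Z : B} (hr : r * Z = (-q⁻¹) • Z) (hk : k * Z = 0) :
    bxS q μ x r k * Z = (1 - bxA q x * q⁻¹) • Z := by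
  rw [bxS, add_mul, add_mul, smul_mul_assoc, smul_mul_assoc, hr, hk, one_mul]
  module

theorem aS_mul_anti {q μ : ℂ} {n : ℕ} (h : Generic q μ n) {r k : ℕ → B} {Z : B}
    (hZ : LAnti q n r k Z) : aS q μ r k (n + 1) * Z = Z := by
  induction n with
  | zero => simp [aS]
  | succ n ih =>
    have ih := ih (h.mono (by omega)) (fun i hi => hZ i (by omega))
    rw [aS, smul_mul_assoc, mul_assoc, ih, mul_assoc,
      bxS_mul_anti (hZ n (by omega)).1 (hZ n (by omega)).2, mul_smul_comm, ih, smul_smul,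
      aC_norm h (by omega) (by omega), one_smul]

theorem k_anti_of_r {q μ : ℂ} (hq : q ≠ 0) (hl : q - q⁻¹ ≠ 0) (hμ : μ ≠ 0) {r k Z : B}
    (h : BMWElt q μ r k) (hr : r * Z = (-q⁻¹) • Z) : k * Z = 0 := by
  have h1 : r * r * Z = (1 + (q - q⁻¹) • r - ((q - q⁻¹) * μ) • k) * Z := by rw [h.sq]
  rw [mul_assoc, hr, mul_smul_comm, hr, sub_mul, add_mul, smul_mul_assoc, smul_mul_assoc, hr,
    one_mul] at h1
  have h2 : ((q - q⁻¹) * μ) • (k * Z) =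
      ((1 : ℂ) + (q - q⁻¹) * (-q⁻¹) - (-q⁻¹) * (-q⁻¹)) • Z := by
    rw [sub_smul, mul_smul (-q⁻¹), h1]
    module
  have h3 : (1 : ℂ) + (q - q⁻¹) * (-q⁻¹) - (-q⁻¹) * (-q⁻¹) = 0 := by
    field_simp; ring
  rw [h3, zero_smul] at h2
  exact (smul_eq_zero.1 h2).resolve_left (mul_ne_zero hl hμ)

theorem anti_base {q μ : ℂ} (hq : q ≠ 0) (hl : q - q⁻¹ ≠ 0) {r k : B} (h : BMWElt q μ r k)
    (hd : μ + q⁻¹ ≠ 0) :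
    r * bxS q μ (q⁻¹ * q⁻¹) r k = (-q⁻¹) • bxS q μ (q⁻¹ * q⁻¹) r k := by
  have hα : bxA q (q⁻¹ * q⁻¹) = -q⁻¹ := by
    rw [bxA]; field_simp
    have hl' := sq_sub_one_ne hl
    field_simp; ring
  have hβ : bxB q μ (q⁻¹ * q⁻¹) * (μ + q⁻¹) = μ * (q⁻¹ * q⁻¹ - 1) := by
    rw [bxB, show q * (q⁻¹ * q⁻¹) = q⁻¹ by field_simp, div_mul_cancel₀ _ hd]
  rw [bxS, hα, mul_add, mul_add, mul_one, mul_smul_comm, mul_smul_comm, h.rk, h.sq]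
  generalize bxB q μ (q⁻¹ * q⁻¹) = b at *
  match_scalars
  · field_simp; ring
  · ring
  · have : b * μ = μ * (q⁻¹ * q⁻¹ - 1) - b * q⁻¹ := by rw [← hβ]; ring
    simp only [mul_one]
    rw [this]; field_simp; ring

theorem anti_step {q μ y : ℂ} (hq : q ≠ 0) (hl : q - q⁻¹ ≠ 0) {r k r' k' a : B}
    (h' : BMWElt q μ r' k') (H : BMWAdj r k r' k') (hd : μ + q * y ≠ 0)
    (hd' : μ + q * (y * (q⁻¹ * q⁻¹)) ≠ 0) (hr : r * a = (-q⁻¹) • a) (hk : k * a = 0) :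
    r' * (bxS q μ y r k * (bxS q μ (y * (q⁻¹ * q⁻¹)) r' k' * a)) =
      (-q⁻¹) • (bxS q μ y r k * (bxS q μ (y * (q⁻¹ * q⁻¹)) r' k' * a)) := by
  have e1 : k * (r' * a) = (-q) • (k * (k' * a)) := by
    have : k * r' * r * a = k * k' * a := by rw [H.krr']
    rw [mul_assoc, hr, mul_smul_comm, mul_assoc, mul_assoc] at this
    rw [← this, smul_smul]
    simp [hq]
  have e2 : r' * (r' * a) = a + (q - q⁻¹) • (r' * a) - ((q - q⁻¹) * μ) • (k' * a) := by
    rw [← mul_assoc, h'.sq, sub_mul, add_mul, one_mul, smul_mul_assoc, smul_mul_assoc]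
  have e3 : r' * (k' * a) = μ • (k' * a) := by rw [← mul_assoc, h'.rk, smul_mul_assoc]
  have e4 : r' * (r * (r' * a)) = (-q⁻¹) • (r * (r' * a)) := by
    rw [← mul_assoc, ← mul_assoc, ← H.braid, mul_assoc, hr, mul_smul_comm, mul_assoc]
  have e5 : r' * (r * (k' * a)) = k * (k' * a) := by
    rw [← mul_assoc, ← mul_assoc, H.rrk', mul_assoc]
  have e6 : r' * (k * (k' * a)) =
      r * (k' * a) + (q - q⁻¹) • (k * (k' * a)) - (q - q⁻¹) • (k' * a) := by
    have h1 : r' * (r' * (r * (k' * a))) = r * (k' * a) + (q - q⁻¹) • (k * (k' * a)) -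
        ((q - q⁻¹) * μ) • (k' * (r * (k' * a))) := by
      rw [← mul_assoc, h'.sq, sub_mul, add_mul, one_mul, smul_mul_assoc, smul_mul_assoc, e5]
    have h2 : μ • (k' * (r * (k' * a))) = k' * a := by
      have : k' * r * r' * k' = k' := by rw [H.krr, H.kkk']
      rw [mul_assoc, h'.rk, mul_smul_comm] at this
      conv_rhs => rw [← this]
      simp only [mul_assoc, smul_mul_assoc]
    rw [e5, mul_smul, h2] at h1
    exact h1
  simp only [bxS, add_mul, mul_add, one_mul, smul_mul_assoc, mul_smul_comm, hr, hk, e1, e2, e3,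
    e4, e5, e6, smul_zero, mul_zero, smul_add, smul_sub]
  have hα : bxA q (y * (q⁻¹ * q⁻¹)) * (q - q⁻¹) = y * (q⁻¹ * q⁻¹) - 1 := div_mul_cancel₀ _ hl
  have hα' : bxA q y * (q - q⁻¹) = y - 1 := div_mul_cancel₀ _ hl
  have hβ : bxB q μ (y * (q⁻¹ * q⁻¹)) * (μ + q * (y * (q⁻¹ * q⁻¹))) =
    μ * (y * (q⁻¹ * q⁻¹) - 1) := div_mul_cancel₀ _ hd'
  have hβ' : bxB q μ y * (μ + q * y) = μ * (y - 1) := div_mul_cancel₀ _ hd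
  have hl' := sq_sub_one_ne hl
  have hd'' : μ * q + y ≠ 0 := by
    intro h0; apply hd'; field_simp; rw [h0, mul_zero]
  have h1 : q * μ + y ≠ 0 := by rwa [mul_comm]
  have h2 : μ + y * q ≠ 0 := by rwa [mul_comm y]
  match_scalars
  all_goals try simp only [bxA, bxB]
  all_goals field_simp
  all_goals ring

end BMW

section Ladder

variable {B : Type*} [Ring B]

/-- The ordered product `k s * k (s + 1) * ⋯ * k (s + n - 1)`. -/
def kap (k : ℕ → B) (s : ℕ) : ℕ → B
  | 0 => 1
  | n + 1 => kap k s n * k (s + n)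

/-- The reversed product `k (s + n - 1) * ⋯ * k (s + 1) * k s`. -/
def kapR (k : ℕ → B) (s : ℕ) : ℕ → B
  | 0 => 1
  | n + 1 => k (s + n) * kapR k s n

theorem kap_succ_left (k : ℕ → B) (s n : ℕ) : kap k s (n + 1) = k s * kap k (s + 1) n := by
  induction n with
  | zero => simp [kap]
  | succ n ih => rw [kap, ih, kap, mul_assoc, show s + (n + 1) = s + 1 + n by omega]

theorem kap_commute {k : ℕ → B} {s n : ℕ} {z : B} (h : ∀ i, i < n → Commute z (k (s + i))) :
    Commute z (kap k s n) := by
  induction n with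
  | zero => exact Commute.one_right z
  | succ n ih => exact (ih fun i hi => h i (by omega)).mul_right (h n (by omega))

theorem kap_op (k : ℕ → B) (s n : ℕ) :
    kap (fun i => MulOpposite.op (k i)) s n = MulOpposite.op (kapR k s n) := by
  induction n with
  | zero => rfl
  | succ n ih => rw [kap, ih, kapR, MulOpposite.op_mul]

theorem kapR_succ_right (k : ℕ → B) (s n : ℕ) : kapR k s (n + 1) = kapR k (s + 1) n * k s := by
  have := kap_succ_left (fun i => MulOpposite.op (k i)) s n
  rw [kap_op, kap_op, ← MulOpposite.op_mul] at this
  exact MulOpposite.op_injective this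

end Ladder

section BMW

variable {B : Type*} [Ring B] [Algebra ℂ B]

theorem spx_one (q : ℂ) : spx q 1 = q⁻¹ * q⁻¹ := by
  rw [spx, _root_.zpow_neg, ← mul_inv]
  norm_cast
  rw [mul_one, pow_two]

theorem spx_succ {q : ℂ} (hq : q ≠ 0) (i : ℕ) : spx q (i + 1) = spx q i * (q⁻¹ * q⁻¹) := by
  rw [← spx_one, spx, spx, spx, ← zpow_add₀ hq]
  congr 1
  push_cast
  ring

theorem aS_lAnti {q μ : ℂ} {n : ℕ} (h : Generic q μ n) {r k : ℕ → B}
    (hc : BMWChain q μ n r k) : LAnti q n r k (aS q μ r k (n + 1)) := by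
  have hk : ∀ i, i < n → r i * aS q μ r k (n + 1) = (-q⁻¹) • aS q μ r k (n + 1) →
      k i * aS q μ r k (n + 1) = 0 :=
    fun i hi H => k_anti_of_r h.q0 h.lam h.mu (hc.elt i hi) H
  suffices H : ∀ i, i < n → r i * aS q μ r k (n + 1) = (-q⁻¹) • aS q μ r k (n + 1) from
    fun i hi => ⟨H i hi, hk i hi (H i hi)⟩
  clear hk
  induction n using Nat.strong_induction_on with
  | _ n ih =>
  have anti : ∀ m, m < n → LAnti q m r k (aS q μ r k (m + 1)) := by
    intro m hm i hi
    have H := ih m hm (h.mono hm.le) (hc.mono hm.le) i hi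
    exact ⟨H, k_anti_of_r h.q0 h.lam h.mu (hc.elt i (by omega)) H⟩
  intro i hi
  obtain _ | n := n
  · omega
  rw [aS, mul_smul_comm, smul_comm (-q⁻¹)]
  congr 1
  rcases Nat.lt_succ_iff_lt_or_eq.1 hi with hi' | rfl
  · rw [← mul_assoc, ← mul_assoc, (anti n (by omega) i hi').1]
    simp only [smul_mul_assoc]
  obtain _ | n := i
  · rw [zero_add, spx_one, aS, one_mul, mul_one]
    refine anti_base h.q0 h.lam (hc.elt 0 (by omega)) ?_
    have := h.den 1 le_rfl (by omega)
    rwa [spx_one, show q * (q⁻¹ * q⁻¹) = q⁻¹ by rw [← mul_assoc, mul_inv_cancel₀ h.q0, one_mul]]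
      at this
  · set A := aS q μ r k (n + 2) with hA
    set A' := aS q μ r k (n + 1) with hA'
    have hAA : A' * A = A :=
      aS_mul_anti (h.mono (by omega)) (fun j hj => anti (n + 1) (by omega) j (by omega))
    have hcr : Commute A' (r (n + 1)) := aS_commute
      (fun j hj => hc.rr _ _ (by omega) (by omega)) (fun j hj => hc.kr _ _ (by omega) (by omega))
    have hck : Commute A' (k (n + 1)) := aS_commute
      (fun j hj => hc.rk _ _ (by omega) (by omega)) (fun j hj => hc.kk _ _ (by omega) (by omega))
    have hcσ : Commute A' (bxS q μ (spx q (n + 1 + 1)) (r (n + 1)) (k (n + 1))) :=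
      ((Commute.one_right _).add_right (hcr.smul_right _)).add_right (hck.smul_right _)
    have key : A * bxS q μ (spx q (n + 1 + 1)) (r (n + 1)) (k (n + 1)) * A = aC q (n + 1) •
        (A' * (bxS q μ (spx q (n + 1)) (r n) (k n) *
          (bxS q μ (spx q (n + 1 + 1)) (r (n + 1)) (k (n + 1)) * A))) := by
      conv_lhs => enter [1, 1]; rw [hA, aS]
      rw [smul_mul_assoc, smul_mul_assoc, ← hA']
      congr 1
      rw [mul_assoc, mul_assoc, mul_assoc, ← mul_assoc A' _ A, hcσ.eq, mul_assoc _ A' A, hAA]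
    have ha := anti (n + 1) (by omega) n (by omega)
    have hd := h.den (n + 1) (by omega) (by omega)
    have hd' := h.den (n + 1 + 1) (by omega) (by omega)
    have st := anti_step h.q0 h.lam (hc.elt (n + 1) (by omega)) (hc.adj n (by omega)) hd
      (by rwa [← spx_succ h.q0]) ha.1 ha.2
    rw [← spx_succ h.q0, ← hA] at st
    rw [key, mul_smul_comm, ← mul_assoc, ← hcr.eq, mul_assoc, st, mul_smul_comm,
      smul_comm (-q⁻¹)]

theorem aS_rAnti {q μ : ℂ} {n : ℕ} (h : Generic q μ n) {r k : ℕ → B}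
    (hc : BMWChain q μ n r k) {i : ℕ} (hi : i < n) :
    aS q μ r k (n + 1) * r i = (-q⁻¹) • aS q μ r k (n + 1) ∧ aS q μ r k (n + 1) * k i = 0 := by
  have H := aS_lAnti h hc.op i hi
  rw [aS_op, ← MulOpposite.op_mul, ← MulOpposite.op_mul, ← MulOpposite.op_smul] at H
  exact ⟨MulOpposite.op_injective H.1, MulOpposite.op_injective H.2⟩

theorem mul_aS_of_anti {q μ : ℂ} {n : ℕ} (h : Generic q μ n) {r k : ℕ → B} {Z : B}
    (hZ : ∀ i, i < n → Z * r i = (-q⁻¹) • Z ∧ Z * k i = 0) : Z * aS q μ r k (n + 1) = Z := by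
  have H : LAnti q n (fun i => MulOpposite.op (r i)) (fun i => MulOpposite.op (k i))
      (MulOpposite.op Z) := fun i hi => by
    rw [← MulOpposite.op_mul, ← MulOpposite.op_mul, (hZ i hi).1, (hZ i hi).2]
    exact ⟨by simp, rfl⟩
  have := aS_mul_anti h H
  rw [aS_op, ← MulOpposite.op_mul] at this
  exact MulOpposite.op_injective this

theorem aS_reverse {q μ : ℂ} {n : ℕ} (h : Generic q μ n) {r k : ℕ → B}
    (hc : BMWChain q μ n r k) :
    aS q μ (fun i => r (n - 1 - i)) (fun i => k (n - 1 - i)) (n + 1) = aS q μ r k (n + 1) := by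
  have h1 := aS_lAnti h hc.reverse
  rw [← aS_mul_anti h (r := r) (k := k)
    (Z := aS q μ (fun i => r (n - 1 - i)) (fun i => k (n - 1 - i)) (n + 1))]
  · exact mul_aS_of_anti h fun i hi => aS_rAnti h hc (by omega)
  · intro i hi
    have := h1 (n - 1 - i) (by omega)
    beta_reduce at this
    rwa [show n - 1 - (n - 1 - i) = i by omega] at this

theorem aS_succ_left {q μ : ℂ} {n : ℕ} (h : Generic q μ (n + 1)) {r k : ℕ → B}
    (hc : BMWChain q μ (n + 1) r k) :
    aS q μ r k (n + 2) = aC q (n + 1) • (aS q μ (fun i => r (1 + i)) (fun i => k (1 + i)) (n + 1) *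
      bxS q μ (spx q (n + 1)) (r 0) (k 0) *
        aS q μ (fun i => r (1 + i)) (fun i => k (1 + i)) (n + 1)) := by
  rw [← aS_reverse h hc, aS, ← aS_reverse (h.mono (by omega)) (hc.shift (m := n) (s := 1)
    (by omega))]
  have e : aS q μ (fun i => r (n + 1 - 1 - i)) (fun i => k (n + 1 - 1 - i)) (n + 1) =
      aS q μ (fun i => r (1 + (n - 1 - i))) (fun i => k (1 + (n - 1 - i))) (n + 1) :=
    aS_congr (fun i hi => by congr 1; omega) (fun i hi => by congr 1; omega)
  rw [e]
  simp

theorem r_mul_kkk {q μ : ℂ} {n : ℕ} {r k : ℕ → B} (hc : BMWChain q μ n r k) {i : ℕ}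
    (hi : i + 2 < n) :
    r (i + 2) * (k i * k (i + 1) * k (i + 2)) = k i * k (i + 1) * k (i + 2) * r i := by
  have a := hc.adj i (by omega)
  have b := hc.adj (i + 1) (by omega)
  have e1 : r (i + 1) * r (i + 2) * k (i + 1) * k (i + 2) = k (i + 2) := by rw [b.rrk, b.kkk']
  have e2 : k i * k (i + 1) * r i * r (i + 1) = k i := by
    rw [mul_assoc (k i * _), mul_assoc (k i), ← mul_assoc (k (i + 1)), a.krr, ← mul_assoc, a.kkk]
  have c1 := hc.kr i (i + 2) le_rfl hi
  have c2 := hc.rk i (i + 2) le_rfl hi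
  calc r (i + 2) * (k i * k (i + 1) * k (i + 2))
      = k i * (r (i + 2) * k (i + 1) * k (i + 2)) := by
        rw [mul_assoc (k i), ← mul_assoc, ← c1.eq]; simp only [mul_assoc]
    _ = k i * k (i + 1) * r i * (r (i + 1) * r (i + 2) * k (i + 1) * k (i + 2)) := by
        conv_lhs => rw [← e2]
        simp only [mul_assoc]
    _ = k i * k (i + 1) * k (i + 2) * r i := by
        rw [e1, mul_assoc (k i * _), c2.eq]; simp only [mul_assoc]

theorem k_mul_kkk {q μ : ℂ} {n : ℕ} {r k : ℕ → B} (hc : BMWChain q μ n r k) {i : ℕ}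
    (hi : i + 2 < n) :
    k (i + 2) * (k i * k (i + 1) * k (i + 2)) = k i * k (i + 1) * k (i + 2) * k i := by
  have a := hc.adj i (by omega)
  have b := hc.adj (i + 1) (by omega)
  have c1 := hc.kk i (i + 2) le_rfl hi
  rw [mul_assoc (k i * _), ← c1.eq, ← mul_assoc (k i * _), a.kkk, mul_assoc (k i), ← mul_assoc, ← c1.eq, mul_assoc,
    ← mul_assoc (k (i + 2)), b.kkk']

theorem slide_kap {q μ : ℂ} {m : ℕ} {r k : ℕ → B} (hc : BMWChain q μ m r k) {s n i : ℕ}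
    (hm : s + n ≤ m) (hs : s ≤ i) (hi : i + 2 < s + n) :
    r (i + 2) * kap k s n = kap k s n * r i ∧ k (i + 2) * kap k s n = kap k s n * k i := by
  induction n with
  | zero => omega
  | succ n ih =>
    rcases Nat.lt_or_ge (i + 2) (s + n) with h | h
    · obtain ⟨h1, h2⟩ := ih (by omega) h
      rw [kap, ← mul_assoc, ← mul_assoc, h1, h2, mul_assoc, mul_assoc, mul_assoc, mul_assoc,
        (hc.rk i (s + n) (by omega) (by omega)).eq, (hc.kk i (s + n) (by omega) (by omega)).eq]
      exact ⟨rfl, rfl⟩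
    · obtain ⟨p, rfl⟩ : ∃ p, i = s + p := ⟨i - s, by omega⟩
      obtain rfl : n = p + 2 := by omega
      have e : kap k s (p + 2 + 1) =
          kap k s p * (k (s + p) * k (s + p + 1) * k (s + p + 2)) := by
        simp only [kap, mul_assoc, add_assoc]
      have c1 : Commute (r (s + p + 2)) (kap k s p) :=
        kap_commute fun j hj => (hc.kr _ _ (by omega) (by omega)).symm
      have c2 : Commute (k (s + p + 2)) (kap k s p) :=
        kap_commute fun j hj => (hc.kk _ _ (by omega) (by omega)).symm
      rw [e, ← mul_assoc (r _), ← mul_assoc (k (s + p + 2)), c1.eq, c2.eq, mul_assoc _ (r _),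
        mul_assoc _ (k (s + p + 2)), r_mul_kkk hc (by omega), k_mul_kkk hc (by omega)]
      simp only [mul_assoc, and_self]

theorem slide_kapR {q μ : ℂ} {m : ℕ} {r k : ℕ → B} (hc : BMWChain q μ m r k) {s n i : ℕ}
    (hm : s + n ≤ m) (hs : s ≤ i) (hi : i + 2 < s + n) :
    kapR k s n * r (i + 2) = r i * kapR k s n ∧ kapR k s n * k (i + 2) = k i * kapR k s n := by
  have H := slide_kap hc.op hm hs hi
  rw [kap_op] at H
  exact ⟨MulOpposite.op_injective H.1, MulOpposite.op_injective H.2⟩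

/-- Contracting a ladder of cups and caps. -/
theorem kapR_mul_kap {q μ : ℂ} {m : ℕ} {r k : ℕ → B} (hc : BMWChain q μ m r k) {s n : ℕ}
    (hm : s + n < m) : kapR k (s + 1) n * k s * kap k (s + 1) n = k (s + n) := by
  induction n with
  | zero => simp [kap, kapR]
  | succ n ih =>
    have H := hc.adj (s + n) (by omega)
    have ih := ih (by omega)
    calc kapR k (s + 1) (n + 1) * k s * kap k (s + 1) (n + 1)
        = k (s + n + 1) * (kapR k (s + 1) n * k s * kap k (s + 1) n) * k (s + n + 1) := by
          rw [kap, kapR, show s + 1 + n = s + n + 1 by omega]; simp only [mul_assoc]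
      _ = _ := by rw [ih, H.kkk', add_assoc]

theorem kap_mul_kapR {q μ : ℂ} {m : ℕ} {r k : ℕ → B} (hc : BMWChain q μ m r k) {s n : ℕ}
    (hm : s + n < m) : kap k s n * k (s + n) * kapR k s n = k s := by
  induction n with
  | zero => simp [kap, kapR]
  | succ n ih =>
    have H := hc.adj (s + n) (by omega)
    have ih := ih (by omega)
    calc kap k s (n + 1) * k (s + (n + 1)) * kapR k s (n + 1)
        = kap k s n * (k (s + n) * k (s + n + 1) * k (s + n)) * kapR k s n := by
          rw [kap, kapR]; simp only [mul_assoc, add_assoc]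
      _ = _ := by rw [H.kkk, ih]

theorem kk_sandwich {q μ a : ℂ} (hq : q ≠ 0) (hμ : μ ≠ 0) {n : ℕ} {r k : ℕ → B}
    (hc : BMWChain q μ n r k) (hn : 3 ≤ n) (ha : μ⁻¹ * (1 + a * (q - q⁻¹)) = -q) :
    k 2 * k 1 * r 0 * (1 + a • r 2 + (-q⁻¹ * a) • k 2) * k 1 * k 2 =
      (-q) • (k 2 * (1 + a • r 0 + (-q⁻¹ * a) • k 0)) := by
  have A := hc.adj 0 (by omega)
  have A' := hc.adj 1 (by omega)
  have E1 := hc.elt 1 (by omega)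
  have E2 := hc.elt 2 (by omega)
  have c0 := hc.rk 0 2 le_rfl (by omega)
  have c0' := hc.kk 0 2 le_rfl (by omega)
  have e0 : k 1 * r 0 * k 1 = μ⁻¹ • k 1 := by
    have h : k 1 * r 0 * r 1 * k 1 = k 1 := by rw [A.krr, A.kkk']
    rw [mul_assoc _ (r 1), E1.rk, mul_smul_comm] at h
    rw [← h, smul_smul, inv_mul_cancel₀ hμ, one_smul, h]
  have e0' : k 2 * r 1 * k 2 = μ⁻¹ • k 2 := by
    have h : k 2 * r 1 * r 2 * k 2 = k 2 := by rw [A'.krr, A'.kkk']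
    rw [mul_assoc _ (r 2), E2.rk, mul_smul_comm] at h
    rw [← h, smul_smul, inv_mul_cancel₀ hμ, one_smul, h]
  have i1 : k 2 * (k 1 * (r 0 * (k 1 * k 2))) = μ⁻¹ • k 2 := by
    rw [← mul_assoc (r 0), ← mul_assoc (k 1), ← mul_assoc (k 1), e0, smul_mul_assoc,
      mul_smul_comm, ← mul_assoc, A'.kkk']
  have i3 : k 2 * (k 1 * (r 0 * k 2)) = k 2 * r 0 := by
    rw [c0.eq, ← mul_assoc, ← mul_assoc, A'.kkk']
  have i3' : k 2 * (k 1 * (k 0 * k 2)) = k 2 * k 0 := by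
    rw [c0'.eq, ← mul_assoc, ← mul_assoc, A'.kkk']
  have j : r 2 * (k 1 * k 2) = r 1 * k 2 + (q - q⁻¹) • (k 1 * k 2) - (q - q⁻¹) • k 2 := by
    rw [← A'.rrk', ← mul_assoc, ← mul_assoc, E2.sq, sub_mul, sub_mul, add_mul, add_mul,
      smul_mul_assoc, smul_mul_assoc, smul_mul_assoc, smul_mul_assoc, one_mul, e0', A'.rrk',
      smul_smul, mul_assoc, mul_inv_cancel₀ hμ, mul_one]
  have i2 : k 2 * (k 1 * (r 0 * (r 2 * (k 1 * k 2)))) =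
      k 2 * k 0 + ((q - q⁻¹) * μ⁻¹) • k 2 - (q - q⁻¹) • (k 2 * r 0) := by
    rw [j]
    simp only [mul_add, mul_sub, mul_smul_comm, i1, i3]
    rw [← mul_assoc (r 0), ← mul_assoc (k 1), ← mul_assoc (k 1), A.krr, mul_assoc, i3', smul_smul]
  have i4 : k 2 * (k 1 * (r 0 * (k 2 * (k 1 * k 2)))) = k 2 * r 0 := by
    rw [← mul_assoc (k 2) (k 1) (k 2), A'.kkk', i3]
  simp only [mul_add, add_mul, mul_one, mul_smul_comm, smul_mul_assoc, mul_assoc, i1, i2, i4]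
  match_scalars
  · linear_combination ha
  · field_simp
  · field_simp
    ring

theorem cap_aS_cup {q μ : ℂ} {n : ℕ} (h : Generic q μ (n + 1)) {r k : ℕ → B}
    (hc : BMWChain q μ (n + 3) r k) (hx : μ = -q⁻¹ * spx q (n + 1)) :
    kapR k 1 (n + 2) * r 0 * aS q μ (fun i => r (2 + i)) (fun i => k (2 + i)) (n + 2) *
      kap k 1 (n + 2) = (-q) • (k (n + 2) * aS q μ r k (n + 2)) := by
  have hq := h.q0
  have hl := h.lam
  have hxne : spx q (n + 1) ≠ 0 := by rintro h0; exact h.mu (by rw [hx, h0, mul_zero])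
  rw [aS_succ_left h (hc.shift (s := 2) (m := n + 1) (by omega)), aS_succ_left h (hc.mono (by omega))]
  set A1 := aS q μ (fun i => r (1 + i)) (fun i => k (1 + i)) (n + 1)
  set A3 := aS q μ (fun i => r (2 + (1 + i))) (fun i => k (2 + (1 + i))) (n + 1)
  have s1 : A3 * kap k 1 (n + 2) = kap k 1 (n + 2) * A1 :=
    aS_slide (fun i hi => by
      rw [show 2 + (1 + i) = (1 + i) + 2 by omega]
      exact (slide_kap hc (by omega) (by omega) (by omega)).1)
     (fun i hi => by
      rw [show 2 + (1 + i) = (1 + i) + 2 by omega]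
      exact (slide_kap hc (by omega) (by omega) (by omega)).2)
  have s2 : A1 * kapR k 1 (n + 2) = kapR k 1 (n + 2) * A3 :=
    aS_slide (fun i hi => by
      rw [show 2 + (1 + i) = (1 + i) + 2 by omega]
      exact (slide_kapR hc (by omega) (by omega) (by omega)).1.symm)
     (fun i hi => by
      rw [show 2 + (1 + i) = (1 + i) + 2 by omega]
      exact (slide_kapR hc (by omega) (by omega) (by omega)).2.symm)
  have c0 : Commute A3 (r 0) := aS_commute
    (fun i hi => (hc.rr _ _ (by omega) (by omega)).symm)
    (fun i hi => (hc.rk _ _ (by omega) (by omega)).symm)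
  have c1 : Commute A1 (k (n + 2)) := aS_commute
    (fun i hi => hc.rk _ _ (by omega) (by omega)) (fun i hi => hc.kk _ _ (by omega) (by omega))
  set a := bxA q (spx q (n + 1)) with ha
  have hb : bxB q μ (spx q (n + 1)) = -q⁻¹ * a := by
    have hl' := sq_sub_one_ne hl
    rw [ha, bxA, bxB, hx]
    generalize spx q (n + 1) = x at *
    have : -q⁻¹ * x + q * x = x * (q - q⁻¹) := by ring
    rw [this]
    field_simp
  have hμa : μ⁻¹ * (1 + a * (q - q⁻¹)) = -q := by
    rw [ha, bxA, div_mul_cancel₀ _ hl, hx]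
    field_simp
    ring
  have hσ : bxS q μ (spx q (n + 1)) (r (2 + 0)) (k (2 + 0)) =
      1 + a • r 2 + (-q⁻¹ * a) • k 2 := by rw [bxS, ← ha, hb]
  have hσ0 : bxS q μ (spx q (n + 1)) (r 0) (k 0) =
      1 + a • r 0 + (-q⁻¹ * a) • k 0 := by rw [bxS, ← ha, hb]
  rw [hσ, hσ0]
  have cρ : Commute (1 + a • r 0 + (-q⁻¹ * a) • k 0) (kap k 3 n) := kap_commute fun i hi =>
    ((Commute.one_left _).add_left ((hc.rk _ _ (by omega) (by omega)).smul_left _)).add_left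
      ((hc.kk _ _ (by omega) (by omega)).smul_left _)
  have key := kk_sandwich hq h.mu hc (by omega) hμa
  have hκ : kap k 1 (n + 2) = k 1 * k 2 * kap k 3 n := by
    rw [kap_succ_left, kap_succ_left, mul_assoc]
  have hκR : kapR k 1 (n + 2) = kapR k 3 n * k 2 * k 1 := by
    rw [kapR_succ_right, kapR_succ_right]
  have hρ : kapR k 3 n * k 2 * kap k 3 n = k (n + 2) := by
    rw [kapR_mul_kap hc (s := 2) (by omega), add_comm]
  have main : kapR k 1 (n + 2) * r 0 * (1 + a • r 2 + (-q⁻¹ * a) • k 2) * kap k 1 (n + 2) =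
      (-q) • (k (n + 2) * (1 + a • r 0 + (-q⁻¹ * a) • k 0)) := by
    generalize 1 + a • r 0 + (-q⁻¹ * a) • k 0 = σ0 at *
    generalize 1 + a • r 2 + (-q⁻¹ * a) • k 2 = σ2 at *
    calc _ = kapR k 3 n * (k 2 * k 1 * r 0 * σ2 * k 1 * k 2) * kap k 3 n := by
          rw [hκ, hκR]; simp only [mul_assoc]
      _ = (-q) • (kapR k 3 n * k 2 * (σ0 * kap k 3 n)) := by
          rw [key]; simp only [mul_smul_comm, smul_mul_assoc, mul_assoc]
      _ = (-q) • (kapR k 3 n * k 2 * kap k 3 n * σ0) := by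
          rw [cρ.eq]; simp only [mul_assoc]
      _ = _ := by rw [hρ]
  generalize 1 + a • r 0 + (-q⁻¹ * a) • k 0 = σ0 at *
  generalize 1 + a • r 2 + (-q⁻¹ * a) • k 2 = σ2 at *
  calc kapR k 1 (n + 2) * r 0 * aC q (n + 1) • (A3 * σ2 * A3) * kap k 1 (n + 2)
      = aC q (n + 1) • (kapR k 1 (n + 2) * (r 0 * A3) * σ2 * (A3 * kap k 1 (n + 2))) := by
        simp only [mul_smul_comm, smul_mul_assoc, mul_assoc]
    _ = aC q (n + 1) • (A1 * (kapR k 1 (n + 2) * r 0 * σ2 * kap k 1 (n + 2)) * A1) := by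
        rw [← c0.eq, s1, ← mul_assoc (kapR k 1 (n + 2)), ← s2]; simp only [mul_assoc]
    _ = (-q) • aC q (n + 1) • (A1 * k (n + 2) * σ0 * A1) := by
        rw [main, smul_comm]; simp only [mul_smul_comm, smul_mul_assoc, mul_assoc]
    _ = _ := by rw [c1.eq]; simp only [mul_smul_comm, mul_assoc]

end BMW

section Legs

variable {N : ℕ} {A : Type*} [Ring A] [Algebra ℂ A]

theorem cmap_lift2 [NeZero N] {n : ℕ} (p : ℕ) (X : MatV N 2 ℂ) :
    cmap (A := A) (lift2 (n := n) p X) = lift2 p (cmap X) := by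
  ext a b
  simp only [cmap, Matrix.map_apply, lift2]
  split_ifs <;> simp

/-- A three-leg complex operator acting on the legs `i`, `j`, `l`. -/
def opThree (A : Type*) [Ring A] [Algebra ℂ A] (i j l : ℕ) (X : MatV N 3 ℂ) : Op N A :=
  emb ![i, j, l] (cmap X)

theorem injective_triple {i j l : ℕ} (hij : i ≠ j) (hjl : j ≠ l) (hil : i ≠ l) :
    Function.Injective ![i, j, l] := by
  intro a b h
  fin_cases a <;> fin_cases b <;> simp_all

theorem opThree_mul {i j l : ℕ} (hij : i ≠ j) (hjl : j ≠ l) (hil : i ≠ l) (X Y : MatV N 3 ℂ) :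
    opThree A i j l (X * Y) = opThree A i j l X * opThree A i j l Y := by
  rw [opThree, cmap_mul, emb_mul (injective_triple hij hjl hil), opThree, opThree]

theorem opThree_lift2_zero [NeZero N] {i j l : ℕ} (hij : i ≠ j) (hjl : j ≠ l) (hil : i ≠ l)
    (X : MatV N 2 ℂ) : opThree A i j l (lift2 0 X) = opTwo A i j X := by
  rw [opThree, cmap_lift2, emb_lift2 (injective_triple hij hjl hil) (by omega), ← emb_pair hij]
  rfl

theorem opThree_lift2_one [NeZero N] {i j l : ℕ} (hij : i ≠ j) (hjl : j ≠ l) (hil : i ≠ l)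
    (X : MatV N 2 ℂ) : opThree A i j l (lift2 1 X) = opTwo A j l X := by
  rw [opThree, cmap_lift2, emb_lift2 (injective_triple hij hjl hil) (by omega), ← emb_pair hjl]
  rfl

theorem MatV.ext_pair {B : Type*} {X Y : MatV N 2 B}
    (h : ∀ a b c d, X ![a, b] ![c, d] = Y ![a, b] ![c, d]) : X = Y := by
  ext x y
  have e : ∀ z : Fin 2 → Fin N, z = ![z 0, z 1] := fun z => by
    ext i; fin_cases i <;> rfl
  rw [e x, e y, h]

theorem opTwo_injective [NeZero N] {i j : ℕ} (hij : i ≠ j) :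
    Function.Injective (opTwo (N := N) ℂ i j) := by
  intro X Y h
  rw [← emb_pair hij, ← emb_pair hij] at h
  exact emb_injective (injective_pair hij) h

/-- The tensor product of two one-leg matrices. -/
def kr (c d : Matrix (Fin N) (Fin N) ℂ) : MatV N 2 ℂ := fun x y => c (x 0) (y 0) * d (x 1) (y 1)

/-- Exchange of the two legs. -/
def sw (X : MatV N 2 ℂ) : MatV N 2 ℂ := fun x y => X ![x 1, x 0] ![y 1, y 0]

theorem opTwo_kr {i j : ℕ} (c d : Matrix (Fin N) (Fin N) ℂ) :
    opTwo A i j (kr c d) = opOne A i c * opOne A j d := by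
  rw [opTwo, opOne, opOne, Finset.sum_mul]
  refine Finset.sum_congr rfl fun a _ => ?_
  rw [Finset.sum_mul, Finset.sum_comm]
  refine Finset.sum_congr rfl fun b _ => ?_
  rw [Finset.mul_sum]
  refine Finset.sum_congr rfl fun e _ => ?_
  rw [Finset.mul_sum]
  refine Finset.sum_congr rfl fun f _ => ?_
  simp [kr, mul_comm (c a b), mul_smul]

theorem mul_apply_pair (X Y : MatV N 2 ℂ) (x y) :
    (X * Y) x y = ∑ a, ∑ b, X x ![a, b] * Y ![a, b] y := by
  rw [Matrix.mul_apply, sum_pair]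

theorem kr_mul (c d c' d' : Matrix (Fin N) (Fin N) ℂ) :
    kr c d * kr c' d' = kr (c * c') (d * d') := by
  ext x y
  rw [mul_apply_pair]
  simp only [kr, Matrix.mul_apply, Finset.sum_mul_sum]
  refine Finset.sum_congr rfl fun a _ => Finset.sum_congr rfl fun b _ => ?_
  simp
  ring

theorem kr_one : kr (1 : Matrix (Fin N) (Fin N) ℂ) 1 = 1 := by
  refine MatV.ext_pair fun a b c d => ?_
  by_cases h : a = c <;> by_cases h' : b = d <;>
    simp [kr, Matrix.one_apply, h, h', Matrix.vecCons_inj]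

theorem mul_kr_one_apply (X : MatV N 2 ℂ) (c : Matrix (Fin N) (Fin N) ℂ) (a b e f) :
    (X * kr c 1) ![a, b] ![e, f] = ∑ g, X ![a, b] ![g, f] * c g e := by
  rw [mul_apply_pair]
  simp [kr, Matrix.one_apply]

theorem mul_one_kr_apply (X : MatV N 2 ℂ) (c : Matrix (Fin N) (Fin N) ℂ) (a b e f) :
    (X * kr 1 c) ![a, b] ![e, f] = ∑ g, X ![a, b] ![e, g] * c g f := by
  rw [mul_apply_pair, Finset.sum_comm]
  refine Finset.sum_congr rfl fun g _ => ?_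
  rw [Finset.sum_eq_single e] <;> simp +contextual [kr, Matrix.one_apply]

theorem kr_one_mul_apply (X : MatV N 2 ℂ) (c : Matrix (Fin N) (Fin N) ℂ) (a b e f) :
    (kr c 1 * X) ![a, b] ![e, f] = ∑ g, c a g * X ![g, b] ![e, f] := by
  rw [mul_apply_pair]
  simp [kr, Matrix.one_apply]

theorem one_kr_mul_apply (X : MatV N 2 ℂ) (c : Matrix (Fin N) (Fin N) ℂ) (a b e f) :
    (kr 1 c * X) ![a, b] ![e, f] = ∑ g, c b g * X ![a, g] ![e, f] := by
  rw [mul_apply_pair, Finset.sum_comm]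
  refine Finset.sum_congr rfl fun g _ => ?_
  rw [Finset.sum_eq_single a] <;> simp +contextual [kr, Matrix.one_apply, eq_comm]

theorem opOne_injective [NeZero N] (j : ℕ) : Function.Injective (opOne (N := N) ℂ j) := by
  intro c d h
  have h' : opTwo ℂ j (j + 1) (kr c 1) = opTwo ℂ j (j + 1) (kr d 1) := by
    rw [opTwo_kr, opTwo_kr, h]
  have := opTwo_injective (by omega) h'
  ext a b
  have := congrFun (congrFun this ![a, a]) ![b, a]
  simpa [kr, Matrix.one_apply] using this

end Legs

section Skew

variable {N : ℕ} {A : Type*} [Ring A] [Algebra ℂ A]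

/-- The twist relations of a compatible pair, on all triples of legs. -/
def Twist (A : Type*) [Ring A] [Algebra ℂ A] (X F : MatV N 2 ℂ) : Prop :=
  ∀ i j l : ℕ, i ≠ j → j ≠ l → i ≠ l →
    opTwo A i j X * opTwo A j l F * opTwo A i j F =
      opTwo A j l F * opTwo A i j F * opTwo A j l X ∧
    opTwo A j l X * opTwo A i j F * opTwo A j l F =
      opTwo A i j F * opTwo A j l F * opTwo A i j X

theorem Compatible.twist [NeZero N] {X F : MatV N 2 ℂ} (h : Compatible X F) : Twist A X F := by
  intro i j l hij hjl hil
  have h1 := congrArg (opThree A i j l) h.1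
  have h2 := congrArg (opThree A i j l) h.2
  simp only [opThree_mul hij hjl hil, opThree_lift2_zero hij hjl hil,
    opThree_lift2_one hij hjl hil] at h1 h2
  exact ⟨h1, h2⟩

theorem IsBraid.twist [NeZero N] {F : MatV N 2 ℂ} (h : IsBraid F) : Twist A F F :=
  Compatible.twist ⟨h, h.symm⟩

theorem opTwo_mul_inv {F : MatV N 2 ℂ} (hF : IsUnit F.det) {i j : ℕ} (hij : i ≠ j) :
    opTwo A i j F * opTwo A i j F⁻¹ = 1 := by
  rw [← opTwo_mul hij, Matrix.mul_nonsing_inv _ hF, opTwo_one hij]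

theorem opTwo_inv_mul {F : MatV N 2 ℂ} (hF : IsUnit F.det) {i j : ℕ} (hij : i ≠ j) :
    opTwo A i j F⁻¹ * opTwo A i j F = 1 := by
  rw [← opTwo_mul hij, Matrix.nonsing_inv_mul _ hF, opTwo_one hij]

/-- Two-leg operators from an invertible matrix, as a unit. -/
def opUnit (A : Type*) [Ring A] [Algebra ℂ A] {F : MatV N 2 ℂ} (hF : IsUnit F.det) {i j : ℕ}
    (hij : i ≠ j) : (Op N A)ˣ :=
  ⟨opTwo A i j F, opTwo A i j F⁻¹, opTwo_mul_inv hF hij, opTwo_inv_mul hF hij⟩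

theorem Twist.inv_left {X F : MatV N 2 ℂ} (h : Twist A X F) (hX : IsUnit X.det) :
    Twist A X⁻¹ F := by
  intro i j l hij hjl hil
  obtain ⟨h1, h2⟩ := h i j l hij hjl hil
  have a1 := opTwo_inv_mul (A := A) hX hij
  have a2 := opTwo_mul_inv (A := A) hX hij
  have b1 := opTwo_inv_mul (A := A) hX hjl
  have b2 := opTwo_mul_inv (A := A) hX hjl
  constructor
  · calc _ = opTwo A i j X⁻¹ * (opTwo A j l F * opTwo A i j F * opTwo A j l X) *
          opTwo A j l X⁻¹ := by
          simp only [mul_assoc, b2, mul_one]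
      _ = _ := by rw [← h1]; simp only [← mul_assoc, a1, one_mul]
  · calc _ = opTwo A j l X⁻¹ * (opTwo A i j F * opTwo A j l F * opTwo A i j X) *
          opTwo A i j X⁻¹ := by
          simp only [mul_assoc, a2, mul_one]
      _ = _ := by rw [← h2]; simp only [← mul_assoc, b1, one_mul]

theorem Twist.inv_right {X F : MatV N 2 ℂ} (h : Twist A X F) (hF : IsUnit F.det) :
    Twist A X F⁻¹ := by
  intro i j l hij hjl hil
  obtain ⟨h1, h2⟩ := h i j l hij hjl hil
  have a1 := opTwo_inv_mul (A := A) hF hij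
  have a2 := opTwo_mul_inv (A := A) hF hij
  have b1 := opTwo_inv_mul (A := A) hF hjl
  have b2 := opTwo_mul_inv (A := A) hF hjl
  generalize opTwo A i j X = x at *
  generalize opTwo A j l X = y at *
  generalize opTwo A i j F = f at *
  generalize opTwo A j l F = g at *
  generalize opTwo A i j F⁻¹ = f' at *
  generalize opTwo A j l F⁻¹ = g' at *
  constructor
  · calc x * g' * f' = g' * f' * (f * g * x) * g' * f' := by
          simp only [← mul_assoc, mul_assoc g' f' f, a1, mul_one, b1, one_mul]
      _ = g' * f' * y * (f * (g * g') * f') := by rw [← h2]; simp only [mul_assoc]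
      _ = _ := by rw [b2, mul_one, a2, mul_one]
  · calc y * f' * g' = f' * g' * (g * f * y) * f' * g' := by
          simp only [← mul_assoc, mul_assoc f' g' g, b1, mul_one, a1, one_mul]
      _ = f' * g' * x * (g * (f * f') * g') := by rw [← h1]; simp only [mul_assoc]
      _ = _ := by rw [a2, mul_one, b2, mul_one]

/-- The matrix with a single nonzero row-column entry contracting the first leg. -/
def wFst (Ψ : MatV N 2 ℂ) (s t : Fin N) : Matrix (Fin N) (Fin N) ℂ :=
  fun m c => Ψ ![t, m] ![s, c]

/-- The weight contracting the second leg. -/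
def wSnd (Ψ : MatV N 2 ℂ) (s t : Fin N) : Matrix (Fin N) (Fin N) ℂ :=
  fun c m => Ψ ![c, t] ![m, s]

/-- The second partial trace of a skew inverse. -/
def Dof' (Ψ : MatV N 2 ℂ) : Matrix (Fin N) (Fin N) ℂ :=
  fun a b => ∑ m, Ψ ![m, a] ![m, b]

theorem wFst_trace (Ψ : MatV N 2 ℂ) (s t : Fin N) : (wFst Ψ s t).trace = Dof Ψ t s := rfl

theorem wSnd_trace (Ψ : MatV N 2 ℂ) (s t : Fin N) : (wSnd Ψ s t).trace = Dof' Ψ t s := rfl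

theorem Tr_sum_weight {ι : Type*} (S : Finset ι) (W : ι → Matrix (Fin N) (Fin N) ℂ) (j : ℕ)
    (Z : Op N A) : Tr (∑ x ∈ S, W x) j Z = ∑ x ∈ S, Tr (W x) j Z := by
  simp only [Tr_apply, Matrix.sum_apply, Finset.sum_smul]
  rw [Finset.sum_comm]
  simp only [Finset.sum_comm (s := S)]
  rw [Finset.sum_comm]

theorem Tr_wFst {X Ψ : MatV N 2 ℂ} (h : SkewPair X Ψ) {i j : ℕ} (hij : i ≠ j) (s t : Fin N) :
    Tr (wFst Ψ s t) i (opTwo A i j X) = eU A j s t := by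
  rw [Tr_opTwo_fst hij, ← opOne_single]
  congr 1
  ext b d
  rw [Matrix.single_apply]
  simp only [wFst]
  rw [h.2 t b s d]
  exact if_congr (by constructor <;> rintro ⟨rfl, rfl⟩ <;> simp) rfl rfl

theorem Tr_wSnd {X Ψ : MatV N 2 ℂ} (h : SkewPair X Ψ) {i j : ℕ} (hij : i ≠ j) (s t : Fin N) :
    Tr (wSnd Ψ s t) j (opTwo A i j X) = eU A i s t := by
  rw [Tr_opTwo hij, ← opOne_single]
  congr 1
  ext a c
  rw [Matrix.single_apply, Finset.sum_comm]
  simp only [wSnd, mul_comm (Ψ _ _)]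
  rw [h.1 a t c s]
  exact if_congr (by constructor <;> rintro ⟨rfl, rfl⟩ <;> simp) rfl rfl

theorem Tr_skew {X Ψ : MatV N 2 ℂ} (h : SkewPair X Ψ) {i j : ℕ} (hij : i ≠ j) :
    Tr (Dof Ψ) j (opTwo A i j X) = 1 := by
  have e : Dof Ψ = ∑ m, wSnd Ψ m m := by
    ext a b
    simp [Dof, wSnd, Matrix.sum_apply]
  rw [e, Tr_sum_weight]
  simp only [Tr_wSnd h hij, sum_eU]

end Skew

section Conjugation

variable {N : ℕ} {A : Type*} [Ring A] [Algebra ℂ A]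

theorem Tr_conj_eU {X F Ψ : MatV N 2 ℂ} (h : Twist A X F) (hF : IsUnit F.det)
    (hΨ : SkewPair X Ψ) {j l : ℕ} (hjl : j ≠ l) (s t : Fin N) :
    Tr (Dof Ψ) l (opTwo A j l F * eU A j s t * opTwo A j l F⁻¹) = Dof Ψ t s • (1 : Op N A) := by
  have hij : j + l + 1 ≠ j := by omega
  have hil : j + l + 1 ≠ l := by omega
  have h2 := (h _ j l hij hjl hil).2
  have key : opTwo A j l F * opTwo A (j + l + 1) j X * opTwo A j l F⁻¹ =
      opTwo A (j + l + 1) j F⁻¹ * opTwo A j l X * opTwo A (j + l + 1) j F := by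
    calc _ = opTwo A (j + l + 1) j F⁻¹ * (opTwo A (j + l + 1) j F * opTwo A j l F *
          opTwo A (j + l + 1) j X) * opTwo A j l F⁻¹ := by
          simp only [← mul_assoc, opTwo_inv_mul hF hij, one_mul]
      _ = _ := by
          rw [← h2]
          simp only [mul_assoc, opTwo_mul_inv hF hjl, mul_one]
  have h1 : Tr (Dof Ψ) l (opTwo A j l F * opTwo A (j + l + 1) j X * opTwo A j l F⁻¹) = 1 := by
    rw [key, Tr_mul_right (Off.opTwo hil hjl _), Tr_mul_left (Off.opTwo hil hjl _),
      Tr_skew hΨ hjl, mul_one, opTwo_inv_mul hF hij]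
  have h3 := congrArg (Tr (wFst Ψ s t) (j + l + 1)) h1
  rw [Tr_Tr hil, Tr_mul_right (Off.opTwo hij.symm hil.symm _),
    Tr_mul_left (Off.opTwo hij.symm hil.symm _), Tr_wFst hΨ hij, Tr_one, wFst_trace] at h3
  exact h3

theorem Tr_conj {X F Ψ : MatV N 2 ℂ} (h : Twist A X F) (hF : IsUnit F.det)
    (hΨ : SkewPair X Ψ) {j l : ℕ} (hjl : j ≠ l) {Z : Op N A} (hZ : Off l Z) :
    Tr (Dof Ψ) l (opTwo A j l F * Z * opTwo A j l F⁻¹) = Tr (Dof Ψ) j Z := by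
  conv_lhs => rw [← sum_cmpt j Z]
  rw [Tr_apply (Dof Ψ) j Z, Finset.sum_comm (f := fun m c => Dof Ψ m c • cmpt j c m Z),
    Finset.mul_sum, Finset.sum_mul, map_sum]
  refine Finset.sum_congr rfl fun s _ => ?_
  rw [Finset.mul_sum, Finset.sum_mul, map_sum]
  refine Finset.sum_congr rfl fun t _ => ?_
  have hc : Commute (opTwo A j l F⁻¹) (cmpt j s t Z) :=
    Off.commute_opTwo (cmpt_off _ _ _ _) (cmpt_off_of_ne hjl.symm hZ _ _) _
  rw [mul_assoc, mul_assoc, ← hc.eq, ← mul_assoc, ← mul_assoc,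
    Tr_mul_right (cmpt_off_of_ne hjl.symm hZ _ _), Tr_conj_eU h hF hΨ hjl, smul_mul_assoc,
    one_mul]

theorem det_inv {F : MatV N 2 ℂ} (hF : IsUnit F.det) : IsUnit F⁻¹.det :=
  Matrix.isUnit_nonsing_inv_det _ hF

end Conjugation

section IndexForms

variable {N : ℕ} [NeZero N]

theorem conj_entries (D : Matrix (Fin N) (Fin N) ℂ) {F G : MatV N 2 ℂ}
    (h : ∀ s t, Tr D 1 (opTwo ℂ 0 1 F * eU ℂ 0 s t * opTwo ℂ 0 1 G) = D t s • (1 : Op N ℂ))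
    (s t x z : Fin N) :
    ∑ w, ∑ y, D w y * ∑ b, F ![x, y] ![s, b] * G ![t, b] ![z, w] =
      if x = z then D t s else 0 := by
  have h1 := h s t
  rw [← opOne_single, ← mul_one (opOne ℂ 0 _), ← opOne_one 1, ← opTwo_kr,
    ← opTwo_mul (by omega), ← opTwo_mul (by omega), Tr_opTwo (by omega), opOne_one 1, ← opOne_one 0,
    ← opOne_smul] at h1
  have h2 := congrFun (congrFun (opOne_injective 0 h1) x) z
  rw [Matrix.smul_apply, Matrix.one_apply] at h2
  simp only [smul_eq_mul, mul_ite, mul_one, mul_zero] at h2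
  rw [← h2]
  refine Finset.sum_congr rfl fun w _ => Finset.sum_congr rfl fun y _ => ?_
  congr 1
  symm
  rw [mul_assoc, mul_apply_pair, Finset.sum_eq_single s]
  · refine Finset.sum_congr rfl fun b _ => ?_
    congr 1
    rw [mul_apply_pair, Finset.sum_eq_single t, Finset.sum_eq_single b]
    · simp [kr, Matrix.one_apply]
    · intro c _ hc; simp [kr, hc.symm]
    · simp
    · intro c _ hc; simp [kr, hc.symm]
    · simp
  · intro a _ ha
    refine Finset.sum_eq_zero fun b _ => ?_
    rw [mul_apply_pair]
    simp [kr, ha.symm]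
  · simp

theorem inv_mul_kr {X F Ψ Φ : MatV N 2 ℂ} (h : Twist ℂ X F) (hF : IsUnit F.det)
    (hΨ : SkewPair X Ψ) (hΦ : SkewPair F Φ) :
    F⁻¹ * kr 1 (Dof Ψ) = kr (Dof Ψ) 1 * sw Φ := by
  have key := conj_entries (Dof Ψ) (F := F) (G := F⁻¹)
    fun s t => Tr_conj_eU h hF hΨ (by omega) s t
  refine MatV.ext_pair fun t a z b => ?_
  rw [mul_one_kr_apply, kr_one_mul_apply]
  have h1 : ∑ s, ∑ x, Φ ![a, s] ![b, x] * (∑ w, ∑ y, Dof Ψ w y *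
      ∑ e, F ![x, y] ![s, e] * F⁻¹ ![t, e] ![z, w]) =
      ∑ s, ∑ x, Φ ![a, s] ![b, x] * if x = z then Dof Ψ t s else 0 :=
    Finset.sum_congr rfl fun s _ => Finset.sum_congr rfl fun x _ => by rw [key]
  have h2 : ∑ s, ∑ x, Φ ![a, s] ![b, x] * (∑ w, ∑ y, Dof Ψ w y *
      ∑ e, F ![x, y] ![s, e] * F⁻¹ ![t, e] ![z, w]) =
      ∑ w, ∑ y, ∑ e, (∑ s, ∑ x, Φ ![a, s] ![b, x] * F ![x, y] ![s, e]) *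
        (Dof Ψ w y * F⁻¹ ![t, e] ![z, w]) := by
    simp only [Finset.mul_sum, Finset.sum_mul]
    rw [Finset.sum_congr rfl fun s _ => Finset.sum_comm, Finset.sum_comm]
    refine Finset.sum_congr rfl fun w _ => ?_
    rw [Finset.sum_congr rfl fun s _ => Finset.sum_comm, Finset.sum_comm]
    refine Finset.sum_congr rfl fun y _ => ?_
    rw [Finset.sum_congr rfl fun s _ => Finset.sum_comm, Finset.sum_comm]
    refine Finset.sum_congr rfl fun e _ => Finset.sum_congr rfl fun s _ =>
      Finset.sum_congr rfl fun x _ => by ring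
  simp only [h2, hΦ.2] at h1
  simpa [ite_and, mul_comm, sw] using h1

theorem kr_mul_inv {X F Ψ Φ : MatV N 2 ℂ} (h : Twist ℂ X F) (hF : IsUnit F.det)
    (hΨ : SkewPair X Ψ) (hΦ : SkewPair F Φ) :
    kr 1 (Dof Ψ) * F⁻¹ = sw Φ * kr (Dof Ψ) 1 := by
  have key := conj_entries (Dof Ψ) (F := F⁻¹) (G := F) fun s t => by
    have := Tr_conj_eU (h.inv_right hF) (det_inv hF) hΨ (show 0 ≠ 1 by omega) s t
    rwa [Matrix.nonsing_inv_nonsing_inv _ hF] at this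
  refine MatV.ext_pair fun x a s b => ?_
  rw [mul_kr_one_apply, one_kr_mul_apply]
  have h1 : ∑ z, ∑ t, Φ ![a, z] ![b, t] * (∑ w, ∑ y, Dof Ψ w y *
      ∑ e, F⁻¹ ![x, y] ![s, e] * F ![t, e] ![z, w]) =
      ∑ z, ∑ t, Φ ![a, z] ![b, t] * if x = z then Dof Ψ t s else 0 :=
    Finset.sum_congr rfl fun s _ => Finset.sum_congr rfl fun x _ => by rw [key]
  have h2 : ∑ z, ∑ t, Φ ![a, z] ![b, t] * (∑ w, ∑ y, Dof Ψ w y *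
      ∑ e, F⁻¹ ![x, y] ![s, e] * F ![t, e] ![z, w]) =
      ∑ w, ∑ y, ∑ e, (∑ z, ∑ t, Φ ![a, z] ![b, t] * F ![t, e] ![z, w]) *
        (Dof Ψ w y * F⁻¹ ![x, y] ![s, e]) := by
    simp only [Finset.mul_sum, Finset.sum_mul]
    rw [Finset.sum_congr rfl fun s _ => Finset.sum_comm, Finset.sum_comm]
    refine Finset.sum_congr rfl fun w _ => ?_
    rw [Finset.sum_congr rfl fun s _ => Finset.sum_comm, Finset.sum_comm]
    refine Finset.sum_congr rfl fun y _ => ?_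
    rw [Finset.sum_congr rfl fun s _ => Finset.sum_comm, Finset.sum_comm]
    refine Finset.sum_congr rfl fun e _ => Finset.sum_congr rfl fun s _ =>
      Finset.sum_congr rfl fun x _ => by ring
  simp only [h2, hΦ.2] at h1
  simpa [ite_and, sw] using h1

theorem sw_mul_kr_comm {X F Ψ Φ : MatV N 2 ℂ} (h : Twist ℂ X F) (hF : IsUnit F.det)
    (hΨ : SkewPair X Ψ) (hΦ : SkewPair F Φ) :
    F⁻¹ * kr (Dof Ψ) (Dof Ψ) = kr (Dof Ψ) (Dof Ψ) * F⁻¹ := by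
  have e1 : kr (Dof Ψ) (Dof Ψ) = kr 1 (Dof Ψ) * kr (Dof Ψ) 1 := by simp [kr_mul]
  have e2 : kr (Dof Ψ) (Dof Ψ) = kr (Dof Ψ) 1 * kr 1 (Dof Ψ) := by simp [kr_mul]
  rw [e1, ← mul_assoc, inv_mul_kr h hF hΨ hΦ, ← e1, e2, mul_assoc, mul_assoc,
    kr_mul_inv h hF hΨ hΦ]

theorem mul_kr_comm {X F Ψ Φ : MatV N 2 ℂ} (h : Twist ℂ X F) (hF : IsUnit F.det)
    (hΨ : SkewPair X Ψ) (hΦ : SkewPair F Φ) :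
    Commute (kr (Dof Ψ) (Dof Ψ)) F := by
  have e := sw_mul_kr_comm h hF hΨ hΦ
  show _ * _ = _ * _
  calc _ = F * (F⁻¹ * kr (Dof Ψ) (Dof Ψ)) * F := by
        rw [← mul_assoc, Matrix.mul_nonsing_inv _ hF, one_mul]
    _ = _ := by rw [e, mul_assoc, mul_assoc, Matrix.nonsing_inv_mul _ hF, mul_one]

end IndexForms

section Relations

variable {B : Type*} [Ring B] [Algebra ℂ B] {q μ : ℂ}

/-- The contractor built from a braid generator. -/
def kOf (q μ : ℂ) (r : B) : B :=
  (μ⁻¹ * (q - q⁻¹)⁻¹) • ((q • (1 : B) - r) * (q⁻¹ • (1 : B) + r))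

theorem kOf_commute {r w r' : B} (h : r * w = w * r') : kOf q μ r * w = w * kOf q μ r' := by
  have e1 : (q⁻¹ • (1 : B) + r) * w = w * (q⁻¹ • (1 : B) + r') := by
    rw [add_mul, mul_add, h, smul_mul_assoc, mul_smul_comm, one_mul, mul_one]
  have e2 : (q • (1 : B) - r) * w = w * (q • (1 : B) - r') := by
    rw [sub_mul, mul_sub, h, smul_mul_assoc, mul_smul_comm, one_mul, mul_one]
  rw [kOf, kOf, smul_mul_assoc, mul_smul_comm, mul_assoc, e1, ← mul_assoc, e2, mul_assoc]

theorem kOf_elt {r : B} (hq : q ≠ 0) (hμ : μ ≠ 0) (hl : q - q⁻¹ ≠ 0)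
    (h : (q • (1 : B) - r) * (q⁻¹ • (1 : B) + r) * (μ • (1 : B) - r) = 0) :
    BMWElt q μ r (kOf q μ r) := by
  have h1 : kOf q μ r * r = μ • kOf q μ r := by
    rw [mul_sub, sub_eq_zero, mul_smul_comm, mul_one] at h
    rw [kOf, smul_mul_assoc, ← h, smul_comm]
  refine ⟨?_, h1, ?_⟩
  · rw [← kOf_commute (q := q) (μ := μ) (rfl : r * r = r * r), h1]
  · have e : (q • (1 : B) - r) * (q⁻¹ • (1 : B) + r) = 1 + (q - q⁻¹) • r - r * r := by
      simp only [sub_mul, mul_add, smul_mul_assoc, mul_smul_comm, one_mul, mul_one, sub_smul,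
        smul_sub, inv_smul_smul₀ hq]
      abel
    rw [kOf, e, smul_smul]
    have e2 : (q - q⁻¹) * μ * (μ⁻¹ * (q - q⁻¹)⁻¹) = 1 := by
      rw [← mul_inv, mul_comm μ, mul_inv_cancel₀ (mul_ne_zero hl hμ)]
    rw [e2, one_smul]
    abel

theorem kOf_sq {r : B} (h : kOf q μ r * r = μ • kOf q μ r) :
    kOf q μ r * kOf q μ r = (μ⁻¹ * (q - q⁻¹)⁻¹ * ((q - μ) * (q⁻¹ + μ))) • kOf q μ r := by
  have e : kOf q μ r * ((q • (1 : B) - r) * (q⁻¹ • (1 : B) + r)) =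
      ((q - μ) * (q⁻¹ + μ)) • kOf q μ r := by
    rw [← mul_assoc, mul_sub, h, mul_smul_comm, mul_one, ← sub_smul, smul_mul_assoc, mul_add, h,
      mul_smul_comm, mul_one, ← add_smul, smul_smul]
  nth_rw 2 [kOf]
  rw [mul_smul_comm, e, smul_smul]

theorem kOf_adj {r r' : Bˣ} (hb : (r : B) * r' * r = r' * r * r')
    (hk : kOf q μ (r' : B) * kOf q μ (r : B) = kOf q μ (r' : B) * r * r')
    (hkk : kOf q μ (r : B) * kOf q μ (r' : B) * kOf q μ (r : B) = kOf q μ (r : B)) :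
    BMWAdj (r : B) (kOf q μ (r : B)) r' (kOf q μ (r' : B)) := by
  have e1 : kOf q μ (r' : B) * (r * r') = r * r' * kOf q μ (r : B) :=
    kOf_commute (by rw [← mul_assoc, ← hb])
  have e2 : kOf q μ (r : B) * (r' * r) = r' * r * kOf q μ (r' : B) :=
    kOf_commute (by rw [← mul_assoc, hb])
  have hw : ((r * r' * r : Bˣ) : B) = r * r' * r := by push_cast; rfl
  have w1 : (r : B) * (r * r' * r : Bˣ) = (r * r' * r : Bˣ) * r' := by
    rw [hw]
    nth_rw 1 [hb]
    simp only [mul_assoc]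
  have w2 : (r' : B) * (r * r' * r : Bˣ) = (r * r' * r : Bˣ) * r := by
    rw [hw]
    nth_rw 2 [hb]
    simp only [mul_assoc]
  have c1 := kOf_commute (q := q) (μ := μ) w1
  have c2 := kOf_commute (q := q) (μ := μ) w2
  generalize r * r' * r = w at w1 w2 c1 c2
  have h1 : kOf q μ (r : B) * r' * r = kOf q μ (r : B) * kOf q μ (r' : B) := by
    rw [← Units.mul_right_inj w]
    calc _ = (w : B) * kOf q μ (r : B) * r' * r := by simp only [mul_assoc]
      _ = kOf q μ (r' : B) * r * r' * w := by
        rw [← c2, mul_assoc (kOf q μ (r' : B)), ← w1]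
        simp only [mul_assoc, w2]
      _ = kOf q μ (r' : B) * (kOf q μ (r : B) * w) := by rw [← hk, mul_assoc]
      _ = _ := by rw [c1, ← mul_assoc, c2, mul_assoc]
  refine ⟨hb, ?_, ?_, hk.symm, h1, hkk, ?_⟩
  · rw [← e1, ← mul_assoc, hk]
  · rw [← e2, ← mul_assoc, h1]
  · rw [← Units.mul_right_inj w]
    calc _ = (w : B) * kOf q μ (r' : B) * kOf q μ (r : B) * kOf q μ (r' : B) := by
          simp only [mul_assoc]
      _ = kOf q μ (r : B) * kOf q μ (r' : B) * kOf q μ (r : B) * w := by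
        rw [← c1, mul_assoc (kOf q μ (r : B)), ← c2]
        simp only [mul_assoc, c1]
      _ = _ := by rw [hkk, c1]

end Relations

section BMWOps

variable {N : ℕ} {A : Type*} [Ring A] [Algebra ℂ A] {q μ : ℂ} {R : MatV N 2 ℂ}

/-- A Birman–Murakami–Wenzl type R-matrix together with the genericity of its parameters. -/
structure BMWData [NeZero N] (q μ : ℂ) (R : MatV N 2 ℂ) : Prop where
  braid : IsBraid R
  det : IsUnit R.det
  bmw : IsBMW q μ R
  q0 : q ≠ 0
  mu : μ ≠ 0
  lam : q - q⁻¹ ≠ 0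
  eta : (q - μ) * (q⁻¹ + μ) ≠ 0

/-- The eigenvalue of the contractor. -/
def etaC (q μ : ℂ) : ℂ := μ⁻¹ * (q - q⁻¹)⁻¹ * ((q - μ) * (q⁻¹ + μ))

theorem opTwo_bmwK {i j : ℕ} (hij : i ≠ j) :
    opTwo A i j (bmwK q μ R) = kOf q μ (opTwo A i j R) := by
  rw [bmwK, kOf, opTwo_smul, opTwo_mul hij, opTwo_sub, opTwo_add, opTwo_smul, opTwo_smul,
    opTwo_one hij]

theorem Twist.bmwK {F : MatV N 2 ℂ} (h : Twist A R F) (q μ : ℂ) : Twist A (bmwK q μ R) F := by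
  intro i j l hij hjl hil
  obtain ⟨h1, h2⟩ := h i j l hij hjl hil
  rw [opTwo_bmwK hij, opTwo_bmwK hjl]
  rw [mul_assoc] at h1 h2
  rw [mul_assoc (kOf _ _ _), mul_assoc (kOf _ _ _)]
  exact ⟨kOf_commute h1, kOf_commute h2⟩

/-- Entrywise contraction against an operator gives contraction of arbitrary operators. -/
theorem contract_off {W : Matrix (Fin N) (Fin N) ℂ} {j : ℕ} {x y k Z : Op N A} {z : ℂ}
    (h : ∀ s t, x * eU A j s t * y = (z * W t s) • k) (hc : ∀ s t, Commute y (cmpt j s t Z)) :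
    x * Z * y = z • (k * Tr W j Z) := by
  conv_lhs => rw [← sum_cmpt j Z]
  rw [Tr_apply, Finset.sum_comm (f := fun m c => W m c • cmpt j c m Z)]
  simp only [Finset.mul_sum, Finset.sum_mul, Finset.smul_sum]
  refine Finset.sum_congr rfl fun s _ => Finset.sum_congr rfl fun t _ => ?_
  rw [mul_assoc, mul_assoc, ← (hc s t).eq, ← mul_assoc, ← mul_assoc, h, smul_mul_assoc,
    mul_smul_comm, smul_smul]

theorem commute_cmpt {j l : ℕ} (hjl : j ≠ l) {Z : Op N A} (hZ : Off l Z) (X : MatV N 2 ℂ)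
    (s t : Fin N) : Commute (opTwo A j l X) (cmpt j s t Z) :=
  Off.commute_opTwo (cmpt_off _ _ _ _) (cmpt_off_of_ne hjl.symm hZ _ _) _

theorem commute_cmpt' {i j : ℕ} (hij : i ≠ j) {Z : Op N A} (hZ : Off i Z) (X : MatV N 2 ℂ)
    (s t : Fin N) : Commute (opTwo A i j X) (cmpt j s t Z) :=
  Off.commute_opTwo (cmpt_off_of_ne hij hZ _ _) (cmpt_off _ _ _ _) _

theorem contract_fst {X K Ψ : MatV N 2 ℂ} (hΨ : SkewPair X Ψ) {i j l : ℕ} (hij : i ≠ j)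
    (hil : i ≠ l) {z : ℂ}
    (h : opTwo A j l K * opTwo A i j X * opTwo A j l K = z • opTwo A j l K) (s t : Fin N) :
    opTwo A j l K * eU A j s t * opTwo A j l K = (z * Dof Ψ t s) • opTwo A j l K := by
  have h3 := congrArg (Tr (wFst Ψ s t) i) h
  rw [Tr_mul_right (Off.opTwo hij.symm hil.symm _), Tr_mul_left (Off.opTwo hij.symm hil.symm _),
    Tr_wFst hΨ hij, LinearMap.map_smul, Tr_of_off _ (Off.opTwo hij.symm hil.symm _), wFst_trace, smul_smul] at h3
  exact h3

theorem contract_snd {X K Ψ : MatV N 2 ℂ} (hΨ : SkewPair X Ψ) {i j l : ℕ} (hjl : j ≠ l)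
    (hil : i ≠ l) {z : ℂ}
    (h : opTwo A i j K * opTwo A j l X * opTwo A i j K = z • opTwo A i j K) (s t : Fin N) :
    opTwo A i j K * eU A j s t * opTwo A i j K = (z * Dof' Ψ t s) • opTwo A i j K := by
  have h3 := congrArg (Tr (wSnd Ψ s t) l) h
  rw [Tr_mul_right (Off.opTwo hil hjl _), Tr_mul_left (Off.opTwo hil hjl _),
    Tr_wSnd hΨ hjl, LinearMap.map_smul, Tr_of_off _ (Off.opTwo hil hjl _), wSnd_trace,
    smul_smul] at h3
  exact h3

variable [NeZero N]

theorem BMWData.eta_ne (h : BMWData q μ R) : etaC q μ ≠ 0 :=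
  mul_ne_zero (mul_ne_zero (inv_ne_zero h.mu) (inv_ne_zero h.lam)) h.eta

theorem BMWData.elt (h : BMWData q μ R) {i j : ℕ} (hij : i ≠ j) :
    BMWElt q μ (opTwo A i j R) (opTwo A i j (bmwK q μ R)) := by
  rw [opTwo_bmwK hij]
  refine kOf_elt h.q0 h.mu h.lam ?_
  have := congrArg (opTwo A i j) h.bmw.1
  rw [opTwo_mul hij, opTwo_mul hij, opTwo_sub, opTwo_sub, opTwo_add, opTwo_smul, opTwo_smul,
    opTwo_smul, opTwo_one hij] at this
  rw [this, ← zero_smul ℂ (0 : MatV N 2 ℂ), opTwo_smul, zero_smul]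

theorem BMWData.adj (h : BMWData q μ R) {i j l : ℕ} (hij : i ≠ j) (hjl : j ≠ l) (hil : i ≠ l) :
    BMWAdj (opTwo A i j R) (opTwo A i j (bmwK q μ R)) (opTwo A j l R)
      (opTwo A j l (bmwK q μ R)) := by
  have h1 := congrArg (opThree A i j l) h.braid
  have h2 := congrArg (opThree A i j l) h.bmw.2.1
  have h3 := congrArg (opThree A i j l) h.bmw.2.2.2
  simp only [opThree_mul hij hjl hil, opThree_lift2_zero hij hjl hil,
    opThree_lift2_one hij hjl hil] at h1 h2 h3
  rw [opTwo_bmwK hij, opTwo_bmwK hjl] at h2 h3 ⊢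
  exact kOf_adj (r := opUnit A h.det hij) (r' := opUnit A h.det hjl) h1 h2 h3

theorem BMWData.sq (h : BMWData q μ R) {i j : ℕ} (hij : i ≠ j) :
    opTwo A i j (bmwK q μ R) * opTwo A i j (bmwK q μ R) =
      etaC q μ • opTwo A i j (bmwK q μ R) := by
  have := (h.elt (A := A) hij).kr
  rw [opTwo_bmwK hij] at this ⊢
  exact kOf_sq this

theorem BMWData.inv (h : BMWData q μ R) {i j : ℕ} (hij : i ≠ j) :
    opTwo A i j R⁻¹ = opTwo A i j R - (q - q⁻¹) • 1 + (q - q⁻¹) • opTwo A i j (bmwK q μ R) := by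
  have e := h.elt (A := A) hij
  have u := opUnit A h.det hij
  have h1 : opTwo A i j R * (opTwo A i j R - (q - q⁻¹) • 1 +
      (q - q⁻¹) • opTwo A i j (bmwK q μ R)) = 1 := by
    rw [mul_add, mul_sub, mul_smul_comm, mul_smul_comm, mul_one, e.rk, e.sq, smul_smul]
    abel
  calc _ = opTwo A i j R⁻¹ * (opTwo A i j R * (opTwo A i j R - (q - q⁻¹) • 1 +
      (q - q⁻¹) • opTwo A i j (bmwK q μ R))) := by rw [h1, mul_one]
    _ = _ := by rw [← mul_assoc, opTwo_inv_mul h.det hij, one_mul]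

theorem BMWData.chain (h : BMWData q μ R) (n : ℕ) :
    BMWChain q μ n (fun i => opTwo A i (i + 1) R) (fun i => opTwo A i (i + 1) (bmwK q μ R)) := by
  have far : ∀ (X Y : MatV N 2 ℂ) (i j : ℕ), i + 2 ≤ j →
      Commute (opTwo A i (i + 1) X) (opTwo A j (j + 1) Y) := fun X Y i j hij =>
    Off.commute_opTwo (Off.opTwo (by omega) (by omega) _) (Off.opTwo (by omega) (by omega) _) _
  exact ⟨fun i _ => h.elt (by omega), fun i _ => h.adj (by omega) (by omega) (by omega),
    fun i j hij _ => far _ _ i j hij, fun i j hij _ => far _ _ i j hij,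
    fun i j hij _ => far _ _ i j hij, fun i j hij _ => far _ _ i j hij⟩

variable {Ψ Ψ' : MatV N 2 ℂ}

theorem BMWData.k_r_k (h : BMWData q μ R) {i j l : ℕ} (hij : i ≠ j) (hjl : j ≠ l)
    (hil : i ≠ l) :
    opTwo A j l (bmwK q μ R) * opTwo A i j R * opTwo A j l (bmwK q μ R) =
      μ⁻¹ • opTwo A j l (bmwK q μ R) := by
  have a := h.adj (A := A) hij hjl hil
  have e := h.elt (A := A) hjl
  rw [eq_inv_smul_iff₀ h.mu, ← mul_smul_comm, ← e.rk, ← mul_assoc, a.krr, a.kkk']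

theorem BMWData.k_r_k' (h : BMWData q μ R) {i j l : ℕ} (hij : i ≠ j) (hjl : j ≠ l)
    (hil : i ≠ l) :
    opTwo A i j (bmwK q μ R) * opTwo A j l R * opTwo A i j (bmwK q μ R) =
      μ⁻¹ • opTwo A i j (bmwK q μ R) := by
  have a := h.adj (A := A) hij hjl hil
  have e := h.elt (A := A) hij
  rw [eq_inv_smul_iff₀ h.mu, ← mul_smul_comm, ← e.rk, ← mul_assoc, a.krr', a.kkk]

theorem BMWData.k_rinv_k (h : BMWData q μ R) {i j l : ℕ} (hij : i ≠ j) (hjl : j ≠ l)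
    (hil : i ≠ l) :
    opTwo A j l (bmwK q μ R) * opTwo A i j R⁻¹ * opTwo A j l (bmwK q μ R) =
      μ • opTwo A j l (bmwK q μ R) := by
  have a := h.adj (A := A) hij hjl hil
  have e := h.elt (A := A) hjl
  have h3 := congrArg (opThree A i j l) h.bmw.2.2.1
  simp only [opThree_mul hij hjl hil, opThree_lift2_zero hij hjl hil,
    opThree_lift2_one hij hjl hil] at h3
  have h4 : opTwo A j l (bmwK q μ R) = μ • (opTwo A j l R⁻¹ * opTwo A j l (bmwK q μ R)) := by
    rw [← mul_smul_comm, ← e.rk, ← mul_assoc, opTwo_inv_mul h.det hjl, one_mul]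
  nth_rw 2 [h4]
  rw [mul_smul_comm, ← mul_assoc, ← h3, a.kkk']

theorem BMWData.kZk (h : BMWData q μ R) (hΨ : SkewPair R Ψ) {j l : ℕ} (hjl : j ≠ l)
    {Z : Op N A} (hZ : Off l Z) :
    opTwo A j l (bmwK q μ R) * Z * opTwo A j l (bmwK q μ R) =
      μ⁻¹ • (opTwo A j l (bmwK q μ R) * Tr (Dof Ψ) j Z) :=
  contract_off (contract_fst hΨ (i := j + l + 1) (by omega) (by omega)
    (h.k_r_k (by omega) hjl (by omega))) fun s t => commute_cmpt hjl hZ _ s t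

theorem BMWData.kZk' (h : BMWData q μ R) (hΨ : SkewPair R Ψ) {i j : ℕ} (hij : i ≠ j)
    {Z : Op N A} (hZ : Off i Z) :
    opTwo A i j (bmwK q μ R) * Z * opTwo A i j (bmwK q μ R) =
      μ⁻¹ • (opTwo A i j (bmwK q μ R) * Tr (Dof' Ψ) j Z) :=
  contract_off (contract_snd hΨ (l := i + j + 1) (by omega) (by omega)
    (h.k_r_k' hij (by omega) (by omega))) fun s t => commute_cmpt' hij hZ _ s t

theorem BMWData.opTwo_ne (hK : bmwK q μ R ≠ 0) {i j : ℕ} (hij : i ≠ j) :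
    opTwo ℂ i j (bmwK q μ R) ≠ 0 := by
  intro h0
  refine hK (opTwo_injective hij ?_)
  rw [h0, ← zero_smul ℂ (0 : MatV N 2 ℂ), opTwo_smul, zero_smul]

theorem BMWData.trace_eq (h : BMWData q μ R) (hK : bmwK q μ R ≠ 0) (hΨ : SkewPair R Ψ) :
    (Dof Ψ).trace = μ * etaC q μ := by
  have h1 := h.kZk (A := ℂ) hΨ (show 0 ≠ 1 by omega) (Z := (1 : Op N ℂ)) (Off.one)
  rw [mul_one, h.sq (by omega), Tr_one, mul_smul_comm, mul_one, smul_smul] at h1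
  have := smul_left_injective ℂ (BMWData.opTwo_ne hK (show 0 ≠ 1 by omega)) h1
  rw [this, mul_inv_cancel_left₀ h.mu]

theorem BMWData.Dof_inv (h : BMWData q μ R) (hK : bmwK q μ R ≠ 0) (hΨ : SkewPair R Ψ)
    (hΨ' : SkewPair R⁻¹ Ψ') : Dof Ψ' = (μ⁻¹) ^ 2 • Dof Ψ := by
  ext t s
  have h1 := contract_fst (A := ℂ) hΨ (i := 2) (j := 0) (l := 1) (by omega) (by omega)
    (h.k_r_k (by omega) (by omega) (by omega)) s t
  rw [contract_fst (A := ℂ) hΨ' (i := 2) (j := 0) (l := 1) (by omega) (by omega)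
    (h.k_rinv_k (by omega) (by omega) (by omega)) s t] at h1
  have h2 := smul_left_injective ℂ (BMWData.opTwo_ne hK (show 0 ≠ 1 by omega)) h1
  have hμ := h.mu
  rw [Matrix.smul_apply, smul_eq_mul, pow_two, mul_assoc, ← h2, inv_mul_cancel_left₀ hμ]

/-- The weighted partial trace over the second leg. -/
def trSnd (W : Matrix (Fin N) (Fin N) ℂ) (X : MatV N 2 ℂ) : Matrix (Fin N) (Fin N) ℂ :=
  fun a c => ∑ d, ∑ b, W d b * X ![a, b] ![c, d]

theorem BMWData.trSnd_k (h : BMWData q μ R) (hK : bmwK q μ R ≠ 0) (hΨ : SkewPair R Ψ) :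
    trSnd (Dof Ψ) (bmwK q μ R) = μ • (1 : Matrix (Fin N) (Fin N) ℂ) := by
  have h1 := h.kZk (A := ℂ) hΨ (show 0 ≠ 1 by omega)
    (Off.opTwo (A := ℂ) (show 2 ≠ 1 by omega) (show 0 ≠ 1 by omega) (bmwK q μ R))
  rw [(h.adj (A := ℂ) (show 2 ≠ 0 by omega) (show 0 ≠ 1 by omega) (by omega)).kkk',
    Tr_opTwo (by omega), eq_inv_smul_iff₀ h.mu] at h1
  change _ = _ * opOne ℂ 2 (trSnd (Dof Ψ) (bmwK q μ R)) at h1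
  refine Matrix.ext_iff_trace_mul_left.2 fun W => ?_
  have h2 := congrArg (Tr W 2) h1
  have ho : Off (A := ℂ) 2 (opTwo ℂ 0 1 (bmwK q μ R)) := Off.opTwo (by omega) (by omega) _
  rw [LinearMap.map_smul, Tr_of_off _ ho, Tr_mul_left ho, Tr_opOne, mul_smul_comm, mul_one,
    smul_smul] at h2
  have := smul_left_injective ℂ (BMWData.opTwo_ne hK (show 0 ≠ 1 by omega)) h2
  rw [mul_smul_comm, mul_one, Matrix.trace_smul, smul_eq_mul, this]

theorem BMWData.Tr_k (h : BMWData q μ R) (hK : bmwK q μ R ≠ 0) (hΨ : SkewPair R Ψ) {i j : ℕ}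
    (hij : i ≠ j) : Tr (Dof Ψ) j (opTwo A i j (bmwK q μ R)) = μ • (1 : Op N A) := by
  rw [Tr_opTwo hij, ← opOne_one i, ← opOne_smul, ← h.trSnd_k hK hΨ]
  rfl

theorem BMWData.Dof_mul_Dof' (h : BMWData q μ R) (hK : bmwK q μ R ≠ 0) (hΨ : SkewPair R Ψ) :
    Dof Ψ * Dof' Ψ = (μ ^ 2) • (1 : Matrix (Fin N) (Fin N) ℂ) := by
  have h1 : Tr (Dof Ψ) 1 (opTwo ℂ 0 1 R⁻¹) = opOne ℂ 0 (Dof Ψ * Dof' Ψ) := by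
    rw [Tr_opTwo (by omega)]
    congr 1
    ext a c
    have e := inv_mul_kr h.braid.twist h.det hΨ hΨ
    calc _ = ∑ d, (R⁻¹ * kr 1 (Dof Ψ)) ![a, d] ![c, d] := by
          simp only [mul_one_kr_apply]
          rw [Finset.sum_comm]
          simp only [mul_comm]
      _ = _ := by
          simp only [e, kr_one_mul_apply]
          simp only [Matrix.mul_apply, Dof', Finset.mul_sum]
          rw [Finset.sum_comm]
          rfl
  rw [h.inv (by omega), map_add, map_sub, map_smul, map_smul, Tr_skew hΨ (by omega), Tr_one,
    h.Tr_k hK hΨ (by omega), h.trace_eq hK hΨ] at h1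
  refine opOne_injective 0 (h1.symm.trans ?_)
  rw [opOne_smul, opOne_one]
  match_scalars
  have h2 := h.mu
  have h3 := mul_inv_cancel₀ h.lam
  have h4 := mul_inv_cancel₀ h.q0
  have h5 : (q - q⁻¹) * (μ * etaC q μ) = (q - μ) * (q⁻¹ + μ) := by
    rw [etaC, mul_assoc μ⁻¹, mul_inv_cancel_left₀ h2, ← mul_assoc, h3, one_mul]
  simp only [mul_one]
  linear_combination -h4 - h5

end BMWOps

section Pair

variable {N : ℕ}

theorem kr_left_unit {D : Matrix (Fin N) (Fin N) ℂ} (hD : IsUnit D.det) (X : MatV N 2 ℂ) :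
    kr D⁻¹ 1 * (kr D 1 * X) = X := by
  rw [← mul_assoc, kr_mul, Matrix.nonsing_inv_mul _ hD, mul_one, kr_one, one_mul]

theorem kr_right_unit {D : Matrix (Fin N) (Fin N) ℂ} (hD : IsUnit D.det) (X : MatV N 2 ℂ) :
    X * kr 1 D * kr 1 D⁻¹ = X := by
  rw [mul_assoc, kr_mul, Matrix.mul_nonsing_inv _ hD, mul_one, kr_one, mul_one]

variable [NeZero N] {q μ : ℂ} {R F ΨR ΨF ΨG : MatV N 2 ℂ}

/-- A compatible pair of R-matrices of the type considered, with chosen skew inverses of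
`R`, `F` and `F⁻¹`. -/
structure PairData (q μ : ℂ) (R F ΨR ΨF ΨG : MatV N 2 ℂ) : Prop where
  bmw : BMWData q μ R
  ne : bmwK q μ R ≠ 0
  braidF : IsBraid F
  detF : IsUnit F.det
  comp : Compatible R F
  skR : SkewPair R ΨR
  skF : SkewPair F ΨF
  skG : SkewPair F⁻¹ ΨG
  detD : IsUnit (Dof ΨR).det

theorem kr_inv_mul_inv {X F Ψ Φ : MatV N 2 ℂ} (h : Twist ℂ X F) (hF : IsUnit F.det)
    (hΨ : SkewPair X Ψ) (hΦ : SkewPair F Φ) (hD : IsUnit (Dof Ψ).det) :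
    kr (Dof Ψ)⁻¹ 1 * F⁻¹ = sw Φ * kr 1 (Dof Ψ)⁻¹ := by
  have e := congrArg (fun Z => kr (Dof Ψ)⁻¹ 1 * Z * kr 1 (Dof Ψ)⁻¹) (inv_mul_kr h hF hΨ hΦ)
  simp only [kr_left_unit hD] at e
  rw [← e, ← mul_assoc, kr_right_unit hD]

theorem inv_mul_kr_quot {X Y F Ψ Ψ' Φ : MatV N 2 ℂ} (hX : Twist ℂ X F) (hY : Twist ℂ Y F)
    (hF : IsUnit F.det) (hΨ : SkewPair X Ψ) (hΨ' : SkewPair Y Ψ') (hΦ : SkewPair F Φ)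
    (hD : IsUnit (Dof Ψ).det) :
    F⁻¹ * kr 1 (Dof Ψ' * (Dof Ψ)⁻¹) = kr (Dof Ψ' * (Dof Ψ)⁻¹) 1 * F⁻¹ := by
  have e1 : kr 1 (Dof Ψ' * (Dof Ψ)⁻¹) = kr 1 (Dof Ψ') * kr 1 (Dof Ψ)⁻¹ := by
    rw [kr_mul, mul_one]
  have e2 : kr (Dof Ψ' * (Dof Ψ)⁻¹) 1 = kr (Dof Ψ') 1 * kr (Dof Ψ)⁻¹ 1 := by
    rw [kr_mul, mul_one]
  rw [e1, e2, ← mul_assoc, inv_mul_kr hY hF hΨ' hΦ, mul_assoc, mul_assoc,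
    kr_inv_mul_inv hX hF hΨ hΦ hD]

namespace PairData

variable {A : Type*} [Ring A] [Algebra ℂ A]

theorem twR (h : PairData q μ R F ΨR ΨF ΨG) : Twist A R F := h.comp.twist

theorem twRG (h : PairData q μ R F ΨR ΨF ΨG) : Twist A R F⁻¹ := h.twR.inv_right h.detF

theorem twK (h : PairData q μ R F ΨR ΨF ΨG) : Twist A (bmwK q μ R) F := h.twR.bmwK q μ

theorem twF (h : PairData q μ R F ΨR ΨF ΨG) : Twist A F F := h.braidF.twist

theorem twG (h : PairData q μ R F ΨR ΨF ΨG) : Twist A F⁻¹ F := h.twF.inv_left h.detF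

/-- The transparent matrix attached to the pair. -/
def tv (ΨR ΨG : MatV N 2 ℂ) : Matrix (Fin N) (Fin N) ℂ := Dof ΨG * (Dof ΨR)⁻¹

theorem inv_mul_tv (h : PairData q μ R F ΨR ΨF ΨG) :
    F⁻¹ * kr 1 (tv ΨR ΨG) = kr (tv ΨR ΨG) 1 * F⁻¹ :=
  inv_mul_kr_quot h.twR h.twG h.detF h.skR h.skG h.skF h.detD

theorem mul_tv (h : PairData q μ R F ΨR ΨF ΨG) :
    F * kr 1 (tv ΨR ΨG) = kr (tv ΨR ΨG) 1 * F := by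
  have := inv_mul_kr_quot h.twRG (h.twG.inv_right h.detF) (det_inv h.detF) h.skR h.skG h.skG h.detD
  rwa [Matrix.nonsing_inv_nonsing_inv _ h.detF] at this

theorem mul_tv' (h : PairData q μ R F ΨR ΨF ΨG) :
    F * kr (tv ΨR ΨG) 1 = kr 1 (tv ΨR ΨG) * F := by
  have := congrArg (fun Z => F * Z * F) h.inv_mul_tv
  simp only [← mul_assoc, Matrix.mul_nonsing_inv _ h.detF, one_mul] at this
  rw [mul_assoc, mul_assoc, Matrix.nonsing_inv_mul _ h.detF, mul_one] at this
  exact this.symm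

theorem inv_mul_tv' (h : PairData q μ R F ΨR ΨF ΨG) :
    F⁻¹ * kr (tv ΨR ΨG) 1 = kr 1 (tv ΨR ΨG) * F⁻¹ := by
  have := congrArg (fun Z => F⁻¹ * Z * F⁻¹) h.mul_tv
  simp only [← mul_assoc, Matrix.nonsing_inv_mul _ h.detF, one_mul] at this
  rw [mul_assoc, mul_assoc, Matrix.mul_nonsing_inv _ h.detF, mul_one] at this
  exact this.symm

theorem opTwo_mul_tv (h : PairData q μ R F ΨR ΨF ΨG) {i j : ℕ} (hij : i ≠ j) :
    opTwo A i j F * opOne A i (tv ΨR ΨG) = opOne A j (tv ΨR ΨG) * opTwo A i j F := by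
  have := congrArg (opTwo A i j) h.mul_tv'
  rwa [opTwo_mul hij, opTwo_mul hij, opTwo_kr, opTwo_kr, opOne_one, opOne_one, one_mul,
    mul_one] at this

theorem trace_wFst_tv (h : PairData q μ R F ΨR ΨF ΨG) (s t : Fin N) :
    (wFst ΨF s t * tv ΨR ΨG).trace = (tv ΨR ΨG * Dof ΨF) t s := by
  have e0 : sw ΨF = kr (Dof ΨR)⁻¹ 1 * F⁻¹ * kr 1 (Dof ΨR) := by
    rw [mul_assoc, inv_mul_kr h.twR h.detF h.skR h.skF, kr_left_unit h.detD]
  have c1 : ∀ c d : Matrix (Fin N) (Fin N) ℂ, kr c 1 * kr 1 d = kr 1 d * kr c 1 := fun c d => by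
    simp only [kr_mul, mul_one, one_mul]
  have e : sw ΨF * kr (tv ΨR ΨG) 1 = kr 1 (tv ΨR ΨG) * sw ΨF := by
    rw [e0, mul_assoc, ← c1, ← mul_assoc, mul_assoc (kr _ _) (F⁻¹), h.inv_mul_tv',
      ← mul_assoc, c1, mul_assoc, mul_assoc, mul_assoc]
  calc _ = ∑ m, (sw ΨF * kr (tv ΨR ΨG) 1) ![m, t] ![m, s] := by
        simp only [mul_kr_one_apply]
        simp only [Matrix.trace, Matrix.diag, Matrix.mul_apply, wFst]
        rfl
    _ = _ := by
        rw [e]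
        simp only [one_kr_mul_apply]
        simp only [Matrix.mul_apply, Dof, Finset.mul_sum]
        rw [Finset.sum_comm]
        rfl

theorem Tr_inv_opTwo {X F Ψ Φ : MatV N 2 ℂ} (h : Twist ℂ X F) (hF : IsUnit F.det)
    (hΨ : SkewPair X Ψ) (hΦ : SkewPair F Φ) (hD : IsUnit (Dof Ψ).det) {i j : ℕ} (hij : i ≠ j) :
    Tr (Dof Ψ)⁻¹ i (opTwo A i j F⁻¹) = opOne A j (Dof Φ * (Dof Ψ)⁻¹) := by
  rw [Tr_opTwo_fst hij]
  congr 1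
  ext b d
  calc _ = ∑ c, (kr (Dof Ψ)⁻¹ 1 * F⁻¹) ![c, b] ![c, d] := by
        simp only [kr_one_mul_apply]
    _ = _ := by
        rw [kr_inv_mul_inv h hF hΨ hΦ hD]
        simp only [mul_one_kr_apply]
        simp only [Matrix.mul_apply, Dof, Finset.sum_mul]
        rw [Finset.sum_comm]
        rfl

theorem Dof'_eq (h : PairData q μ R F ΨR ΨF ΨG) : Dof' ΨR = (μ ^ 2) • (Dof ΨR)⁻¹ := by
  have := congrArg (fun Z => (Dof ΨR)⁻¹ * Z) (h.bmw.Dof_mul_Dof' h.ne h.skR)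
  simp only [← mul_assoc, Matrix.nonsing_inv_mul _ h.detD, one_mul, mul_smul_comm, mul_one] at this
  exact this

theorem kFk (h : PairData q μ R F ΨR ΨF ΨG) {i j l : ℕ} (hij : i ≠ j) (hjl : j ≠ l)
    (hil : i ≠ l) :
    opTwo A i j (bmwK q μ R) * opTwo A j l F * opTwo A i j (bmwK q μ R) =
      μ • (opTwo A i j (bmwK q μ R) * opOne A l (tv ΨR ΨG)) := by
  have e := Tr_inv_opTwo (A := A) h.twRG (det_inv h.detF) h.skR h.skG h.detD hjl
  rw [Matrix.nonsing_inv_nonsing_inv _ h.detF] at e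
  rw [h.bmw.kZk' h.skR hij (Off.opTwo hij.symm hil.symm _), h.Dof'_eq, Tr_smul_weight, e,
    mul_smul_comm, smul_smul, pow_two, inv_mul_cancel_left₀ h.bmw.mu]
  rfl

theorem kGk (h : PairData q μ R F ΨR ΨF ΨG) {i j l : ℕ} (hij : i ≠ j) (hjl : j ≠ l)
    (hil : i ≠ l) :
    opTwo A i j (bmwK q μ R) * opTwo A j l F⁻¹ * opTwo A i j (bmwK q μ R) =
      μ • (opTwo A i j (bmwK q μ R) * opOne A l (Dof ΨF * (Dof ΨR)⁻¹)) := by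
  have e := Tr_inv_opTwo (A := A) h.twR h.detF h.skR h.skF h.detD hjl
  rw [h.bmw.kZk' h.skR hij (Off.opTwo hij.symm hil.symm _), h.Dof'_eq, Tr_smul_weight, e,
    mul_smul_comm, smul_smul, pow_two, inv_mul_cancel_left₀ h.bmw.mu]

end PairData

end Pair

section TwistRing

variable {B : Type*} [Ring B]

/-- Two braiding units `f, g` and two operators intertwined by them. -/
structure TwistRel (f g : Bˣ) (x y : B) : Prop where
  braid : (f : B) * g * f = g * f * g
  left : x * g * f = g * f * y
  right : y * f * g = f * g * x

namespace TwistRel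

variable {f g : Bˣ} {x y : B}

theorem conj_eq (h : TwistRel f g x y) : (g : B) * f * ↑g⁻¹ = ↑f⁻¹ * g * f := by
  rw [Units.mul_inv_eq_iff_eq_mul, mul_assoc, mul_assoc, ← mul_assoc (g : B), ← h.braid,
    mul_assoc, Units.inv_mul_cancel_left]

theorem right_inv (h : TwistRel f g x y) : y * ↑f⁻¹ * ↑g⁻¹ = ↑f⁻¹ * ↑g⁻¹ * x := by
  rw [Units.mul_inv_eq_iff_eq_mul, Units.mul_inv_eq_iff_eq_mul, mul_assoc, mul_assoc, mul_assoc,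
    ← mul_assoc x, h.left, mul_assoc, Units.inv_mul_cancel_left, Units.inv_mul_cancel_left]

theorem left_inv (h : TwistRel f g x y) : x * ↑g⁻¹ * ↑f⁻¹ = ↑g⁻¹ * ↑f⁻¹ * y := by
  rw [Units.mul_inv_eq_iff_eq_mul, Units.mul_inv_eq_iff_eq_mul, mul_assoc, mul_assoc, mul_assoc,
    ← mul_assoc y, h.right, mul_assoc, Units.inv_mul_cancel_left, Units.inv_mul_cancel_left]

theorem mul_inv_swap (h : TwistRel f g x y) : (g : B) * ↑f⁻¹ = ↑f⁻¹ * ↑g⁻¹ * f * g := by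
  rw [Units.mul_inv_eq_iff_eq_mul]
  simp only [mul_assoc]
  rw [← mul_assoc (f : B), h.braid, mul_assoc, Units.inv_mul_cancel_left,
    Units.inv_mul_cancel_left]

theorem mul_inv_swap' (h : TwistRel f g x y) : (f : B) * ↑g⁻¹ = ↑g⁻¹ * ↑f⁻¹ * g * f := by
  rw [Units.mul_inv_eq_iff_eq_mul]
  simp only [mul_assoc]
  rw [← mul_assoc (g : B), ← h.braid, mul_assoc, Units.inv_mul_cancel_left,
    Units.inv_mul_cancel_left]

theorem mul_swap_left (h : TwistRel f g x y) : y * (g * ↑f⁻¹) = ↑f⁻¹ * ↑g⁻¹ * x * (f * g) := by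
  rw [h.mul_inv_swap, ← h.right_inv]
  simp only [mul_assoc]

theorem mul_swap_right (h : TwistRel f g x y) : (f * ↑g⁻¹) * y = ↑g⁻¹ * ↑f⁻¹ * x * (g * f) := by
  rw [h.mul_inv_swap', mul_assoc, mul_assoc, mul_assoc _ x, ← mul_assoc x, h.left]
  simp only [mul_assoc]

theorem sandwich (h : TwistRel f g x y) :
    y * (g * f * ↑g⁻¹) * y = ↑f⁻¹ * ↑g⁻¹ * (x * g * x) * (g * f) := by
  have e := h.right_inv
  rw [Units.mul_inv_eq_iff_eq_mul] at e
  rw [h.conj_eq, ← mul_assoc, ← mul_assoc, e]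
  simp only [mul_assoc]
  rw [← mul_assoc (g : B) f y, ← h.left]
  simp only [mul_assoc]

/-- The mixed relations of a second intertwined pair of units. -/
theorem inner (h : TwistRel f g x y) {z w : B} (hz : TwistRel f g z w) {Y : B}
    (hY : Commute (g : B) Y) :
    y * (g * (↑f⁻¹ * Y * z * f) * ↑g⁻¹) * y =
      ↑f⁻¹ * ↑g⁻¹ * (x * (f * Y * ↑f⁻¹) * w * x) * (g * f) := by
  have e1 := hz.left_inv
  have e2 : (g : B) * z * ↑g⁻¹ * ↑f⁻¹ = ↑f⁻¹ * w := by
    have e3 := hz.right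
    rw [mul_assoc (g : B), mul_assoc (g : B), e1]
    simp only [← mul_assoc, Units.mul_inv, one_mul]
  calc _ = (y * (g * ↑f⁻¹)) * Y * z * ((f * ↑g⁻¹) * y) := by simp only [mul_assoc]
    _ = ↑f⁻¹ * ↑g⁻¹ * x * f * (g * Y) * z * (↑g⁻¹ * ↑f⁻¹ * x * (g * f)) := by
        rw [h.mul_swap_left, h.mul_swap_right]
        simp only [mul_assoc]
    _ = ↑f⁻¹ * ↑g⁻¹ * x * f * Y * (g * z * ↑g⁻¹ * ↑f⁻¹) * x * (g * f) := by
        rw [hY.eq]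
        simp only [mul_assoc]
    _ = _ := by
        rw [e2]
        simp only [mul_assoc]

theorem commute_shift (h : TwistRel f g x y) {Y : B} (hY : Commute y Y) :
    Commute x (g * (f * Y * ↑f⁻¹) * ↑g⁻¹) := by
  show _ * _ = _ * _
  calc _ = (x * g * f) * Y * ↑f⁻¹ * ↑g⁻¹ := by simp only [mul_assoc]
    _ = g * f * (y * Y) * ↑f⁻¹ * ↑g⁻¹ := by
        rw [h.left]
        simp only [mul_assoc]
    _ = g * f * Y * (y * ↑f⁻¹ * ↑g⁻¹) := by
        rw [hY.eq]
        simp only [mul_assoc]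
    _ = _ := by
        rw [h.right_inv]
        simp only [mul_assoc]

theorem shift_shift (h : TwistRel f g x y) {Y : B} (hY : Commute (g : B) Y) :
    f * (g * (f * Y * ↑f⁻¹ * x) * ↑g⁻¹) * ↑f⁻¹ = g * (f * Y * ↑f⁻¹) * ↑g⁻¹ * y := by
  have e : (g : B) * Y * ↑g⁻¹ = Y := by rw [hY.eq, Units.mul_inv_cancel_right]
  have e2 : (↑f⁻¹ * ↑g⁻¹ * ↑f⁻¹ : B) = ↑g⁻¹ * ↑f⁻¹ * ↑g⁻¹ := by
    have e3 : f * g * f = g * f * g := Units.ext h.braid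
    have := congrArg (fun u : Bˣ => (↑u⁻¹ : B)) e3
    simpa only [_root_.mul_inv_rev, Units.val_mul, mul_assoc] using this
  calc _ = (f * g * f) * Y * ↑f⁻¹ * (x * ↑g⁻¹ * ↑f⁻¹) := by simp only [mul_assoc]
    _ = g * f * g * Y * (↑f⁻¹ * ↑g⁻¹ * ↑f⁻¹) * y := by
        rw [h.left_inv, h.braid]
        simp only [mul_assoc]
    _ = g * f * (g * Y * ↑g⁻¹) * ↑f⁻¹ * ↑g⁻¹ * y := by
        rw [e2]
        simp only [mul_assoc]
    _ = _ := by
        rw [e]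
        simp only [mul_assoc]

end TwistRel

end TwistRing

section Inverse

variable {N : ℕ} [NeZero N] {q μ : ℂ} {R F ΨR ΨF ΨG : MatV N 2 ℂ}
variable {A : Type*} [Ring A] [Algebra ℂ A]

theorem Twist.rel {X : MatV N 2 ℂ} (h : Twist A X F) (hF : IsBraid F) (hd : IsUnit F.det)
    {i j l : ℕ} (hij : i ≠ j) (hjl : j ≠ l) (hil : i ≠ l) :
    TwistRel (opUnit A hd hij) (opUnit A hd hjl) (opTwo A i j X) (opTwo A j l X) where
  braid := (hF.twist i j l hij hjl hil).1
  left := (h i j l hij hjl hil).1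
  right := (h i j l hij hjl hil).2

namespace PairData

theorem kFeGk (h : PairData q μ R F ΨR ΨF ΨG) {j l : ℕ} (hjl : j ≠ l) (s t : Fin N) :
    opTwo A j l (bmwK q μ R) * (opTwo A j l F * eU A j s t * opTwo A j l F⁻¹) *
      opTwo A j l (bmwK q μ R) = (μ * (tv ΨR ΨG * Dof ΨF) t s) • opTwo A j l (bmwK q μ R) := by
  set i := j + l + 1
  have hij : i ≠ j := by omega
  have hil : i ≠ l := by omega
  have T := h.twK.rel (A := A) h.braidF h.detF hij hjl hil
  have e := T.sandwich
  change opTwo A j l (bmwK q μ R) * (opTwo A j l F * opTwo A i j F * opTwo A j l F⁻¹) *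
      opTwo A j l (bmwK q μ R) = opTwo A i j F⁻¹ * opTwo A j l F⁻¹ *
      (opTwo A i j (bmwK q μ R) * opTwo A j l F * opTwo A i j (bmwK q μ R)) *
      (opTwo A j l F * opTwo A i j F) at e
  have hc : Commute (opTwo A i j (bmwK q μ R)) (opOne A l (tv ΨR ΨG)) :=
    (Off.commute_opOne (Off.opTwo hil hjl _) _).symm
  have e1 : opTwo A i j F⁻¹ * opTwo A j l F⁻¹ *
      (opTwo A i j (bmwK q μ R) * opTwo A j l F * opTwo A i j (bmwK q μ R)) *
      (opTwo A j l F * opTwo A i j F) =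
      μ • (opOne A i (tv ΨR ΨG) * opTwo A j l (bmwK q μ R)) := by
    rw [h.kFk hij hjl hil, mul_smul_comm, smul_mul_assoc, hc.eq]
    congr 1
    calc _ = opTwo A i j F⁻¹ * opTwo A j l F⁻¹ * opOne A l (tv ΨR ΨG) *
          (opTwo A i j (bmwK q μ R) * opTwo A j l F * opTwo A i j F) := by simp only [mul_assoc]
      _ = opTwo A i j F⁻¹ * (opTwo A j l F⁻¹ * (opOne A l (tv ΨR ΨG) * opTwo A j l F)) *
          opTwo A i j F * opTwo A j l (bmwK q μ R) := by
          rw [(h.twK i j l hij hjl hil).1]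
          simp only [mul_assoc]
      _ = opTwo A i j F⁻¹ * (opOne A j (tv ΨR ΨG) * opTwo A i j F) *
          opTwo A j l (bmwK q μ R) := by
          rw [← h.opTwo_mul_tv hjl, ← mul_assoc (opTwo A j l F⁻¹), opTwo_inv_mul h.detF hjl,
            one_mul]
          simp only [mul_assoc]
      _ = _ := by
          rw [← h.opTwo_mul_tv hij, ← mul_assoc (opTwo A i j F⁻¹), opTwo_inv_mul h.detF hij,
            one_mul]
  have e3 := congrArg (Tr (wFst ΨF s t) i) (e.trans e1)
  have o1 : ∀ X : MatV N 2 ℂ, Off i (opTwo A j l X) := Off.opTwo hij.symm hil.symm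
  rw [Tr_mul_right (o1 _), Tr_mul_left (o1 _), Tr_mul_right (o1 _), Tr_mul_left (o1 _),
    Tr_wFst h.skF hij, LinearMap.map_smul, Tr_mul_right (o1 _), Tr_opOne, h.trace_wFst_tv,
    smul_mul_assoc, one_mul, smul_smul] at e3
  exact e3

theorem kFZGk (h : PairData q μ R F ΨR ΨF ΨG) {j l : ℕ} (hjl : j ≠ l) {Z : Op N A}
    (hZ : Off l Z) :
    opTwo A j l (bmwK q μ R) * (opTwo A j l F * Z * opTwo A j l F⁻¹) *
      opTwo A j l (bmwK q μ R) =
      μ • (opTwo A j l (bmwK q μ R) * Tr (tv ΨR ΨG * Dof ΨF) j Z) := by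
  have := contract_off (A := A) (W := tv ΨR ΨG * Dof ΨF) (j := j) (Z := Z)
    (x := opTwo A j l (bmwK q μ R) * opTwo A j l F)
    (y := opTwo A j l F⁻¹ * opTwo A j l (bmwK q μ R)) (k := opTwo A j l (bmwK q μ R)) (z := μ)
    (fun s t => by rw [← h.kFeGk hjl]; simp only [mul_assoc])
    fun s t => (commute_cmpt hjl hZ _ s t).mul_left (commute_cmpt hjl hZ _ s t)
  rw [← this]
  simp only [mul_assoc]

/-- The map `φ` on operators. -/
def phiOp (R F ΨR : MatV N 2 ℂ) (Y : Op N A) : Op N A :=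
  Tr (Dof ΨR) 1 (opTwo A 0 1 F * Y * opTwo A 0 1 F⁻¹ * opTwo A 0 1 R)

/-- The inverse of `φ` on operators. -/
def phiInvOp (R F ΨR ΨF ΨG : MatV N 2 ℂ) (Y : Op N A) : Op N A :=
  Tr (tv ΨR ΨG * Dof ΨF) 1 (opTwo A 0 1 F⁻¹ * Y * opTwo A 0 1 R⁻¹ * opTwo A 0 1 F)

theorem phiInvOp_phiOp (h : PairData q μ R F ΨR ΨF ΨG) {Y : Op N A} (h1 : Off 1 Y)
    (h2 : Off 2 Y) (h3 : Off 3 Y) : phiInvOp R F ΨR ΨF ΨG (phiOp R F ΨR Y) = Y := by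
  have o : ∀ {i j l : ℕ} (X : MatV N 2 ℂ), i ≠ l → j ≠ l → Off l (opTwo A i j X) :=
    fun X hi hj => Off.opTwo hi hj X
  have TK := h.twK.rel (A := A) h.braidF h.detF (i := 0) (j := 1) (l := 2) (by omega) (by omega)
    (by omega)
  have TR := h.twR.rel (A := A) h.braidF h.detF (i := 0) (j := 1) (l := 2) (by omega) (by omega)
    (by omega)
  have TI := (h.twR.inv_left h.bmw.det).rel (A := A) h.braidF h.detF (i := 0) (j := 1) (l := 2)
    (by omega) (by omega) (by omega)
  have a := h.bmw.adj (A := A) (i := 0) (j := 1) (l := 2) (by omega) (by omega) (by omega)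
  have c12 : ∀ X : MatV N 2 ℂ, Commute (opTwo A 1 2 X) Y := fun X => Off.commute_opTwo h1 h2 X
  have oZ : Off 2 (opTwo A 0 1 F * Y * opTwo A 0 1 F⁻¹ * opTwo A 0 1 R) :=
    (((o F (by omega) (by omega)).mul h2).mul (o F⁻¹ (by omega) (by omega))).mul
      (o R (by omega) (by omega))
  set x2 := opTwo A 1 2 F * (opTwo A 0 1 F * Y * opTwo A 0 1 F⁻¹) * opTwo A 1 2 F⁻¹ with hx2
  have ox : Off 3 x2 := ((o F (by omega) (by omega)).mul
    (((o F (by omega) (by omega)).mul h3).mul (o F⁻¹ (by omega) (by omega)))).mul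
      (o F⁻¹ (by omega) (by omega))
  have cx : Commute (opTwo A 0 1 (bmwK q μ R)) x2 := TK.commute_shift (c12 _)
  have s1 : opTwo A 0 1 F * phiOp R F ΨR Y * opTwo A 0 1 F⁻¹ =
      Tr (Dof ΨR) 3 (opTwo A 2 3 F * (x2 * opTwo A 1 2 R) * opTwo A 2 3 F⁻¹) := by
    rw [phiOp, ← Tr_conj h.twR h.detF h.skR (show 1 ≠ 2 by omega) oZ,
      ← Tr_mul_left (o F (by omega) (by omega)), ← Tr_mul_right (o F⁻¹ (by omega) (by omega)),
      Tr_conj h.twR h.detF h.skR (show 2 ≠ 3 by omega) (ox.mul (o R (by omega) (by omega)))]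
    exact congrArg _ (TR.shift_shift (c12 _))
  have s2 : opTwo A 0 1 (bmwK q μ R) * (opTwo A 0 1 F * phiOp R F ΨR Y * opTwo A 0 1 F⁻¹) *
      opTwo A 1 2 R⁻¹ * opTwo A 0 1 (bmwK q μ R) = μ • (x2 * opTwo A 0 1 (bmwK q μ R)) := by
    have ck : ∀ X : MatV N 2 ℂ, Commute (opTwo A 0 1 (bmwK q μ R)) (opTwo A 2 3 X) := fun X =>
      (Off.commute_opTwo (o _ (by omega) (by omega)) (o _ (by omega) (by omega)) _).symm
    have cr : ∀ X : MatV N 2 ℂ, Commute (opTwo A 0 1 R⁻¹) (opTwo A 2 3 X) := fun X =>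
      (Off.commute_opTwo (o _ (by omega) (by omega)) (o _ (by omega) (by omega)) _).symm
    have e1 : opTwo A 0 1 (bmwK q μ R) * opTwo A 1 2 R =
        opTwo A 0 1 (bmwK q μ R) * opTwo A 1 2 (bmwK q μ R) * opTwo A 0 1 R⁻¹ := by
      rw [← a.krr', mul_assoc _ (opTwo A 0 1 R), opTwo_mul_inv h.bmw.det (by omega), mul_one]
    have e2 : opTwo A 1 2 R⁻¹ * opTwo A 0 1 (bmwK q μ R) =
        opTwo A 0 1 R * opTwo A 1 2 (bmwK q μ R) * opTwo A 0 1 (bmwK q μ R) := by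
      rw [← one_mul (opTwo A 0 1 R), ← opTwo_inv_mul h.bmw.det (show 1 ≠ 2 by omega),
        mul_assoc (opTwo A 1 2 R⁻¹), mul_assoc (opTwo A 1 2 R⁻¹), mul_assoc (opTwo A 1 2 R⁻¹),
        a.rrk', a.kkk]
    have cv : ∀ X : Op N A, Off 3 X → Commute (opOne A 3 (Dof ΨF * (Dof ΨR)⁻¹)) X :=
      fun X hX => Off.commute_opOne hX _
    have e3 : opTwo A 0 1 (bmwK q μ R) *
        (opTwo A 2 3 F * (x2 * opTwo A 1 2 R) * opTwo A 2 3 F⁻¹) * opTwo A 1 2 R⁻¹ *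
        opTwo A 0 1 (bmwK q μ R) = μ • (opTwo A 2 3 F * opOne A 3 (Dof ΨF * (Dof ΨR)⁻¹) *
          (x2 * opTwo A 0 1 (bmwK q μ R))) := by
      calc _ = (opTwo A 0 1 (bmwK q μ R) * opTwo A 2 3 F) * x2 * opTwo A 1 2 R *
            opTwo A 2 3 F⁻¹ * (opTwo A 1 2 R⁻¹ * opTwo A 0 1 (bmwK q μ R)) := by
            simp only [mul_assoc]
        _ = opTwo A 2 3 F * (opTwo A 0 1 (bmwK q μ R) * x2) * opTwo A 1 2 R *
            opTwo A 2 3 F⁻¹ * (opTwo A 0 1 R * opTwo A 1 2 (bmwK q μ R) *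
              opTwo A 0 1 (bmwK q μ R)) := by
            rw [(ck F).eq, e2]
            simp only [mul_assoc]
        _ = opTwo A 2 3 F * x2 * (opTwo A 0 1 (bmwK q μ R) * opTwo A 1 2 R) *
            opTwo A 2 3 F⁻¹ * (opTwo A 0 1 R * opTwo A 1 2 (bmwK q μ R) *
              opTwo A 0 1 (bmwK q μ R)) := by
            rw [cx.eq]
            simp only [mul_assoc]
        _ = opTwo A 2 3 F * x2 * opTwo A 0 1 (bmwK q μ R) * opTwo A 1 2 (bmwK q μ R) *
            (opTwo A 0 1 R⁻¹ * opTwo A 2 3 F⁻¹) * opTwo A 0 1 R * opTwo A 1 2 (bmwK q μ R) *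
              opTwo A 0 1 (bmwK q μ R) := by
            rw [e1]
            simp only [mul_assoc]
        _ = opTwo A 2 3 F * x2 * opTwo A 0 1 (bmwK q μ R) * opTwo A 1 2 (bmwK q μ R) *
            opTwo A 2 3 F⁻¹ * (opTwo A 0 1 R⁻¹ * opTwo A 0 1 R) * opTwo A 1 2 (bmwK q μ R) *
              opTwo A 0 1 (bmwK q μ R) := by
            rw [(cr F⁻¹).eq]
            simp only [mul_assoc]
        _ = opTwo A 2 3 F * x2 * opTwo A 0 1 (bmwK q μ R) * (opTwo A 1 2 (bmwK q μ R) *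
            opTwo A 2 3 F⁻¹ * opTwo A 1 2 (bmwK q μ R)) * opTwo A 0 1 (bmwK q μ R) := by
            rw [opTwo_inv_mul h.bmw.det (by omega), mul_one]
            simp only [mul_assoc]
        _ = μ • (opTwo A 2 3 F * x2 * (opTwo A 0 1 (bmwK q μ R) * opTwo A 1 2 (bmwK q μ R) *
            (opOne A 3 (Dof ΨF * (Dof ΨR)⁻¹) * opTwo A 0 1 (bmwK q μ R)))) := by
            rw [h.kGk (by omega) (by omega) (by omega)]
            simp only [mul_smul_comm, smul_mul_assoc, mul_assoc]
        _ = μ • (opTwo A 2 3 F * x2 * (opTwo A 0 1 (bmwK q μ R) *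
            opOne A 3 (Dof ΨF * (Dof ΨR)⁻¹))) := by
            rw [(cv _ (o _ (by omega) (by omega))).eq, ← mul_assoc _ (opTwo A 0 1 (bmwK q μ R)),
              a.kkk]
        _ = _ := by
            rw [← (cv _ (o _ (by omega) (by omega))).eq, mul_assoc, ← mul_assoc x2,
              ← (cv _ ox).eq]
            simp only [mul_assoc]
    have ok : Off (A := A) 3 (opTwo A 0 1 (bmwK q μ R)) := o _ (by omega) (by omega)
    rw [s1, ← Tr_mul_left ok, ← Tr_mul_right (o R⁻¹ (by omega) (by omega)), ← Tr_mul_right ok, e3,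
      LinearMap.map_smul, Tr_mul_right (ox.mul ok), Tr_opOne_right, mul_assoc,
      Matrix.nonsing_inv_mul _ h.detD, mul_one, Tr_skew h.skF (by omega), one_mul]
  have oY : Off 2 (phiOp R F ΨR Y) := Tr_off_of _ oZ
  have s3 : μ • (opTwo A 1 2 (bmwK q μ R) * phiInvOp R F ΨR ΨF ΨG (phiOp R F ΨR Y)) =
      μ • (opTwo A 1 2 (bmwK q μ R) * Y) := by
    rw [phiInvOp, ← h.kFZGk (by omega) (((o F⁻¹ (by omega) (by omega)).mul oY).mul
      (o R⁻¹ (by omega) (by omega)) |>.mul (o F (by omega) (by omega)))]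
    have oY1 : Commute (opTwo A 1 2 F) (phiOp R F ΨR Y) := Off.commute_opTwo (Tr_off _ _ _) oY _
    refine (TK.inner TI oY1).trans ?_
    change opTwo A 0 1 F⁻¹ * opTwo A 1 2 F⁻¹ * (opTwo A 0 1 (bmwK q μ R) *
      (opTwo A 0 1 F * phiOp R F ΨR Y * opTwo A 0 1 F⁻¹) * opTwo A 1 2 R⁻¹ *
        opTwo A 0 1 (bmwK q μ R)) * (opTwo A 1 2 F * opTwo A 0 1 F) = _
    rw [s2, mul_smul_comm, smul_mul_assoc, (c12 _).eq]
    congr 1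
    calc _ = opTwo A 0 1 F⁻¹ * opTwo A 1 2 F⁻¹ * x2 * (opTwo A 0 1 (bmwK q μ R) *
          opTwo A 1 2 F * opTwo A 0 1 F) := by simp only [mul_assoc]
      _ = opTwo A 0 1 F⁻¹ * ((opTwo A 1 2 F⁻¹ * opTwo A 1 2 F) * (opTwo A 0 1 F * Y *
          (opTwo A 0 1 F⁻¹ * (opTwo A 1 2 F⁻¹ * opTwo A 1 2 F) * opTwo A 0 1 F))) *
            opTwo A 1 2 (bmwK q μ R) := by
          rw [(h.twK 0 1 2 (by omega) (by omega) (by omega)).1, hx2]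
          simp only [mul_assoc]
      _ = _ := by
          rw [opTwo_inv_mul h.detF (by omega), mul_one, one_mul, opTwo_inv_mul h.detF (by omega),
            mul_one, ← mul_assoc, opTwo_inv_mul h.detF (by omega), one_mul]
  have s4 := congrArg (fun X => Tr (Dof ΨR) 2 X) s3
  have oP : Off 2 (phiInvOp R F ΨR ΨF ΨG (phiOp R F ΨR Y)) :=
    Tr_off_of _ (((((o F⁻¹ (by omega) (by omega)).mul oY).mul
      (o R⁻¹ (by omega) (by omega))).mul (o F (by omega) (by omega))))
  simp only [LinearMap.map_smul, Tr_mul_right oP, Tr_mul_right h2,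
    h.bmw.Tr_k h.ne h.skR (show 1 ≠ 2 by omega), smul_mul_assoc, one_mul, smul_smul] at s4
  exact smul_right_injective _ (mul_ne_zero h.bmw.mu h.bmw.mu) s4

end PairData

end Inverse

section RankOne

variable {N : ℕ} [NeZero N] {A : Type*} [Ring A] [Algebra ℂ A] {q μ : ℂ} {R Ψ : MatV N 2 ℂ}

theorem BMWData.contract_entry (h : BMWData q μ R) (hΨ : SkewPair R Ψ) (s t x y z u : Fin N) :
    ∑ w, bmwK q μ R ![x, y] ![s, w] * bmwK q μ R ![t, w] ![z, u] =
      μ⁻¹ * Dof Ψ t s * bmwK q μ R ![x, y] ![z, u] := by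
  have e := contract_fst (A := ℂ) hΨ (i := 2) (j := 0) (l := 1) (by omega) (by omega)
    (h.k_r_k (by omega) (by omega) (by omega)) s t
  rw [← opOne_single, ← mul_one (opOne ℂ 0 _), ← opOne_one 1, ← opTwo_kr,
    ← opTwo_mul (by omega), ← opTwo_mul (by omega), ← opTwo_smul] at e
  have e1 := congrFun (congrFun (opTwo_injective (by omega) e) ![x, y]) ![z, u]
  rw [mul_apply_pair] at e1
  simp only [mul_kr_one_apply] at e1
  rw [Matrix.smul_apply, smul_eq_mul] at e1
  rw [← e1, Finset.sum_comm]
  refine Finset.sum_congr rfl fun w _ => ?_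
  rw [Finset.sum_eq_single t]
  · rw [Finset.sum_eq_single s]
    · simp
    · intro b _ hb; simp [Matrix.single, hb.symm]
    · simp
  · intro b _ hb
    rw [Finset.sum_eq_zero, zero_mul]
    intro c _
    simp [Matrix.single, hb.symm]
  · simp

/-- The contraction operator has rank one. -/
theorem BMWData.rank_one (h : BMWData q μ R) (hK : bmwK q μ R ≠ 0) (hΨ : SkewPair R Ψ)
    (hD : IsUnit (Dof Ψ).det) (X : MatV N 2 ℂ) :
    ∃ θ : ℂ, bmwK q μ R * X * bmwK q μ R = θ • bmwK q μ R := by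
  obtain ⟨x, y, z, u, hne⟩ : ∃ x y z u, bmwK q μ R ![x, y] ![z, u] ≠ 0 := by
    by_contra! h0
    exact hK (MatV.ext_pair fun a b c d => h0 a b c d)
  set K := bmwK q μ R
  let U : Matrix (Fin N) (Fin N) ℂ := fun s w => K ![x, y] ![s, w]
  let T : Matrix (Fin N) (Fin N) ℂ := fun w t => K ![t, w] ![z, u]
  have hUT : U * T = (μ⁻¹ * K ![x, y] ![z, u]) • (Dof Ψ)ᵀ := by
    ext s t
    rw [Matrix.mul_apply, Matrix.smul_apply, Matrix.transpose_apply, smul_eq_mul]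
    exact (h.contract_entry hΨ s t x y z u).trans (by ring)
  have hU : IsUnit U.det := by
    have : IsUnit (U * T).det := by
      rw [hUT, Matrix.det_smul, Matrix.det_transpose]
      exact ((isUnit_iff_ne_zero.mpr (mul_ne_zero (inv_ne_zero h.mu) hne)).pow _).mul hD
    rw [Matrix.det_mul] at this
    exact isUnit_of_mul_isUnit_left this
  let p : Fin N → Fin N → ℂ := fun t w => ∑ s, U⁻¹ w s * (μ⁻¹ * Dof Ψ t s)
  have hp : ∀ t w a b, K ![t, w] ![a, b] = p t w * K ![x, y] ![a, b] := by
    intro t w a b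
    have e : U *ᵥ (fun w => K ![t, w] ![a, b]) =
        fun s => μ⁻¹ * Dof Ψ t s * K ![x, y] ![a, b] :=
      funext fun s => h.contract_entry hΨ s t x y a b
    have e2 := congrArg (fun v => (U⁻¹ *ᵥ v) w) e
    simp only [Matrix.mulVec_mulVec, Matrix.nonsing_inv_mul _ hU, Matrix.one_mulVec] at e2
    rw [e2, Matrix.mulVec, dotProduct, Finset.sum_mul]
    exact Finset.sum_congr rfl fun s _ => (mul_assoc _ _ _).symm
  refine ⟨∑ c, ∑ d, (K * X) ![x, y] ![c, d] * p c d, MatV.ext_pair fun a b c d => ?_⟩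
  have hKX : ∀ c' d', (K * X) ![a, b] ![c', d'] = p a b * (K * X) ![x, y] ![c', d'] := by
    intro c' d'
    rw [mul_apply_pair, mul_apply_pair]
    simp only [hp a b, Finset.mul_sum, mul_assoc]
  rw [mul_apply_pair, Matrix.smul_apply, hp a b, smul_eq_mul]
  simp only [hKX, Finset.sum_mul]
  refine Finset.sum_congr rfl fun c' _ => Finset.sum_congr rfl fun d' _ => ?_
  rw [hp c' d']
  ring

end RankOne

section Embedding

variable {N : ℕ} {A : Type*} [Ring A] [Algebra ℂ A]

/-- A two-leg operator on each pair of consecutive legs. -/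
def leg (A : Type*) [Ring A] [Algebra ℂ A] (X : MatV N 2 ℂ) (j : ℕ) : Op N A :=
  opTwo A j (j + 1) X

/-- The copies of the quantum matrix on the successive legs. -/
def mleg (F : MatV N 2 ℂ) (M : Matrix (Fin N) (Fin N) A) : ℕ → Op N A
  | 0 => iot M
  | j + 1 => leg A F j * mleg F M j * leg A F⁻¹ j

theorem val_pair {n p : ℕ} (hp : p + 1 < n) :
    ![((⟨p, by omega⟩ : Fin n) : ℕ), ((⟨p + 1, hp⟩ : Fin n) : ℕ)] = ![p, p + 1] := rfl

theorem emb_cmap_lift2 [NeZero N] {n p : ℕ} (hp : p + 1 < n) (X : MatV N 2 ℂ) :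
    emb (A := A) (Fin.val : Fin n → ℕ) (cmap (lift2 p X)) = leg A X p := by
  rw [cmap_lift2, emb_lift2 Fin.val_injective hp, val_pair, emb_pair (by omega), leg]

theorem emb_lift1_zero [NeZero N] {n : ℕ} (hn : 0 < n) (X : Matrix (Fin N) (Fin N) A) :
    emb (Fin.val : Fin n → ℕ) (lift1 0 X) = iot X := by
  rw [emb_lift1 Fin.val_injective hn]
  exact emb_single _

theorem emb_Mcopy [NeZero N] {n : ℕ} (F : MatV N 2 ℂ) (M : Matrix (Fin N) (Fin N) A) {j : ℕ}
    (hj : j < n) : emb (Fin.val : Fin n → ℕ) (Mcopy F M j) = mleg F M j := by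
  induction j with
  | zero => exact emb_lift1_zero hj M
  | succ j ih =>
    rw [Mcopy, emb_mul Fin.val_injective, emb_mul Fin.val_injective, ih (by omega),
      emb_cmap_lift2 hj, emb_cmap_lift2 hj, mleg]

theorem emb_Mprod [NeZero N] {n : ℕ} (F : MatV N 2 ℂ) (M : Matrix (Fin N) (Fin N) A) {j : ℕ}
    (hj : j ≤ n) : emb (Fin.val : Fin n → ℕ) (Mprod F M j) = kap (mleg F M) 0 j := by
  induction j with
  | zero => exact emb_one _
  | succ j ih =>
    rw [Mprod, emb_mul Fin.val_injective, ih (by omega), emb_Mcopy F M hj, kap, zero_add]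

theorem emb_MprodFrom2 [NeZero N] {n : ℕ} (F : MatV N 2 ℂ) (M : Matrix (Fin N) (Fin N) A)
    {j : ℕ} (hj : j < n) :
    emb (Fin.val : Fin n → ℕ) (MprodFrom2 F M j) = kap (mleg F M) 1 j := by
  induction j with
  | zero => exact emb_one _
  | succ j ih =>
    rw [MprodFrom2, emb_mul Fin.val_injective, ih (by omega), emb_Mcopy F M hj, kap, add_comm 1 j]

theorem cmap_smul {m : Type*} (z : ℂ) (X : Matrix m m ℂ) : cmap (A := A) (z • X) = z • cmap X := by
  ext a b
  simp [cmap, Algebra.smul_def]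

theorem cmap_add {m : Type*} (X Y : Matrix m m ℂ) :
    cmap (A := A) (X + Y) = cmap X + cmap Y := by
  ext a b
  simp [cmap]

theorem cmap_ext1 {n : ℕ} (X : MatV N n ℂ) : cmap (A := A) (ext1 X) = ext1 (cmap X) := by
  ext a b
  simp only [cmap, Matrix.map_apply, ext1]
  split_ifs <;> simp

theorem emb_asym [NeZero N] (q μ : ℂ) (hq : q ≠ 0) (R : MatV N 2 ℂ) (n : ℕ) :
    emb (A := A) (Fin.val : Fin n → ℕ) (cmap (asym q μ R n)) =
      aS q μ (leg A R) (leg A (bmwK q μ R)) n := by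
  induction n with
  | zero => rw [asym, cmap_one, emb_one, aS]
  | succ n ih =>
    cases n with
    | zero => rw [asym, cmap_one, emb_one, aS]
    | succ n =>
      have e1 : emb (A := A) (Fin.val : Fin (n + 2) → ℕ) (cmap (ext1 (asym q μ R (n + 1)))) =
          aS q μ (leg A R) (leg A (bmwK q μ R)) (n + 1) := by
        rw [cmap_ext1, emb_ext1 Fin.val_injective, ← ih]
        rfl
      have e2 : spx q (n + 1) = q ^ (-(2 * ((n : ℤ) + 1))) := by
        rw [spx]
        push_cast
        rfl
      have e3 : q * spx q (n + 1) = q ^ (1 - 2 * ((n : ℤ) + 1)) := by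
        rw [e2, sub_eq_add_neg, zpow_add₀ hq, zpow_one]
      rw [asym, cmap_smul, cmap_mul, cmap_mul, cmap_add, cmap_add, cmap_smul, cmap_smul, cmap_one,
        emb_smul, emb_mul Fin.val_injective, emb_mul Fin.val_injective, emb_add, emb_add,
        emb_smul, emb_smul, emb_one, e1, emb_cmap_lift2 (by omega), emb_cmap_lift2 (by omega), aS,
        aC, bxS, bxA, bxB, e3, e2]

theorem iot_ptrace (W : Matrix (Fin N) (Fin N) ℂ) (X : MatV N 2 A) :
    iot (toN (ptrace (cmap W) X)) = Tr W 1 (emb (Fin.val : Fin 2 → ℕ) X) :=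
  iot_trTail W 1 X

theorem gam_trAll_two (W : Matrix (Fin N) (Fin N) ℂ) (X : MatV N 2 A) :
    gam N (trAll (cmap W) 2 X) = Tr W 0 (Tr W 1 (emb (Fin.val : Fin 2 → ℕ) X)) := by
  rw [← emb_ptrace, ← emb_ptrace]
  refine Op.ext fun f a => ?_
  have e : ∀ b, Function.extend (Fin.val : Fin 0 → ℕ) b a = a := fun b =>
    funext fun i => Function.extend_apply' _ _ _ fun ⟨j, _⟩ => j.elim0
  rw [emb_apply, gam_apply]
  simp only [e, Fintype.sum_unique]
  congr 1

theorem iot_mul (X Y : Matrix (Fin N) (Fin N) A) : iot (X * Y) = iot X * iot Y := by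
  have e : ∀ s t u v, gam N (X s t) * eU A 0 s t * (gam N (Y u v) * eU A 0 u v) =
      if t = u then gam N (X s t * Y u v) * eU A 0 s v else 0 := by
    intro s t u v
    rw [mul_assoc, ← mul_assoc (eU A 0 s t), ← (gam_comm_eU _ _ _ _).eq, mul_assoc, eU_mul_same,
      gam_mul, mul_assoc]
    split_ifs <;> simp
  have e2 : ∀ s v, gam N ((X * Y) s v) = ∑ j, gam N (X s j * Y j v) := by
    intro s v
    refine Op.ext fun f a => ?_
    simp [gam_apply, Op.sum_apply, Finset.sum_mul, Matrix.mul_apply]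
  rw [iot, iot, iot, Finset.sum_mul]
  refine Finset.sum_congr rfl fun s _ => ?_
  simp only [e2, Finset.sum_mul]
  rw [Finset.sum_comm]
  refine Finset.sum_congr rfl fun t _ => ?_
  simp only [Finset.mul_sum, e]
  symm
  rw [Finset.sum_eq_single t]
  · simp
  · intro b _ hb
    simp [hb.symm]
  · simp

theorem iot_smul (z : ℂ) (X : Matrix (Fin N) (Fin N) A) : iot (z • X) = z • iot X := by
  simp [iot, gam_smul, Finset.smul_sum]

theorem iot_rmulE (X : Matrix (Fin N) (Fin N) A) (x : A) :
    iot (rmulE X x) = iot X * gam N x := by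
  simp only [iot, rmulE, Finset.sum_mul, gam_mul, mul_assoc, (gam_comm_eU x _ _ _).eq]

variable [NeZero N] {R F ΨR ΨF ΨG : MatV N 2 ℂ} {q μ : ℂ}

theorem iot_phi (X : Matrix (Fin N) (Fin N) A) :
    iot (phi R F ΨR X) = PairData.phiOp R F ΨR (iot X) := by
  rw [phi, iot_ptrace, emb_mul Fin.val_injective, emb_mul Fin.val_injective,
    emb_mul Fin.val_injective, emb_cmap_lift2 (by omega), emb_cmap_lift2 (by omega),
    emb_cmap_lift2 (by omega), emb_lift1_zero (by omega)]
  rfl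

theorem iot_xi (X : Matrix (Fin N) (Fin N) A) :
    iot (xi q μ R F ΨR X) =
      Tr (Dof ΨR) 1 (leg A F 0 * iot X * leg A F⁻¹ 0 * leg A (bmwK q μ R) 0) := by
  rw [xi, iot_ptrace, emb_mul Fin.val_injective, emb_mul Fin.val_injective,
    emb_mul Fin.val_injective, emb_cmap_lift2 (by omega), emb_cmap_lift2 (by omega),
    emb_cmap_lift2 (by omega), emb_lift1_zero (by omega)]

theorem PairData.iot_phiInv (h : PairData q μ R F ΨR ΨF ΨG) {ΨR' : MatV N 2 ℂ}
    (hΨ' : SkewPair R⁻¹ ΨR') (X : Matrix (Fin N) (Fin N) A) :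
    iot (phiInv μ R F ΨF ΨG ΨR' X) = PairData.phiInvOp R F ΨR ΨF ΨG (iot X) := by
  have e : Dof ΨG * (Dof ΨR')⁻¹ * Dof ΨF = μ ^ 2 • (tv ΨR ΨG * Dof ΨF) := by
    have e1 : (Dof ΨR')⁻¹ = μ ^ 2 • (Dof ΨR)⁻¹ := by
      refine Matrix.inv_eq_left_inv ?_
      rw [h.bmw.Dof_inv h.ne h.skR hΨ', smul_mul_smul_comm, Matrix.nonsing_inv_mul _ h.detD,
        ← mul_pow, mul_inv_cancel₀ h.bmw.mu, one_pow, one_smul]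
    rw [e1, tv, mul_smul_comm, smul_mul_assoc]
  rw [phiInv, iot_smul, iot_ptrace, emb_mul Fin.val_injective, emb_mul Fin.val_injective,
    emb_mul Fin.val_injective, emb_cmap_lift2 (by omega), emb_cmap_lift2 (by omega),
    emb_cmap_lift2 (by omega), emb_lift1_zero (by omega), e, Tr_smul_weight, smul_smul,
    ← mul_pow, inv_mul_cancel₀ h.bmw.mu, one_pow, one_smul]
  rfl

end Embedding

theorem commute_of_semiconj {B : Type*} [Ring B] {u x y x' y' : B} (hu : IsUnit u)
    (hx : SemiconjBy u x x') (hy : SemiconjBy u y y') (c : Commute x y) : Commute x' y' := by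
  refine hu.mul_left_injective ?_
  exact (hx.mul_right hy).eq.symm.trans ((congrArg (u * ·) c.eq).trans (hy.mul_right hx).eq)

theorem SemiconjBy.kap {B : Type*} [Ring B] {u : B} {x : ℕ → B} {s n : ℕ}
    (h : ∀ i, i < n → SemiconjBy u (x (s + i)) (x (s + 1 + i))) :
    SemiconjBy u (kap x s n) (kap x (s + 1) n) := by
  induction n with
  | zero => exact SemiconjBy.one_right u
  | succ n ih => exact (ih fun i hi => h i (by omega)).mul_right (h n (by omega))

section Shift

variable {N : ℕ} {A : Type*} [Ring A] [Algebra ℂ A]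
variable {R F ΨR ΨF ΨG : MatV N 2 ℂ} {q μ : ℂ}

theorem Off.leg {j l : ℕ} (X : MatV N 2 ℂ) (h : l < j ∨ j + 1 < l) : Off l (leg A X j) :=
  Off.opTwo (by omega) (by omega) X

theorem Off.mleg (M : Matrix (Fin N) (Fin N) A) {i l : ℕ} (h : i < l) : Off l (mleg F M i) := by
  induction i with
  | zero => exact Off.iot (by omega) M
  | succ i ih =>
    exact ((Off.leg F (by omega)).mul (ih (by omega))).mul (Off.leg F⁻¹ (by omega))

theorem Off.kap {B : ℕ → Op N A} {s n l : ℕ} (h : ∀ i, i < n → Off l (B (s + i))) :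
    Off l (kap B s n) := fun a b => kap_commute fun i hi => h i hi a b

theorem leg_commute_leg (X Y : MatV N 2 ℂ) {i j : ℕ} (hij : i + 2 ≤ j ∨ j + 2 ≤ i) :
    Commute (leg A X i) (leg A Y j) :=
  Off.commute_opTwo (Off.leg Y (by omega)) (Off.leg Y (by omega)) X

theorem gam_commute_leg (x : A) (X : MatV N 2 ℂ) (j : ℕ) : Commute (gam N x) (leg A X j) :=
  (Off.commute_opTwo (Off.gam x) (Off.gam x) X).symm

theorem leg_commute_mleg_of_lt (M : Matrix (Fin N) (Fin N) A) (X : MatV N 2 ℂ) {i j : ℕ}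
    (h : i < j) : Commute (leg A X j) (mleg F M i) :=
  Off.commute_opTwo (Off.mleg M h) (Off.mleg M (by omega)) X

theorem Twist.semiconj_leg {X : MatV N 2 ℂ} (hX : Twist A X F) {i m : ℕ} (hi : i + 1 < m) :
    SemiconjBy (kap (leg A F) 0 m) (leg A X i) (leg A X (i + 1)) := by
  induction m, hi using Nat.le_induction with
  | base =>
    have e : SemiconjBy (leg A F i * leg A F (i + 1)) (leg A X i) (leg A X (i + 1)) :=
      ((mul_assoc _ _ _).symm.trans
        (hX i (i + 1) (i + 2) (by omega) (by omega) (by omega)).2).symm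
    rw [show (i + 1).succ = i + 2 from rfl, kap, kap, zero_add, zero_add, mul_assoc]
    refine SemiconjBy.mul_left (Commute.symm (kap_commute fun l hl => ?_)) e
    exact leg_commute_leg X F (by omega)
  | succ m hm ih =>
    rw [kap, zero_add]
    exact ih.mul_left (leg_commute_leg F X (by omega))

variable [NeZero N]

namespace PairData

theorem leg_commute_mleg (h : PairData q μ R F ΨR ΨF ΨG) (M : Matrix (Fin N) (Fin N) A)
    {X : MatV N 2 ℂ} (hX : Twist A X F) {i j : ℕ} (hij : j + 2 ≤ i) :
    Commute (leg A X j) (mleg F M i) := by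
  induction i, hij using Nat.le_induction with
  | base =>
    exact (hX.rel h.braidF h.detF (i := j) (j := j + 1) (l := j + 2) (by omega) (by omega)
      (by omega)).commute_shift (leg_commute_mleg_of_lt M X (by omega))
  | succ i hij ih =>
    exact ((leg_commute_leg X F (by omega)).mul_right ih).mul_right
      (leg_commute_leg X F⁻¹ (by omega))

theorem isUnit_kap_leg (h : PairData q μ R F ΨR ΨF ΨG) (m : ℕ) :
    IsUnit (kap (leg A F) 0 m) := by
  induction m with
  | zero => exact isUnit_one
  | succ m ih => exact ih.mul (opUnit A h.detF (i := 0 + m) (j := 0 + m + 1) (by omega)).isUnit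

theorem semiconj_mleg (h : PairData q μ R F ΨR ΨF ΨG) (M : Matrix (Fin N) (Fin N) A)
    {i m : ℕ} (hi : i < m) :
    SemiconjBy (kap (leg A F) 0 m) (mleg F M i) (mleg F M (i + 1)) := by
  induction m, hi using Nat.le_induction with
  | base =>
    rw [Nat.succ_eq_add_one, kap, zero_add]
    refine SemiconjBy.mul_left (Commute.symm (kap_commute fun l hl => ?_)) ?_
    · exact (h.leg_commute_mleg M h.twF (by omega)).symm
    · show _ * _ = _ * _
      rw [mleg, mul_assoc, leg, leg, opTwo_inv_mul h.detF (by omega), mul_one]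
  | succ m hm ih =>
    rw [kap, zero_add]
    exact ih.mul_left (leg_commute_mleg_of_lt M F (by omega))

theorem tau_shift (h : PairData q μ R F ΨR ΨF ΨG) {n : ℕ} {Z Z' : Op N A} (hs : SemiconjBy (kap (leg A F) 0 (n + 1)) Z Z')
    (ho : ∀ l, n < l → Off l Z) :
    tau (Dof ΨR) 1 n Z' = leg A F 0 * tau (Dof ΨR) 0 n Z * leg A F⁻¹ 0 := by
  induction n generalizing Z Z' with
  | zero =>
    have e : leg A F 0 * Z = Z' * leg A F 0 := by simpa [kap] using hs.eq
    rw [tau, tau, e, mul_assoc, leg, leg, opTwo_mul_inv h.detF (by omega), mul_one]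
  | succ n ih =>
    rw [tau, tau, zero_add]
    refine ih (Z := Tr (Dof ΨR) (n + 1) Z) ?_ fun l hl => ?_
    · have o : Off (1 + n + 1) (kap (leg A F) 0 (n + 1)) :=
        Off.kap fun i hi => Off.leg F (by omega)
      have e := Tr_conj (A := A) h.twR h.detF h.skR (j := n + 1) (l := 1 + n + 1) (by omega)
        (ho _ (by omega))
      show _ * _ = _ * _
      rw [← e, ← Tr_mul_left o, ← Tr_mul_right o]
      congr 1
      have e2 := hs.eq
      rw [kap, zero_add, show leg A F (n + 1) = opTwo A (n + 1) (1 + n + 1) F by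
        rw [leg, add_comm 1 n]] at e2
      calc _ = (kap (leg A F) 0 (n + 1) * opTwo A (n + 1) (1 + n + 1) F * Z) *
            opTwo A (n + 1) (1 + n + 1) F⁻¹ := by simp only [mul_assoc]
        _ = _ := by
          rw [e2, mul_assoc, mul_assoc, opTwo_mul_inv h.detF (by omega), mul_one]
    · rcases Nat.lt_or_ge (n + 1) l with hl' | hl'
      · exact Tr_off_of _ (ho l hl')
      · obtain rfl : l = n + 1 := by omega
        exact Tr_off _ _ _

variable {M : Matrix (Fin N) (Fin N) A}

theorem leg_commute_mleg_pair (h : PairData q μ R F ΨR ΨF ΨG)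
    (hM : Commute (leg A R 0) (mleg F M 0 * mleg F M 1)) (j : ℕ) :
    Commute (leg A R j) (mleg F M j * mleg F M (j + 1)) := by
  induction j with
  | zero => exact hM
  | succ j ih =>
    exact commute_of_semiconj (h.isUnit_kap_leg (j + 2)) (h.twR.semiconj_leg (by omega))
      ((h.semiconj_mleg M (by omega)).mul_right (h.semiconj_mleg M (by omega))) ih

theorem kleg_commute_mleg_pair (h : PairData q μ R F ΨR ΨF ΨG)
    (hM : Commute (leg A R 0) (mleg F M 0 * mleg F M 1)) (j : ℕ) :
    Commute (leg A (bmwK q μ R) j) (mleg F M j * mleg F M (j + 1)) := by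
  rw [leg, opTwo_bmwK (by omega)]
  exact kOf_commute (h.leg_commute_mleg_pair hM j).eq

theorem commute_kap_mleg (h : PairData q μ R F ΨR ΨF ΨG) {X : MatV N 2 ℂ} (hX : Twist A X F) {s m j : ℕ} (hs : s ≤ j)
    (hj : j + 1 < s + m)
    (hp : Commute (leg A X j) (mleg F M j * mleg F M (j + 1))) :
    Commute (leg A X j) (kap (mleg F M) s m) := by
  induction m with
  | zero => omega
  | succ m ih =>
    rcases Nat.lt_or_ge (j + 1) (s + m) with h1 | h1
    · exact (ih h1).mul_right (h.leg_commute_mleg M hX (by omega))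
    · obtain ⟨p, rfl⟩ : ∃ p, m = p + 1 := ⟨m - 1, by omega⟩
      obtain rfl : j = s + p := by omega
      rw [kap, kap, mul_assoc]
      exact (kap_commute fun i hi => leg_commute_mleg_of_lt M X (by omega)).mul_right hp

theorem rleg_commute_kap (h : PairData q μ R F ΨR ΨF ΨG)
    (hM : Commute (leg A R 0) (mleg F M 0 * mleg F M 1)) {s m j : ℕ} (hs : s ≤ j) (hj : j + 1 < s + m) :
    Commute (leg A R j) (kap (mleg F M) s m) :=
  h.commute_kap_mleg h.twR hs hj (h.leg_commute_mleg_pair hM j)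

theorem kleg_commute_kap (h : PairData q μ R F ΨR ΨF ΨG)
    (hM : Commute (leg A R 0) (mleg F M 0 * mleg F M 1)) {s m j : ℕ} (hs : s ≤ j) (hj : j + 1 < s + m) :
    Commute (leg A (bmwK q μ R) j) (kap (mleg F M) s m) :=
  h.commute_kap_mleg h.twK hs hj (h.kleg_commute_mleg_pair hM j)

end PairData

end Shift

section Cyclic

variable {N : ℕ} {A : Type*} [Ring A] [Algebra ℂ A]

theorem tau_smul (D : Matrix (Fin N) (Fin N) ℂ) (s n : ℕ) (z : ℂ) (Z : Op N A) :
    tau D s n (z • Z) = z • tau D s n Z := by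
  induction n generalizing Z with
  | zero => rfl
  | succ n ih => rw [tau, tau, map_smul, ih]

theorem tau_add (D : Matrix (Fin N) (Fin N) ℂ) (s n : ℕ) (Y Z : Op N A) :
    tau D s n (Y + Z) = tau D s n Y + tau D s n Z := by
  induction n generalizing Y Z with
  | zero => rfl
  | succ n ih => rw [tau, tau, tau, map_add, ih]

theorem tau_mul_left (D : Matrix (Fin N) (Fin N) ℂ) {s n : ℕ} {z : Op N A}
    (h : ∀ l, s < l → l ≤ s + n → Off l z) (Z : Op N A) :
    tau D s n (z * Z) = z * tau D s n Z := by
  induction n generalizing Z with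
  | zero => rfl
  | succ n ih =>
    rw [tau, tau, Tr_mul_left (h _ (by omega) (by omega)), ih fun l h1 h2 => h l h1 (by omega)]

theorem tau_mul_right (D : Matrix (Fin N) (Fin N) ℂ) {s n : ℕ} {z : Op N A}
    (h : ∀ l, s < l → l ≤ s + n → Off l z) (Z : Op N A) :
    tau D s n (Z * z) = tau D s n Z * z := by
  induction n generalizing Z with
  | zero => rfl
  | succ n ih =>
    rw [tau, tau, Tr_mul_right (h _ (by omega) (by omega)), ih fun l h1 h2 => h l h1 (by omega)]

theorem Tr_tau (D : Matrix (Fin N) (Fin N) ℂ) (s n : ℕ) (Z : Op N A) :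
    Tr D (s + 1) (tau D (s + 1) n Z) = tau D s (n + 1) Z := by
  induction n generalizing Z with
  | zero => rfl
  | succ n ih => rw [tau, ih, tau, tau, tau, show s + 1 + n + 1 = s + (n + 1) + 1 by omega]

/-- The operators which cycle under the `D`-trace over the legs `1, …, n`. -/
def TauCyclic (D : Matrix (Fin N) (Fin N) ℂ) (n : ℕ) (c : Op N A) : Prop :=
  ∀ Z, tau D 0 n (c * Z) = tau D 0 n (Z * c)

namespace TauCyclic

variable {D : Matrix (Fin N) (Fin N) ℂ} {n : ℕ} {b c : Op N A}

theorem one : TauCyclic D n (1 : Op N A) := fun Z => by rw [one_mul, mul_one]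

theorem mul (hb : TauCyclic D n b) (hc : TauCyclic D n c) : TauCyclic D n (b * c) := fun Z => by
  rw [mul_assoc, hb, mul_assoc, hc, mul_assoc]

theorem add (hb : TauCyclic D n b) (hc : TauCyclic D n c) : TauCyclic D n (b + c) := fun Z => by
  rw [add_mul, mul_add, tau_add, tau_add, hb, hc]

theorem smul (z : ℂ) (hc : TauCyclic D n c) : TauCyclic D n (z • c) := fun Z => by
  rw [smul_mul_assoc, mul_smul_comm, tau_smul, tau_smul, hc]

theorem kap {x : ℕ → Op N A} {s m : ℕ} (h : ∀ i, i < m → TauCyclic D n (x (s + i))) :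
    TauCyclic D n (kap x s m) := by
  induction m with
  | zero => exact one
  | succ m ih => exact (ih fun i hi => h i (by omega)).mul (h m (by omega))

theorem aS {q μ : ℂ} {r k : ℕ → Op N A} {m : ℕ} (hr : ∀ i, i + 1 < m → TauCyclic D n (r i))
    (hk : ∀ i, i + 1 < m → TauCyclic D n (k i)) : TauCyclic D n (aS q μ r k m) := by
  induction m with
  | zero => exact one
  | succ m ih =>
    cases m with
    | zero => exact one
    | succ m =>
      have e := ih (fun i hi => hr i (by omega)) fun i hi => hk i (by omega)
      exact ((e.mul ((one.add ((hr m (by omega)).smul _)).add ((hk m (by omega)).smul _))).mul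
        e).smul _

theorem leg {X : MatV N 2 ℂ} (h : Commute (kr D D) X) {i : ℕ} (hi : 1 ≤ i) (hn : i + 1 ≤ n) :
    TauCyclic D n (leg A X i) := by
  intro Z
  induction n generalizing Z with
  | zero => omega
  | succ n ih =>
    rcases Nat.lt_or_ge i n with h1 | h1
    · have o : Off (0 + n + 1) (QMA.leg A X i) := Off.leg X (by omega)
      rw [tau, tau, Tr_mul_left o, Tr_mul_right o, ih (by omega)]
    · obtain rfl : i = n := by omega
      obtain ⟨p, rfl⟩ : ∃ p, i = p + 1 := ⟨i - 1, by omega⟩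
      have c : Commute (opOne A (p + 1) D * opOne A (p + 1 + 1) D)
          (opTwo A (p + 1) (p + 1 + 1) X) := by
        rw [← opTwo_kr]
        show _ * _ = _ * _
        rw [← opTwo_mul (by omega), ← opTwo_mul (by omega), h.eq]
      rw [tau, tau, tau, tau, zero_add, zero_add]
      exact congrArg _ (trace_cyclic_two (by omega) c Z)

end TauCyclic

variable [NeZero N] {R F ΨR ΨF ΨG : MatV N 2 ℂ} {q μ : ℂ}

namespace PairData

theorem kr_commute (h : PairData q μ R F ΨR ΨF ΨG) : Commute (kr (Dof ΨR) (Dof ΨR)) R :=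
  mul_kr_comm h.bmw.braid.twist h.bmw.det h.skR h.skR

theorem kr_commute_bmwK (h : PairData q μ R F ΨR ΨF ΨG) :
    Commute (kr (Dof ΨR) (Dof ΨR)) (bmwK q μ R) := by
  have c := h.kr_commute
  have c1 := Commute.one_right (kr (Dof ΨR) (Dof ΨR))
  exact (((c1.smul_right q).sub_right c).mul_right ((c1.smul_right q⁻¹).add_right c)).smul_right _

theorem exists_contraction (h : PairData q μ R F ΨR ΨF ΨG) (M : Matrix (Fin N) (Fin N) A) :
    ∃ γ : A, leg A (bmwK q μ R) 0 * (mleg F M 0 * mleg F M 1) * leg A (bmwK q μ R) 0 =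
      gam N γ * leg A (bmwK q μ R) 0 := by
  have key : ∀ s t u v, ∃ θ : ℂ, leg A (bmwK q μ R) 0 *
      (eU A 0 s t * (leg A F 0 * eU A 0 u v * leg A F⁻¹ 0)) * leg A (bmwK q μ R) 0 =
        θ • leg A (bmwK q μ R) 0 := by
    intro s t u v
    have e : ∀ s t : Fin N, eU A 0 s t = opTwo A 0 1 (kr (Matrix.single s t 1) 1) := fun s t => by
      rw [opTwo_kr, opOne_one, mul_one, opOne_single]
    obtain ⟨θ, hθ⟩ := h.bmw.rank_one h.ne h.skR h.detD
      (kr (Matrix.single s t 1) 1 * (F * kr (Matrix.single u v 1) 1 * F⁻¹))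
    refine ⟨θ, ?_⟩
    rw [leg, leg, leg, e, e, zero_add, ← opTwo_mul (by omega), ← opTwo_mul (by omega),
      ← opTwo_mul (by omega), ← opTwo_mul (by omega), ← opTwo_mul (by omega), hθ, opTwo_smul]
  have e2 : ∀ f : Fin N → A, gam N (∑ s, f s) = ∑ s, gam N (f s) := fun f =>
    map_sum (AddMonoidHom.mk' (gam N) (fun x y => gam_add x y)) f Finset.univ
  have lin : ∀ φ : Op N A →+ Op N A,
      (∀ s t, ∃ γ, φ (gam N (M s t) * eU A 0 s t) = gam N γ * leg A (bmwK q μ R) 0) →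
        ∃ γ, φ (iot M) = gam N γ * leg A (bmwK q μ R) 0 := by
    intro φ hφ
    choose γ hγ using hφ
    refine ⟨∑ s, ∑ t, γ s t, ?_⟩
    rw [iot, map_sum]
    simp only [map_sum, hγ, e2, Finset.sum_mul]
  refine lin ((AddMonoidHom.mulRight (leg A (bmwK q μ R) 0)).comp
    ((AddMonoidHom.mulLeft (leg A (bmwK q μ R) 0)).comp
      (AddMonoidHom.mulRight (mleg F M 1)))) fun s t => ?_
  refine lin ((AddMonoidHom.mulRight (leg A (bmwK q μ R) 0)).comp
    ((AddMonoidHom.mulLeft (leg A (bmwK q μ R) 0)).comp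
      ((AddMonoidHom.mulLeft (gam N (M s t) * eU A 0 s t)).comp
        ((AddMonoidHom.mulRight (leg A F⁻¹ 0)).comp
          (AddMonoidHom.mulLeft (leg A F 0)))))) fun u v => ?_
  obtain ⟨θ, hθ⟩ := key s t u v
  refine ⟨θ • (M s t * M u v), ?_⟩
  show leg A (bmwK q μ R) 0 * (gam N (M s t) * eU A 0 s t *
    (leg A F 0 * (gam N (M u v) * eU A 0 u v) * leg A F⁻¹ 0)) * leg A (bmwK q μ R) 0 = _
  calc _ = leg A (bmwK q μ R) 0 * (gam N (M s t) * eU A 0 s t *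
        ((leg A F 0 * gam N (M u v)) * eU A 0 u v * leg A F⁻¹ 0)) *
          leg A (bmwK q μ R) 0 := by simp only [mul_assoc]
    _ = leg A (bmwK q μ R) 0 * (gam N (M s t) * (eU A 0 s t * gam N (M u v)) *
        (leg A F 0 * eU A 0 u v * leg A F⁻¹ 0)) * leg A (bmwK q μ R) 0 := by
      rw [← (gam_commute_leg (M u v) F 0).eq]
      simp only [mul_assoc]
    _ = (leg A (bmwK q μ R) 0 * gam N (M s t * M u v)) * (eU A 0 s t *
        (leg A F 0 * eU A 0 u v * leg A F⁻¹ 0)) * leg A (bmwK q μ R) 0 := by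
      rw [← (gam_comm_eU (M u v) 0 s t).eq, gam_mul]
      simp only [mul_assoc]
    _ = gam N (M s t * M u v) * (leg A (bmwK q μ R) 0 * (eU A 0 s t *
        (leg A F 0 * eU A 0 u v * leg A F⁻¹ 0)) * leg A (bmwK q μ R) 0) := by
      rw [← (gam_commute_leg _ _ _).eq]
      simp only [mul_assoc]
    _ = _ := by rw [hθ, gam_smul, mul_smul_comm, smul_mul_assoc]

theorem exists_kleg_mul_pair (h : PairData q μ R F ΨR ΨF ΨG) {M : Matrix (Fin N) (Fin N) A}
    (hM : Commute (leg A R 0) (mleg F M 0 * mleg F M 1)) :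
    ∃ γ : A, (∀ j, mleg F M j * mleg F M (j + 1) * leg A (bmwK q μ R) j =
        gam N γ * leg A (bmwK q μ R) j) ∧
      gam N (gElt q μ R F ΨR M) = (μ ^ 2) • gam N γ := by
  obtain ⟨γ, hγ⟩ := h.exists_contraction M
  have hη := h.bmw.eta_ne
  have h0 : mleg F M 0 * mleg F M 1 * leg A (bmwK q μ R) 0 =
      gam N ((etaC q μ)⁻¹ • γ) * leg A (bmwK q μ R) 0 := by
    have sq : leg A (bmwK q μ R) 0 * leg A (bmwK q μ R) 0 = etaC q μ • leg A (bmwK q μ R) 0 :=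
      h.bmw.sq (by omega)
    have e : leg A (bmwK q μ R) 0 * (mleg F M 0 * mleg F M 1) * leg A (bmwK q μ R) 0 =
        etaC q μ • (mleg F M 0 * mleg F M 1 * leg A (bmwK q μ R) 0) := by
      rw [(h.kleg_commute_mleg_pair hM 0).eq, mul_assoc, sq, mul_smul_comm]
    rw [gam_smul, smul_mul_assoc, ← hγ, e, smul_smul, inv_mul_cancel₀ hη, one_smul]
  refine ⟨(etaC q μ)⁻¹ • γ, fun j => ?_, ?_⟩
  · induction j with
    | zero => exact h0
    | succ j ih =>
      have sK := h.twK.semiconj_leg (A := A) (i := j) (m := j + 2) (by omega)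
      have sW := (h.semiconj_mleg M (i := j) (m := j + 2) (by omega)).mul_right
        (h.semiconj_mleg M (i := j + 1) (m := j + 2) (by omega))
      have sg : SemiconjBy (kap (leg A F) 0 (j + 2)) (gam N ((etaC q μ)⁻¹ • γ)) (gam N _) :=
        (kap_commute fun i _ => gam_commute_leg _ F _).symm
      refine (h.isUnit_kap_leg (A := A) (j + 2)).mul_left_injective ?_
      exact (sW.mul_right sK).eq.symm.trans ((congrArg _ ih).trans (sg.mul_right sK).eq)
  · have e : μ * (q - q⁻¹) / ((q - μ) * (q⁻¹ + μ)) = (etaC q μ)⁻¹ := by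
      rw [etaC, _root_.mul_inv_rev, _root_.mul_inv_rev, _root_.mul_inv_rev, inv_inv, inv_inv, div_eq_mul_inv,
        _root_.mul_inv_rev]
      ring
    have e2 : emb (Fin.val : Fin 2 → ℕ) (Mprod F M 2 * cmap (lift2 0 (bmwK q μ R))) =
        mleg F M 0 * mleg F M 1 * leg A (bmwK q μ R) 0 := by
      rw [emb_mul Fin.val_injective, emb_Mprod F M le_rfl, emb_cmap_lift2 (by omega)]
      simp [kap]
    have o : ∀ l, Off l (gam N ((etaC q μ)⁻¹ • γ)) := fun l => Off.gam _
    have t : Tr (Dof ΨR) 1 (leg A (bmwK q μ R) 0) = μ • 1 :=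
      h.bmw.Tr_k h.ne h.skR (by omega)
    rw [gElt, gam_smul, gam_trAll_two, e2, h0, Tr_mul_left (o 1), Tr_mul_left (o 0), t, map_smul,
      Tr_one, h.bmw.trace_eq h.ne h.skR, smul_smul, mul_smul_comm, smul_smul, e, mul_one]
    congr 1
    field_simp

end PairData

end Cyclic

section Cutting

variable {N : ℕ} {A : Type*} [Ring A] [Algebra ℂ A]
variable {R F ΨR ΨF ΨG : MatV N 2 ℂ} {q μ : ℂ}

/-- The antisymmetrizer of `m` factors starting at leg `s`. -/
def legS (A : Type*) [Ring A] [Algebra ℂ A] (q μ : ℂ) (R : MatV N 2 ℂ) (s m : ℕ) : Op N A :=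
  aS q μ (fun i => leg A R (s + i)) (fun i => leg A (bmwK q μ R) (s + i)) m

theorem legS_zero (m : ℕ) : legS A q μ R 0 m = aS q μ (leg A R) (leg A (bmwK q μ R)) m :=
  aS_congr (fun i _ => by rw [zero_add]) fun i _ => by rw [zero_add]

theorem Off.legS {s m l : ℕ} (h : l < s ∨ s + m ≤ l) : Off l (legS A q μ R s m) := fun a b =>
  (aS_commute (fun i hi => (Off.leg R (by omega) a b).symm)
    fun i hi => (Off.leg (bmwK q μ R) (by omega) a b).symm).symm

theorem gam_commute_legS (x : A) (s m : ℕ) : Commute (gam N x) (legS A q μ R s m) :=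
  (aS_commute (fun _ _ => (gam_commute_leg x _ _).symm) fun _ _ =>
    (gam_commute_leg x _ _).symm).symm

variable [NeZero N]

theorem iot_Mwedge (hq : q ≠ 0) (M : Matrix (Fin N) (Fin N) A) (n : ℕ) :
    iot (Mwedge q μ R F ΨR M (n + 1)) =
      tau (Dof ΨR) 0 n (kap (mleg F M) 0 (n + 1) * legS A q μ R 0 (n + 1)) := by
  rw [Mwedge, iot_trTail, emb_mul Fin.val_injective, emb_Mprod F M le_rfl, emb_asym q μ hq,
    legS_zero]

/-- The wedge power of `M` with the first factor of the product removed. -/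
def Mcut (q μ : ℂ) (R F ΨR : MatV N 2 ℂ) (M : Matrix (Fin N) (Fin N) A) (n : ℕ) :
    Matrix (Fin N) (Fin N) A :=
  toN (trTail (cmap (Dof ΨR)) n (MprodFrom2 F M n * cmap (asym q μ R (n + 1))))

theorem iot_Mcut (hq : q ≠ 0) (M : Matrix (Fin N) (Fin N) A) (n : ℕ) :
    iot (Mcut q μ R F ΨR M n) =
      tau (Dof ΨR) 0 n (kap (mleg F M) 1 n * legS A q μ R 0 (n + 1)) := by
  rw [Mcut, iot_trTail, emb_mul Fin.val_injective, emb_MprodFrom2 F M (Nat.lt_succ_self n),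
    emb_asym q μ hq, legS_zero]

theorem mul_Mcut (hq : q ≠ 0) (M : Matrix (Fin N) (Fin N) A) (n : ℕ) :
    M * Mcut q μ R F ΨR M n = Mwedge q μ R F ΨR M (n + 1) := by
  refine iot_injective ?_
  rw [iot_mul, iot_Mcut hq, iot_Mwedge hq, kap_succ_left, mul_assoc]
  exact (tau_mul_left _ (fun l hl _ => Off.mleg (F := F) M (i := 0) hl) _).symm

namespace PairData

theorem semiconj_legS (h : PairData q μ R F ΨR ΨF ΨG) {s p m : ℕ} (hm : s + p ≤ m) :
    SemiconjBy (kap (leg A F) 0 m) (legS A q μ R s p) (legS A q μ R (s + 1) p) := by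
  have c : ∀ {X : MatV N 2 ℂ}, Twist A X F → ∀ i, i + 1 < p →
      leg A X (s + 1 + i) * kap (leg A F) 0 m = kap (leg A F) 0 m * leg A X (s + i) := by
    intro X hX i hi
    rw [show s + 1 + i = s + i + 1 by omega]
    exact (hX.semiconj_leg (by omega)).eq.symm
  exact (aS_slide (c h.twR) (c h.twK)).symm

theorem leg_mul_iot_Mwedge (h : PairData q μ R F ΨR ΨF ΨG) (M : Matrix (Fin N) (Fin N) A)
    (n : ℕ) : leg A F 0 * iot (Mwedge q μ R F ΨR M (n + 1)) * leg A F⁻¹ 0 =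
      tau (Dof ΨR) 1 n (kap (mleg F M) 1 (n + 1) * legS A q μ R 1 (n + 1)) := by
  rw [iot_Mwedge h.bmw.q0]
  refine (h.tau_shift (SemiconjBy.mul_right (QMA.SemiconjBy.kap fun i hi => ?_)
    (h.semiconj_legS (by omega))) fun l hl => ?_).symm
  · rw [zero_add, show 0 + 1 + i = i + 1 by omega]
    exact h.semiconj_mleg M hi
  · exact (Off.kap fun i hi => Off.mleg M (by omega)).mul (Off.legS (by omega))

theorem iot_mul_xi (h : PairData q μ R F ΨR ΨF ΨG) (M : Matrix (Fin N) (Fin N) A) (n : ℕ) :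
    iot (M * xi q μ R F ΨR (Mwedge q μ R F ΨR M (n + 1))) =
      tau (Dof ΨR) 0 (n + 1) (kap (mleg F M) 0 (n + 2) * legS A q μ R 1 (n + 1) *
        leg A (bmwK q μ R) 0) := by
  have o : ∀ l, 1 < l → l ≤ 1 + n → Off l (leg A (bmwK q μ R) 0) := fun l hl _ =>
    Off.leg _ (by omega)
  rw [iot_mul, iot_xi, h.leg_mul_iot_Mwedge, ← tau_mul_right _ o, Tr_tau _ 0 n, kap_succ_left (mleg F M) 0, mul_assoc,
    mul_assoc, mul_assoc, tau_mul_left _ (fun l hl _ => Off.mleg (F := F) M (i := 0) hl)]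
  rfl

theorem phiOp_mul_xi (h : PairData q μ R F ΨR ΨF ΨG) (M : Matrix (Fin N) (Fin N) A) (n : ℕ) :
    phiOp R F ΨR (iot (M * xi q μ R F ΨR (Mwedge q μ R F ΨR M (n + 1)))) =
      tau (Dof ΨR) 0 (n + 2) (kap (mleg F M) 1 (n + 2) * legS A q μ R 2 (n + 1) *
        leg A (bmwK q μ R) 1 * leg A R 0) := by
  have o : ∀ l, 1 < l → l ≤ 1 + (n + 1) → Off l (leg A R 0) := fun l hl _ =>
    Off.leg _ (by omega)
  have e : leg A F 0 * iot (M * xi q μ R F ΨR (Mwedge q μ R F ΨR M (n + 1))) * leg A F⁻¹ 0 =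
      tau (Dof ΨR) 1 (n + 1) (kap (mleg F M) 1 (n + 2) * legS A q μ R 2 (n + 1) *
        leg A (bmwK q μ R) 1) := by
    rw [h.iot_mul_xi]
    refine (h.tau_shift (SemiconjBy.mul_right (SemiconjBy.mul_right
      (QMA.SemiconjBy.kap fun i hi => ?_) (h.semiconj_legS (by omega)))
      (h.twK.semiconj_leg (by omega))) fun l hl => ?_).symm
    · rw [zero_add, show 0 + 1 + i = i + 1 by omega]
      exact h.semiconj_mleg M hi
    · exact ((Off.kap fun i hi => Off.mleg M (by omega)).mul (Off.legS (by omega))).mul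
        (Off.leg _ (by omega))
  rw [← Tr_tau, tau_mul_right _ o, ← e]
  rfl

theorem tau_kap_mul_kleg (h : PairData q μ R F ΨR ΨF ΨG) {M : Matrix (Fin N) (Fin N) A}
    (hM : Commute (leg A R 0) (mleg F M 0 * mleg F M 1)) (n : ℕ) :
    tau (Dof ΨR) 0 (n + 2) (kap (mleg F M) 1 (n + 2) *
        (leg A (bmwK q μ R) (n + 1) * legS A q μ R 0 (n + 1))) =
      etaC q μ • (iot (Mcut q μ R F ΨR M n) * gam N (gElt q μ R F ΨR M)) := by
  obtain ⟨γ, hγ, hg⟩ := h.exists_kleg_mul_pair hM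
  have oP : ∀ {l}, n < l → Off l (kap (mleg F M) 1 n) := fun hl =>
    Off.kap fun i hi => Off.mleg M (by omega)
  have oS : ∀ {l}, n < l → Off l (legS A q μ R 0 (n + 1)) := fun hl => Off.legS (by omega)
  have e : kap (mleg F M) 1 (n + 2) * (leg A (bmwK q μ R) (n + 1) * legS A q μ R 0 (n + 1)) =
      kap (mleg F M) 1 n * gam N γ * leg A (bmwK q μ R) (n + 1) * legS A q μ R 0 (n + 1) := by
    have e1 := hγ (n + 1)
    rw [kap, kap, show 1 + n = n + 1 by omega, show 1 + (n + 1) = n + 1 + 1 by omega, ← mul_assoc,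
      mul_assoc (kap (mleg F M) 1 n), mul_assoc (kap (mleg F M) 1 n), e1]
    simp only [mul_assoc]
  have t : Tr (Dof ΨR) (n + 2) (leg A (bmwK q μ R) (n + 1)) = μ • 1 :=
    h.bmw.Tr_k h.ne h.skR (by omega)
  rw [e, tau, tau, zero_add, zero_add, Tr_mul_right (oS (by omega)),
    Tr_mul_left ((oP (by omega)).mul (Off.gam γ)), t, mul_smul_comm, mul_one, smul_mul_assoc,
    map_smul, ← mul_one (_ * legS A q μ R 0 (n + 1)),
    Tr_mul_left (((oP (by omega)).mul (Off.gam γ)).mul (oS (by omega))), Tr_one,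
    h.bmw.trace_eq h.ne h.skR, mul_smul_comm, mul_one, smul_smul, tau_smul, mul_assoc,
    (gam_commute_legS γ 0 (n + 1)).eq, ← mul_assoc (kap _ _ _),
    tau_mul_right _ fun l _ _ => Off.gam γ,
    ← iot_Mcut h.bmw.q0, hg, mul_smul_comm, smul_smul]
  congr 1
  ring

theorem phiOp_mul_xi_Mwedge (h : PairData q μ R F ΨR ΨF ΨG) {M : Matrix (Fin N) (Fin N) A}
    (hM : Commute (leg A R 0) (mleg F M 0 * mleg F M 1)) {n : ℕ} (hG : Generic q μ (n + 1))
    (hx : μ = -q⁻¹ * spx q (n + 1)) :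
    phiOp R F ΨR (iot (M * xi q μ R F ΨR (Mwedge q μ R F ΨR M (n + 2)))) =
      (-q) • (iot (Mcut q μ R F ΨR M (n + 1)) * gam N (gElt q μ R F ΨR M)) := by
  set D := Dof ΨR
  set k : ℕ → Op N A := leg A (bmwK q μ R)
  set P := kap (mleg F M) 1 (n + 3)
  have hη := h.bmw.eta_ne
  have eη : etaC q μ • k 1 = kap k 1 (n + 2) * kapR k 1 (n + 2) := by
    have sq : k (1 + (n + 1)) * k (1 + (n + 1)) = etaC q μ • k (1 + (n + 1)) :=
      h.bmw.sq (by omega)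
    have e := kap_mul_kapR (h.bmw.chain (A := A) (n + 3)) (s := 1) (n := n + 1) (by omega)
    calc etaC q μ • k 1 = etaC q μ • (kap k 1 (n + 1) * k (1 + (n + 1)) * kapR k 1 (n + 1)) :=
          congrArg _ e.symm
      _ = kap k 1 (n + 1) * (etaC q μ • k (1 + (n + 1))) * kapR k 1 (n + 1) := by
          rw [mul_smul_comm, smul_mul_assoc]
      _ = _ := by
          rw [← sq, kap.eq_2 k 1 (n + 1), kapR.eq_2 k 1 (n + 1)]
          simp only [mul_assoc]
  have cP : Commute (legS A q μ R 2 (n + 2) * kap k 1 (n + 2)) P :=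
    Commute.mul_left
      (aS_commute (fun i hi => h.rleg_commute_kap hM (by omega) (by omega))
        fun i hi => h.kleg_commute_kap hM (by omega) (by omega))
      (kap_commute fun i hi => (h.kleg_commute_kap hM (by omega) (by omega)).symm).symm
  have cy : TauCyclic D (n + 3) (legS A q μ R 2 (n + 2) * kap k 1 (n + 2)) :=
    (TauCyclic.aS (fun i hi => TauCyclic.leg h.kr_commute (by omega) (by omega))
      fun i hi => TauCyclic.leg h.kr_commute_bmwK (by omega) (by omega)).mul
      (TauCyclic.kap fun i hi => TauCyclic.leg h.kr_commute_bmwK (by omega) (by omega))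
  have cut : kapR k 1 (n + 2) * leg A R 0 * legS A q μ R 2 (n + 2) * kap k 1 (n + 2) =
      (-q) • (k (n + 2) * legS A q μ R 0 (n + 2)) := by
    rw [legS_zero]
    exact cap_aS_cup hG (h.bmw.chain (n + 3)) hx
  have e : etaC q μ • (P * legS A q μ R 2 (n + 2) * k 1 * leg A R 0) =
      legS A q μ R 2 (n + 2) * kap k 1 (n + 2) * (P * (kapR k 1 (n + 2) * leg A R 0)) := by
    rw [← smul_mul_assoc, ← mul_smul_comm, eη, ← mul_assoc _ P, cP.eq]
    simp only [mul_assoc]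
  have e2 : etaC q μ • tau D 0 (n + 3) (P * legS A q μ R 2 (n + 2) * k 1 * leg A R 0) =
      etaC q μ • (-q) • (iot (Mcut q μ R F ΨR M (n + 1)) * gam N (gElt q μ R F ΨR M)) := by
    rw [← tau_smul, e, cy]
    have e3 : P * (kapR k 1 (n + 2) * leg A R 0) *
        (legS A q μ R 2 (n + 2) * kap k 1 (n + 2)) =
          (-q) • (P * (k (n + 2) * legS A q μ R 0 (n + 2))) := by
      rw [← mul_smul_comm, ← cut]
      simp only [mul_assoc]
    rw [e3, tau_smul, h.tau_kap_mul_kleg hM, smul_comm]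
  rw [h.phiOp_mul_xi]
  exact smul_right_injective _ hη e2

end PairData

end Cutting

theorem mul_rmulE {N : ℕ} {A : Type*} [Ring A] (X Y : Matrix (Fin N) (Fin N) A)
    (x : A) : X * rmulE Y x = rmulE (X * Y) x := by
  ext a b
  simp only [rmulE, Matrix.mul_apply, Finset.sum_mul, mul_assoc]

section Descendants

variable {N : ℕ} {A : Type*} [Ring A] [Algebra ℂ A]

theorem rmulE_smul (c : ℂ) (X : Matrix (Fin N) (Fin N) A) (x : A) :
    rmulE (c • X) x = c • rmulE X x := by
  ext a b
  exact smul_mul_assoc c (X a b) x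

theorem PairData.phiInvOp_smul_mul_gam {R F ΨR ΨF ΨG : MatV N 2 ℂ} (c : ℂ) (Y : Op N A) (x : A) :
    PairData.phiInvOp R F ΨR ΨF ΨG (c • (Y * gam N x)) =
      c • (PairData.phiInvOp R F ΨR ΨF ΨG Y * gam N x) := by
  rw [phiInvOp, phiInvOp, ← Tr_mul_right (Off.gam x), ← map_smul]
  have c1 : ∀ X : MatV N 2 ℂ, gam N x * opTwo A 0 1 X = opTwo A 0 1 X * gam N x :=
    fun X => (gam_commute_leg x X 0).eq
  simp only [mul_smul_comm, smul_mul_assoc, mul_assoc, c1]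

theorem PairData.phiOp_smul_mul_gam {R F ΨR : MatV N 2 ℂ} (c : ℂ) (Y : Op N A) (x : A) :
    PairData.phiOp R F ΨR (c • (Y * gam N x)) = c • (PairData.phiOp R F ΨR Y * gam N x) := by
  rw [phiOp, phiOp, ← Tr_mul_right (Off.gam x), ← map_smul]
  have c1 : ∀ X : MatV N 2 ℂ, gam N x * opTwo A 0 1 X = opTwo A 0 1 X * gam N x :=
    fun X => (gam_commute_leg x X 0).eq
  simp only [mul_smul_comm, smul_mul_assoc, mul_assoc, c1]

variable [NeZero N] {R F ΨR ΨF ΨG : MatV N 2 ℂ} {q μ : ℂ}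

theorem Lmap_smul_rmulE (M X : Matrix (Fin N) (Fin N) A) (c : ℂ) (x : A) :
    Lmap R F ΨR M (c • rmulE X x) = c • rmulE (Lmap R F ΨR M X) x := by
  have e : phi R F ΨR (c • rmulE X x) = c • rmulE (phi R F ΨR X) x := iot_injective <| by
    rw [iot_phi, iot_smul, iot_rmulE, PairData.phiOp_smul_mul_gam, iot_smul, iot_rmulE, iot_phi]
  rw [Lmap, e, mul_smul_comm, mul_rmulE, Lmap]

theorem Lmap_iterate_smul_rmulE (M X : Matrix (Fin N) (Fin N) A) (c : ℂ) (x : A) (m : ℕ) :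
    (Lmap R F ΨR M)^[m] (c • rmulE X x) = c • rmulE ((Lmap R F ΨR M)^[m] X) x := by
  induction m generalizing X with
  | zero => rfl
  | succ m ih =>
    rw [Function.iterate_succ_apply, Lmap_smul_rmulE, ih, Function.iterate_succ_apply]

theorem xi_eq_zero (hK : bmwK q μ R = 0) (X : Matrix (Fin N) (Fin N) A) :
    xi q μ R F ΨR X = 0 := by
  refine iot_injective ?_
  have e : leg A (0 : MatV N 2 ℂ) 0 = 0 := by
    have := opTwo_smul (A := A) 0 1 (0 : ℂ) (0 : MatV N 2 ℂ)
    rwa [zero_smul, zero_smul] at this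
  have e2 := iot_smul (A := A) 0 (0 : Matrix (Fin N) (Fin N) A)
  rw [zero_smul, zero_smul] at e2
  rw [iot_xi, hK, e, mul_zero, map_zero, e2]

theorem gElt_eq_zero (hK : bmwK q μ R = 0) (M : Matrix (Fin N) (Fin N) A) :
    gElt q μ R F ΨR M = 0 := by
  have e : cmap (A := A) (lift2 (n := 2) 0 (0 : MatV N 2 ℂ)) = 0 := by
    ext a b
    simp [cmap, lift2]
  rw [gElt, hK, e, mul_zero]
  simp [trAll, ptrace]

theorem commute_of_QMArel {M : Matrix (Fin N) (Fin N) A} (hM : QMArel R F M) :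
    Commute (leg A R 0) (mleg F M 0 * mleg F M 1) := by
  have e := congrArg (emb (Fin.val : Fin 2 → ℕ)) hM
  simp only [emb_mul Fin.val_injective, emb_cmap_lift2 (n := 2) (p := 0) (by omega),
    emb_Mcopy (n := 2) (j := 0) F M (by omega), emb_Mcopy (n := 2) (j := 1) F M (by omega)] at e
  rw [mul_assoc] at e
  exact e

namespace PairData

variable {M : Matrix (Fin N) (Fin N) A} {n : ℕ}

theorem phi_mul_xi (h : PairData q μ R F ΨR ΨF ΨG) (hM : QMArel R F M)
    (hG : Generic q μ (n + 1)) (hx : μ = -q⁻¹ * spx q (n + 1)) :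
    phi R F ΨR (M * xi q μ R F ΨR (Mwedge q μ R F ΨR M (n + 2))) =
      (-q) • rmulE (Mcut q μ R F ΨR M (n + 1)) (gElt q μ R F ΨR M) := iot_injective <| by
  rw [iot_phi, h.phiOp_mul_xi_Mwedge (commute_of_QMArel hM) hG hx, iot_smul, iot_rmulE]

theorem mul_xi_eq (h : PairData q μ R F ΨR ΨF ΨG) {ΨR' : MatV N 2 ℂ} (hΨ' : SkewPair R⁻¹ ΨR')
    (hM : QMArel R F M) (hG : Generic q μ (n + 1)) (hx : μ = -q⁻¹ * spx q (n + 1)) :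
    M * xi q μ R F ΨR (Mwedge q μ R F ΨR M (n + 2)) =
      (-q) • rmulE (phiInv μ R F ΨF ΨG ΨR' (Mcut q μ R F ΨR M (n + 1)))
        (gElt q μ R F ΨR M) := iot_injective <| by
  rw [iot_smul, iot_rmulE, h.iot_phiInv hΨ', ← phiInvOp_smul_mul_gam,
    ← h.phiOp_mul_xi_Mwedge (commute_of_QMArel hM) hG hx,
    h.phiInvOp_phiOp (Off.iot (by omega) _) (Off.iot (by omega) _) (Off.iot (by omega) _)]

theorem Lmap_iterate_mul_xi (h : PairData q μ R F ΨR ΨF ΨG) (hM : QMArel R F M)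
    (hG : Generic q μ (n + 1)) (hx : μ = -q⁻¹ * spx q (n + 1)) (m : ℕ) :
    (Lmap R F ΨR M)^[m + 1] (M * xi q μ R F ΨR (Mwedge q μ R F ΨR M (n + 2))) =
      (-q) • rmulE ((Lmap R F ΨR M)^[m] (Mwedge q μ R F ΨR M (n + 2)))
        (gElt q μ R F ΨR M) := by
  rw [Function.iterate_succ_apply, Lmap, h.phi_mul_xi hM hG hx, mul_smul_comm, mul_rmulE,
    mul_Mcut hG.q0, Lmap_iterate_smul_rmulE]

end PairData

theorem BMWData.of_ne (hq0 : q ≠ 0) (hq1 : q ≠ 1) (hqm1 : q ≠ -1) (hμ0 : μ ≠ 0) (hμq : μ ≠ q)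
    (hμq' : μ ≠ -q⁻¹) (hb : IsBraid R) (hd : IsUnit R.det) (hbmw : IsBMW q μ R) :
    BMWData q μ R where
  braid := hb
  det := hd
  bmw := hbmw
  q0 := hq0
  mu := hμ0
  lam h := by
    have e : (q - 1) * (q + 1) = q * (q - q⁻¹) := by
      field_simp
      ring
    rw [h, mul_zero] at e
    rcases mul_eq_zero.1 e with e | e
    · exact hq1 (sub_eq_zero.1 e)
    · exact hqm1 (eq_neg_of_add_eq_zero_left e)
  eta := mul_ne_zero (sub_ne_zero.2 hμq.symm) fun e => hμq' (eq_neg_of_add_eq_zero_right e)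

end Descendants

/-- **Linear dependence of the two cutting conditions in the symplectic case**
(eq. (4.8) of Ogievetsky–Pyatov).

For a compatible pair `{R,F}` with `F` strict skew invertible and `R` skew invertible of BMW
type with `μ = -q^{-1-2k}`, and antisymmetrizers defined for `1 ≤ i ≤ k+1`, one has
`B^{(m+1,k+1)} + q A^{(m-1,k+1)} g = 0` for every `m ≥ 0`. -/
theorem symplectic_cutting_conditions_dependence
    {N : ℕ} [NeZero N] (k : ℕ) (q μ : ℂ)
    (hq0 : q ≠ 0) (hq1 : q ≠ 1) (hqm1 : q ≠ -1)
    (hμ0 : μ ≠ 0) (hμq : μ ≠ q) (hμq' : μ ≠ -q⁻¹)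
    (hiq : ∀ i : ℕ, 2 ≤ i → i ≤ k + 1 → nq q i ≠ 0)
    (hμi : ∀ i : ℕ, 1 ≤ i → i ≤ k → μ ≠ -q ^ (1 - 2 * (i : ℤ)))
    (R F ΨR ΨF ΨFinv ΨRinv : MatV N 2 ℂ)
    (hRbraid : IsBraid R) (hRdet : IsUnit R.det)
    (hFbraid : IsBraid F) (hFdet : IsUnit F.det)
    (hcomp : Compatible R F)
    (hΨR : SkewPair R ΨR) (hΨF : SkewPair F ΨF)
    (hΨFinv : SkewPair F⁻¹ ΨFinv) (hΨRinv : SkewPair R⁻¹ ΨRinv)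
    (hRstrict : IsUnit (Dof ΨR).det) (hFstrict : IsUnit (Dof ΨF).det)
    (hRinvstrict : IsUnit (Dof ΨRinv).det)
    (hbmw : IsBMW q μ R)
    (hμval : μ = -q ^ (-1 - 2 * (k : ℤ)))
    (A : Type*) [Ring A] [Algebra ℂ A]
    (M : Matrix (Fin N) (Fin N) A)
    (hM : QMArel R F M) :
    ∀ m : ℕ,
      Bd q μ R F ΨR ΨF ΨFinv ΨRinv M (m + 1) (k + 1) +
        q • rmulE (AdS q μ R F ΨR ΨF ΨFinv ΨRinv M m (k + 1)) (gElt q μ R F ΨR M) = 0 := by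
  intro m
  by_cases hK : bmwK q μ R = 0
  · have e := Lmap_iterate_smul_rmulE (R := R) (F := F) (ΨR := ΨR) M 0 0 0 m
    rw [zero_smul, zero_smul] at e
    have e2 : ∀ X : Matrix (Fin N) (Fin N) A, rmulE X 0 = 0 := fun X => by
      ext a b
      exact mul_zero _
    rw [Bd, xi_eq_zero hK, mul_zero, e, smul_zero, gElt_eq_zero hK, e2, smul_zero, add_zero]
  have hx : μ = -q⁻¹ * spx q k := by
    rw [hμval, sub_eq_add_neg, zpow_add₀ hq0, spx, neg_mul, _root_.zpow_neg_one]
  cases k with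
  | zero => exact absurd (by simpa [spx] using hx) hμq'
  | succ n =>
    have hb := BMWData.of_ne hq0 hq1 hqm1 hμ0 hμq hμq' hRbraid hRdet hbmw
    have h : PairData q μ R F ΨR ΨF ΨFinv :=
      ⟨hb, hK, hFbraid, hFdet, hcomp, hΨR, hΨF, hΨFinv, hRstrict⟩
    have hG : Generic q μ (n + 1) := ⟨hq0, hb.lam, hμ0, hiq, fun i h1 h2 e => hμi i h1 h2 <| by
      rw [sub_eq_add_neg, zpow_add₀ hq0, zpow_one]
      exact eq_neg_of_add_eq_zero_left e⟩
    have fin : ∀ X : Matrix (Fin N) (Fin N) A, nq q (n + 2) • (-q) • rmulE X (gElt q μ R F ΨR M) +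
        q • rmulE (nq q (n + 2) • X) (gElt q μ R F ΨR M) = 0 := fun X => by
      rw [rmulE_smul, smul_smul, smul_smul, ← add_smul]
      convert zero_smul ℂ _
      ring
    cases m with
    | zero =>
      have e := h.mul_xi_eq hΨRinv hM hG hx
      rw [Bd, Function.iterate_zero_apply, e]
      exact fin _
    | succ m =>
      rw [Bd, h.Lmap_iterate_mul_xi hM hG hx]
      exact fin _

end QMA

end
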